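/- Let h ∈ ℤ[x] be an intersective polynomial of degree k ≥ 2. Then there exists a constant C depending only on h such that for all N sufficiently large depending on h, every subset A of {1, …, N} containing no two distinct elements a, a' with a − a' = h(n) for some integer n satisfies |A| ≤ C · N · (log log N)^{μ/(k−1)} / (log N)^{1/(k−1)}, where μ = 3 if k = 2 and μ = 2 if k ≥ 3. -/

import Mathlib

open Polynomial

/-- The additive character `x ↦ exp (2π i x)` on the reals. -/
noncomputable def expo (x : ℝ) : ℂ := Complex.exp ((2 * Real.pi * x : ℝ) * Complex.I)

lemma expo_add (x y : ℝ) : expo (x + y) = expo x * expo y := by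
  unfold expo
  rw [← Complex.exp_add]
  congr 1
  push_cast
  ring

lemma expo_zero : expo 0 = 1 := by simp [expo]

lemma norm_expo (x : ℝ) : ‖expo x‖ = 1 := by
  unfold expo
  exact Complex.norm_exp_ofReal_mul_I _

lemma expo_int (n : ℤ) : expo n = 1 := by
  unfold expo
  rw [Complex.exp_eq_one_iff]
  exact ⟨n, by push_cast; ring⟩

lemma expo_add_int (x : ℝ) (n : ℤ) : expo (x + n) = expo x := by
  rw [expo_add, expo_int, mul_one]

lemma conj_expo (x : ℝ) : (starRingEnd ℂ) (expo x) = expo (-x) := by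
  unfold expo
  rw [← Complex.exp_conj, map_mul, Complex.conj_ofReal, Complex.conj_I]
  congr 1
  push_cast
  ring

lemma expo_sub (x y : ℝ) : expo (x - y) = expo x * (starRingEnd ℂ) (expo y) := by
  rw [conj_expo, ← expo_add]; ring_nf

lemma expo_nat_mul (x : ℝ) (n : ℕ) : expo (n * x) = expo x ^ n := by
  unfold expo
  rw [← Complex.exp_nat_mul]
  congr 1
  push_cast; ring

lemma norm_expo_sub_expo_le (x y : ℝ) : ‖expo x - expo y‖ ≤ 2 * Real.pi * |x - y| := by
  have h : expo x - expo y = expo y * (expo (x - y) - 1) := by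
    rw [mul_sub, ← expo_add]; ring_nf
  rw [h, norm_mul, norm_expo, one_mul]
  unfold expo
  have := Real.norm_exp_I_mul_ofReal_sub_one_le (x := 2 * Real.pi * (x - y))
  rw [mul_comm Complex.I] at this
  refine this.trans ?_
  rw [Real.norm_eq_abs, abs_mul, abs_of_pos (by positivity : 0 < 2 * Real.pi)]

/-- `Near x ε` says that `x` is within `ε` of an integer. -/
def Near (x ε : ℝ) : Prop := ∃ a : ℤ, |x - a| ≤ ε

lemma Near.mono {x ε ε' : ℝ} (h : Near x ε) (hε : ε ≤ ε') : Near x ε' := by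
  obtain ⟨a, ha⟩ := h
  exact ⟨a, ha.trans hε⟩

lemma Near.add {x y ε ε' : ℝ} (h : Near x ε) (h' : Near y ε') : Near (x + y) (ε + ε') := by
  obtain ⟨a, ha⟩ := h
  obtain ⟨b, hb⟩ := h'
  refine ⟨a + b, ?_⟩
  calc |x + y - ((a + b : ℤ) : ℝ)| = |(x - a) + (y - b)| := by push_cast; ring_nf
    _ ≤ _ := (abs_add_le _ _).trans (add_le_add ha hb)

lemma Near.neg {x ε : ℝ} (h : Near x ε) : Near (-x) ε := by
  obtain ⟨a, ha⟩ := h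
  refine ⟨-a, ?_⟩
  rw [← abs_neg]
  push_cast
  convert ha using 2
  ring

lemma Near.sub {x y ε ε' : ℝ} (h : Near x ε) (h' : Near y ε') : Near (x - y) (ε + ε') := by
  rw [sub_eq_add_neg]; exact h.add h'.neg

lemma Near.int_mul {x ε : ℝ} (n : ℤ) (h : Near x ε) : Near (n * x) (|(n : ℝ)| * ε) := by
  obtain ⟨a, ha⟩ := h
  refine ⟨n * a, ?_⟩
  push_cast
  rw [← mul_sub, abs_mul]
  gcongr

lemma Near.nat_mul {x ε : ℝ} (n : ℕ) (h : Near x ε) : Near (n * x) (n * ε) := by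
  simpa using h.int_mul (n : ℤ)

lemma near_half (x : ℝ) : Near x (1 / 2) := ⟨round x, abs_sub_round x⟩

lemma near_zero {ε : ℝ} (hε : 0 ≤ ε) : Near 0 ε := ⟨0, by simpa⟩

lemma Near.sum {ι : Type*} (s : Finset ι) (x ε : ι → ℝ) (h : ∀ i ∈ s, Near (x i) (ε i)) :
    Near (∑ i ∈ s, x i) (∑ i ∈ s, ε i) := by
  classical
  induction s using Finset.induction_on with
  | empty => simpa using near_zero le_rfl
  | insert i s hi ih =>
    rw [Finset.sum_insert hi, Finset.sum_insert hi]
    exact (h i (Finset.mem_insert_self _ _)).add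
      (ih fun j hj => h j (Finset.mem_insert_of_mem hj))

/-- The lower bound `4 ‖x‖ ≤ |e(x) - 1|` in terms of distance to the nearest integer. -/
lemma near_of_norm_expo_sub_one (x : ℝ) : Near x (‖expo x - 1‖ / 4) := by
  refine ⟨round x, ?_⟩
  set y := x - round x with hy
  have hy2 : |y| ≤ 1 / 2 := abs_sub_round x
  have h1 : expo x = expo y := by
    rw [← expo_add_int y (round x)]; simp [hy]
  rw [h1]
  have h2 : ‖expo y - 1‖ = ‖2 * Real.sin (Real.pi * y)‖ := by
    unfold expo
    have := Complex.norm_exp_I_mul_ofReal_sub_one (2 * Real.pi * y)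
    rw [mul_comm Complex.I] at this
    rw [this]; congr 2; ring_nf
  rw [h2, norm_mul, Real.norm_eq_abs, Real.norm_eq_abs, abs_two]
  have h3 : 2 / Real.pi * |Real.pi * y| ≤ |Real.sin (Real.pi * y)| := by
    apply Real.mul_abs_le_abs_sin
    rw [abs_mul, abs_of_pos Real.pi_pos]
    nlinarith [Real.pi_pos]
  rw [abs_mul, abs_of_pos Real.pi_pos] at h3
  have : 2 / Real.pi * (Real.pi * |y|) = 2 * |y| := by
    field_simp
  linarith

/-- The exponential sum of a real polynomial over `0 ≤ n < M`. -/
noncomputable def weylSum (P : ℝ[X]) (M : ℕ) : ℂ := ∑ n ∈ Finset.range M, expo (P.eval (n : ℝ))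

lemma norm_weylSum_le (P : ℝ[X]) (M : ℕ) : ‖weylSum P M‖ ≤ M := by
  unfold weylSum
  refine (norm_sum_le _ _).trans ?_
  simp [norm_expo]

lemma norm_sq_sum_le_correlations (z : ℕ → ℂ) (M : ℕ) :
    ‖∑ n ∈ Finset.range M, z n‖ ^ 2 ≤
      2 * ∑ h ∈ Finset.range M,
        ‖∑ n ∈ Finset.range (M - h), z (n + h) * (starRingEnd ℂ) (z n)‖ := by
  have key : ∀ M : ℕ, ‖∑ n ∈ Finset.range M, z n‖ ^ 2 + ∑ n ∈ Finset.range M, ‖z n‖ ^ 2 =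
      2 * (∑ m ∈ Finset.range M, ∑ k ∈ Finset.range (m + 1),
        z m * (starRingEnd ℂ) (z k)).re := by
    intro M
    induction M with
    | zero => simp
    | succ M ih =>
      rw [Finset.sum_range_succ, Finset.sum_range_succ, Finset.sum_range_succ (n := M), 
        Complex.add_re, mul_add, ← ih, ← Finset.mul_sum, Finset.sum_range_succ]
      simp only [← Complex.normSq_eq_norm_sq, Complex.normSq_add, mul_add,
        Complex.add_re, Complex.mul_conj, Complex.ofReal_re]
      rw [← map_sum (starRingEnd ℂ), mul_comm (z M)]
      have : ((∑ n ∈ Finset.range M, z n) * (starRingEnd ℂ) (z M)).re =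
        ((starRingEnd ℂ) (∑ n ∈ Finset.range M, z n) * z M).re := by
        simp [Complex.mul_re]
      rw [this]
      ring
  have h1 := key M
  have h2 : ∑ m ∈ Finset.range M, ∑ k ∈ Finset.range (m + 1), z m * (starRingEnd ℂ) (z k) =
      ∑ h ∈ Finset.range M, ∑ n ∈ Finset.range (M - h), z (n + h) * (starRingEnd ℂ) (z n) := by
    have := Finset.sum_range_diag_flip M (fun h n => z (n + h) * (starRingEnd ℂ) (z n))
    rw [← this]
    apply Finset.sum_congr rfl
    intro m _
    rw [← Finset.sum_range_reflect]
    apply Finset.sum_congr rfl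
    intro k hk
    rw [Finset.mem_range] at hk
    rw [show m + 1 - 1 - k = m - k by omega, show m - k + k = m by omega]
  rw [h2] at h1
  have h3 : (∑ h ∈ Finset.range M, ∑ n ∈ Finset.range (M - h),
      z (n + h) * (starRingEnd ℂ) (z n)).re ≤ ∑ h ∈ Finset.range M,
        ‖∑ n ∈ Finset.range (M - h), z (n + h) * (starRingEnd ℂ) (z n)‖ :=
    (Complex.re_le_norm _).trans (norm_sum_le _ _)
  have h4 : 0 ≤ ∑ n ∈ Finset.range M, ‖z n‖ ^ 2 := by positivity
  linarith

lemma card_int_le_of_dist {s : Finset ℤ} {D : ℝ} (hD : 0 ≤ D)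
    (h : ∀ a ∈ s, ∀ b ∈ s, (b : ℝ) - a ≤ D) : (s.card : ℝ) ≤ D + 1 := by
  rcases s.eq_empty_or_nonempty with rfl | hs
  · simp; linarith
  have h1 : s ⊆ Finset.Icc (s.min' hs) (s.max' hs) := fun a ha =>
    Finset.mem_Icc.2 ⟨Finset.min'_le _ _ ha, Finset.le_max' _ _ ha⟩
  have h2 := Finset.card_le_card h1
  rw [Int.card_Icc] at h2
  have h3 := h _ (Finset.min'_mem s hs) _ (Finset.max'_mem s hs)
  have h4 : s.min' hs ≤ s.max' hs := Finset.min'_le_max' _ _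
  have h5 : (s.card : ℤ) ≤ s.max' hs + 1 - s.min' hs := by omega
  have h6 : (s.card : ℝ) ≤ s.max' hs + 1 - s.min' hs := by exact_mod_cast h5
  linarith

lemma card_nat_le_of_dist {s : Finset ℕ} {D : ℝ} (hD : 0 ≤ D)
    (h : ∀ a ∈ s, ∀ b ∈ s, (b : ℝ) - a ≤ D) : (s.card : ℝ) ≤ D + 1 := by
  have := card_int_le_of_dist (s := s.map Nat.castEmbedding) hD (by simpa using h)
  simpa using this

/-- Number of terms of an arithmetic progression that are near an integer. -/
lemma card_near_progression_le (γ θ ε : ℝ) (hε : 0 ≤ ε) (hθ : θ ≠ 0) (J : ℝ) (hJ : 0 ≤ J)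
    (s : Finset ℕ) (hs : ∀ j ∈ s, (j : ℝ) ≤ J ∧ Near (γ + j * θ) ε) :
    (s.card : ℝ) ≤ (J * |θ| + 2 * ε + 1) * (2 * ε / |θ| + 1) := by
  classical
  have hθ' : 0 < |θ| := abs_pos.2 hθ
  choose! a ha using fun j hj => (hs j hj).2
  have h1 : ((s.image a).card : ℝ) ≤ J * |θ| + 2 * ε + 1 := by
    apply card_int_le_of_dist (by positivity)
    intro x hx y hy
    obtain ⟨i, hi, rfl⟩ := Finset.mem_image.1 hx
    obtain ⟨j, hj, rfl⟩ := Finset.mem_image.1 hy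
    have h1 := abs_le.1 (ha i hi)
    have h2 := abs_le.1 (ha j hj)
    have h3 : (j - i : ℝ) * θ ≤ J * |θ| := by
      refine (le_abs_self _).trans ?_
      rw [abs_mul]
      gcongr
      rw [abs_le]
      have := (hs i hi).1
      have := (hs j hj).1
      have : (0 : ℝ) ≤ i := by positivity
      have : (0 : ℝ) ≤ j := by positivity
      constructor <;> linarith
    nlinarith
  have h2 : ∀ x ∈ s.image a, ((s.filter fun j => a j = x).card : ℝ) ≤ 2 * ε / |θ| + 1 := by
    intro x _
    apply card_nat_le_of_dist (by positivity)
    intro i hi j hj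
    rw [Finset.mem_filter] at hi hj
    rw [le_div_iff₀ hθ']
    have h1 := abs_le.1 (ha i hi.1)
    have h2 := abs_le.1 (ha j hj.1)
    rw [hi.2] at h1
    rw [hj.2] at h2
    have h3 : |(j - i : ℝ) * θ| ≤ 2 * ε := by
      rw [abs_le]; constructor <;> linarith
    rw [abs_mul] at h3
    exact (mul_le_mul_of_nonneg_right (le_abs_self _) hθ'.le).trans h3
  have h3 := Finset.card_eq_sum_card_image a s
  calc (s.card : ℝ) = ∑ x ∈ s.image a, ((s.filter fun j => a j = x).card : ℝ) := by
        exact_mod_cast h3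
    _ ≤ ∑ x ∈ s.image a, (2 * ε / |θ| + 1) := Finset.sum_le_sum h2
    _ = (s.image a).card * (2 * ε / |θ| + 1) := by rw [Finset.sum_const, nsmul_eq_mul]
    _ ≤ _ := by gcongr

/-- If many multiples of `β` are close to integers then `β` has a good rational approximation
with small denominator. -/
lemma exists_near_of_many_near (β κ ε : ℝ) (M : ℕ) (H : Finset ℕ) (hκ : 0 < κ) (hκ1 : κ ≤ 1)
    (hε : 0 ≤ ε) (hεκ : ε ≤ κ / 32) (hM : 24 / κ ^ 2 ≤ M)
    (hH : H ⊆ Finset.Icc 1 M) (hcard : κ * M ≤ H.card) (hnear : ∀ h ∈ H, Near (β * h) ε) :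
    ∃ q : ℕ, 1 ≤ q ∧ (q : ℝ) ≤ 2 / κ ∧ Near (q * β) (32 * ε / (κ ^ 2 * M)) := by
  classical
  have hM0 : (0 : ℝ) < M := lt_of_lt_of_le (by positivity) hM
  have hκM : 24 ≤ κ * M := by
    rw [div_le_iff₀ (by positivity)] at hM
    nlinarith [mul_nonneg hκ.le hM0.le]
  -- two elements of `H` close to one another
  obtain ⟨q, hq1, hq2, hq3⟩ : ∃ q : ℕ, 1 ≤ q ∧ (q : ℝ) ≤ 2 / κ ∧ Near (q * β) (2 * ε) := by
    have hpig : ∃ x ∈ H, ∃ y ∈ H, x ≠ y ∧ ⌊(x : ℝ) * (κ / 2)⌋₊ = ⌊(y : ℝ) * (κ / 2)⌋₊ := by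
      apply Finset.exists_ne_map_eq_of_card_lt_of_maps_to
        (t := Finset.range (⌊(M : ℝ) * (κ / 2)⌋₊ + 1))
      · rw [Finset.card_range]
        have h1 := Nat.floor_le (show 0 ≤ (M : ℝ) * (κ / 2) by positivity)
        have : ((⌊(M : ℝ) * (κ / 2)⌋₊ + 1 : ℕ) : ℝ) < H.card := by
          push_cast; linarith
        exact_mod_cast this
      · intro x hx
        have := (Finset.mem_Icc.1 (hH hx)).2
        simp only [Finset.coe_range, Set.mem_Iio]
        refine Nat.lt_succ_of_le (Nat.floor_le_floor ?_)
        gcongr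
    obtain ⟨x, hx, y, hy, hxy, hfl⟩ := hpig
    wlog hlt : x < y generalizing x y
    · exact this y hy x hx hxy.symm hfl.symm (by omega)
    refine ⟨y - x, by omega, ?_, ?_⟩
    · rw [Nat.cast_sub hlt.le, le_div_iff₀ hκ]
      have h1 := Nat.floor_le (show 0 ≤ (x : ℝ) * (κ / 2) by positivity)
      have h2 := Nat.lt_floor_add_one ((y : ℝ) * (κ / 2))
      rw [hfl] at h1
      linarith
    · rw [Nat.cast_sub hlt.le]
      have := (hnear y hy).sub (hnear x hx)
      rw [show ((y : ℝ) - x) * β = β * y - β * x by ring, two_mul]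
      exact this
  refine ⟨q, hq1, hq2, ?_⟩
  obtain ⟨a, ha⟩ := hq3
  refine ⟨a, ?_⟩
  set θ := q * β - a with hθ
  by_cases hθ0 : θ = 0
  · rw [hθ0]; simp; positivity
  have hθ' : 0 < |θ| := abs_pos.2 hθ0
  have hq0 : (0 : ℝ) < q := by exact_mod_cast hq1
  -- a residue class with many elements
  obtain ⟨r, hr, hrc⟩ : ∃ r ∈ Finset.range q,
      κ * M / q ≤ ((H.filter fun h => h % q = r).card : ℝ) := by
    by_contra! hcon
    have h1 : (H.card : ℝ) = ∑ r ∈ Finset.range q, ((H.filter fun h => h % q = r).card : ℝ) := by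
      have := Finset.card_eq_sum_card_fiberwise (f := fun h => h % q) (s := H)
        (t := Finset.range q) (fun x _ => by simpa using Nat.mod_lt _ (by omega))
      exact_mod_cast this
    have h2 : (H.card : ℝ) < ∑ r ∈ Finset.range q, κ * M / q := by
      rw [h1]
      apply Finset.sum_lt_sum_of_nonempty (by simp; omega) hcon
    rw [Finset.sum_const, Finset.card_range, nsmul_eq_mul] at h2
    rw [mul_div_cancel₀ _ hq0.ne'] at h2
    linarith
  set s := (H.filter fun h => h % q = r).image (fun h => h / q) with hs
  have hscard : s.card = (H.filter fun h => h % q = r).card := by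
    apply Finset.card_image_of_injOn
    intro x hx y hy hxy
    simp only [Finset.coe_filter, Set.mem_ofPred_eq] at hx hy
    rw [← Nat.div_add_mod x q, ← Nat.div_add_mod y q, hx.2, hy.2]
    simp only at hxy
    rw [hxy]
  have hcount := card_near_progression_le (β * r) θ ε hε hθ0 (M / q) (by positivity) s (by
    intro j hj
    obtain ⟨h, hh, rfl⟩ := Finset.mem_image.1 hj
    rw [Finset.mem_filter] at hh
    constructor
    · refine Nat.cast_div_le.trans ?_
      have := (Finset.mem_Icc.1 (hH hh.1)).2
      gcongr
    · obtain ⟨b, hb⟩ := hnear h hh.1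
      refine ⟨b - a * ((h / q : ℕ) : ℤ), ?_⟩
      convert hb using 2
      have h1 : (h : ℝ) = q * (h / q : ℕ) + r := by
        have := Nat.div_add_mod h q
        rw [hh.2] at this
        exact_mod_cast this.symm
      rw [hθ, Int.cast_sub, Int.cast_mul, Int.cast_natCast, h1]
      ring)
  rw [hscard] at hcount
  have hc := hrc.trans hcount
  have hexp : ((M : ℝ) / q * |θ| + 2 * ε + 1) * (2 * ε / |θ| + 1) =
      2 * ε * (M / q) + 4 * ε * (ε / |θ|) + 2 * (ε / |θ|) + M / q * |θ| + 2 * ε + 1 := by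
    field_simp
    ring
  rw [hexp] at hc
  have hMq : (0 : ℝ) < M / q := by positivity
  have h1 : (M : ℝ) / q * |θ| ≤ M / q * (2 * ε) := by gcongr
  have h2 : 0 ≤ ε / |θ| := by positivity
  have h3 : 12 ≤ κ * (M / q) := by
    rw [← mul_div_assoc, le_div_iff₀ hq0]
    rw [div_le_iff₀ (by positivity)] at hM
    rw [le_div_iff₀ hκ] at hq2
    nlinarith
  have h4 : κ * M / q = κ * (M / q) := by ring
  rw [h4] at hc
  have h5 : ε * (M / q) ≤ κ / 32 * (M / q) := by gcongr
  have h6 : ε * (ε / |θ|) ≤ 1 / 32 * (ε / |θ|) := by gcongr; linarith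
  have h7 : κ * (M / q) ≤ 8 * (ε / |θ|) := by nlinarith
  rw [le_div_iff₀ (by positivity)]
  rw [← h4, ← mul_div_assoc, le_div_iff₀ hθ', div_mul_eq_mul_div, div_le_iff₀ hq0] at h7
  rw [le_div_iff₀ hκ] at hq2
  have h8 : κ * M * |θ| * κ ≤ 8 * ε * q * κ := by gcongr
  nlinarith

/-- Weyl's inequality in inverse form, with all losses polynomial in `X`: a large exponential
sum forces all non-constant coefficients to have good approximations with the same denominator. -/
def WeylBound (k K : ℕ) : Prop :=
  ∀ X : ℝ, 2 ≤ X → ∀ M : ℕ, 1 ≤ M → ∀ P : ℝ[X], P.natDegree ≤ k → M ≤ X * ‖weylSum P M‖ →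
    ∃ q : ℕ, 1 ≤ q ∧ (q : ℝ) ≤ X ^ K ∧
      ∀ i, 1 ≤ i → i ≤ k → Near (q * P.coeff i) (X ^ K / (M : ℝ) ^ i)

lemma weylBound_one : WeylBound 1 1 := by
  intro X hX M hM P hP hS
  have hM0 : (0 : ℝ) < M := by exact_mod_cast hM
  refine ⟨1, le_rfl, by simp; linarith, ?_⟩
  intro i hi1 hi2
  obtain rfl : i = 1 := by omega
  set b := P.coeff 1 with hb
  have hsum : weylSum P M = expo (P.coeff 0) * ∑ n ∈ Finset.range M, expo b ^ n := by
    unfold weylSum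
    rw [Finset.mul_sum]
    apply Finset.sum_congr rfl
    intro n _
    rw [← expo_nat_mul, ← expo_add]
    congr 1
    rw [eval_eq_sum_range' (n := 2) (by omega)]
    simp [Finset.sum_range_succ]
    ring
  have hgeom : ‖weylSum P M‖ * ‖expo b - 1‖ ≤ 2 := by
    rw [hsum, norm_mul, norm_expo, one_mul, ← norm_mul, geom_sum_mul]
    refine (norm_sub_le _ _).trans ?_
    rw [norm_pow, norm_expo]
    norm_num
  rw [Nat.cast_one, one_mul, pow_one, pow_one]
  refine (near_of_norm_expo_sub_one b).mono ?_
  rw [le_div_iff₀ hM0]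
  have h1 : ‖expo b - 1‖ / 4 * M ≤ ‖expo b - 1‖ / 4 * (X * ‖weylSum P M‖) := by gcongr
  have h2 : ‖expo b - 1‖ / 4 * (X * ‖weylSum P M‖) =
      X / 4 * (‖weylSum P M‖ * ‖expo b - 1‖) := by ring
  have h3 : X / 4 * (‖weylSum P M‖ * ‖expo b - 1‖) ≤ X / 4 * 2 := by gcongr
  linarith

lemma taylor_coeff_eq_sum {R : Type*} [CommRing R] (f : R[X]) (d : ℕ) (hf : f.natDegree ≤ d)
    (r : R) (n : ℕ) :
    (taylor r f).coeff n = ∑ j ∈ Finset.range (d + 1),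
      ((j + n).choose n : R) * f.coeff (j + n) * r ^ j := by
  rw [taylor_coeff, eval_eq_sum_range' (n := d + 1)]
  · simp [hasseDeriv_coeff]
  · have := natDegree_hasseDeriv_le f n
    omega

lemma natDegree_taylor_sub_le (P : ℝ[X]) (k : ℕ) (hP : P.natDegree ≤ k + 1) (r : ℝ) :
    (taylor r P - P).natDegree ≤ k := by
  rw [natDegree_le_iff_coeff_eq_zero]
  intro n hn
  rw [coeff_sub, taylor_coeff_eq_sum P (k + 1) hP, Finset.sum_range_succ']
  rw [Finset.sum_eq_zero]
  · simp
  · intro j _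
    rw [coeff_eq_zero_of_natDegree_lt (by omega)]
    simp

lemma coeff_taylor_sub (P : ℝ[X]) (k : ℕ) (hP : P.natDegree ≤ k + 1) (r : ℝ) :
    (taylor r P - P).coeff k = (k + 1) * P.coeff (k + 1) * r := by
  rw [coeff_sub, taylor_coeff_eq_sum P (k + 1) hP, Finset.sum_range_succ',
    Finset.sum_range_succ']
  rw [Finset.sum_eq_zero]
  · simp [Nat.choose_succ_self_right, add_comm]
  · intro j _
    rw [coeff_eq_zero_of_natDegree_lt (by omega)]
    simp

lemma exists_many_large_differences (P : ℝ[X]) (X : ℝ) (hX : 2 ≤ X) (M : ℕ)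
    (hM : X ^ 5 ≤ M) (hS : M ≤ X * ‖weylSum P M‖) :
    ∃ H : Finset ℕ, H ⊆ Finset.Icc 1 (M - 1) ∧ (M : ℝ) / X ^ 4 ≤ H.card ∧
      ∀ h ∈ H, (M : ℝ) / X ^ 5 ≤ ‖weylSum (taylor (h : ℝ) P - P) (M - h)‖ := by
  classical
  have hX0 : 0 < X := by linarith
  have hM0 : (0 : ℝ) < M := lt_of_lt_of_le (by positivity) hM
  have hM1 : 1 ≤ M := by exact_mod_cast hM0
  refine ⟨(Finset.Icc 1 (M - 1)).filter fun h : ℕ =>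
    (M : ℝ) / X ^ 5 ≤ ‖weylSum (taylor (h : ℝ) P - P) (M - h)‖, Finset.filter_subset _ _, ?_,
    fun h hh => (Finset.mem_filter.1 hh).2⟩
  set H := (Finset.Icc 1 (M - 1)).filter fun h : ℕ =>
    (M : ℝ) / X ^ 5 ≤ ‖weylSum (taylor (h : ℝ) P - P) (M - h)‖ with hH
  have h1 := norm_sq_sum_le_correlations (fun n => expo (P.eval (n : ℝ))) M
  have h2 : ∀ h ∈ Finset.range M, ‖∑ n ∈ Finset.range (M - h), expo (P.eval ((n + h : ℕ) : ℝ)) *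
      (starRingEnd ℂ) (expo (P.eval (n : ℝ)))‖ ≤
        (if h = 0 then (M : ℝ) else 0) + (M / X ^ 5 + if h ∈ H then (M : ℝ) else 0) := by
    intro h hh
    have heq : ∑ n ∈ Finset.range (M - h), expo (P.eval ((n + h : ℕ) : ℝ)) *
      (starRingEnd ℂ) (expo (P.eval (n : ℝ))) = weylSum (taylor (h : ℝ) P - P) (M - h) := by
      unfold weylSum
      apply Finset.sum_congr rfl
      intro n _
      rw [← expo_sub, eval_sub, taylor_eval]
      push_cast
      ring_nf
    rw [heq]
    have hle : ‖weylSum (taylor (h : ℝ) P - P) (M - h)‖ ≤ M :=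
      (norm_weylSum_le _ _).trans (by exact_mod_cast Nat.sub_le _ _)
    have hpos : 0 ≤ (M : ℝ) / X ^ 5 := by positivity
    rcases Nat.eq_zero_or_pos h with h0 | h0
    · rw [if_pos h0]
      split_ifs <;> linarith
    · by_cases hm : h ∈ H
      · rw [if_pos hm, if_neg (by omega)]
        linarith
      · rw [if_neg hm, if_neg (by omega)]
        have : ¬ ((M : ℝ) / X ^ 5 ≤ ‖weylSum (taylor (h : ℝ) P - P) (M - h)‖) := by
          intro hcon
          apply hm
          rw [Finset.mem_range] at hh
          exact Finset.mem_filter.2 ⟨Finset.mem_Icc.2 ⟨h0, by omega⟩, hcon⟩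
        linarith
  have h3 := Finset.sum_le_sum h2
  rw [Finset.sum_add_distrib, Finset.sum_add_distrib, Finset.sum_ite_eq' (Finset.range M) 0,
    if_pos (by simp; omega), Finset.sum_const, Finset.card_range, ← Finset.sum_filter,
    Finset.sum_const, nsmul_eq_mul, nsmul_eq_mul] at h3
  have h4 : ((Finset.range M).filter fun h : ℕ => h ∈ H).card ≤ H.card :=
    Finset.card_le_card fun x hx => (Finset.mem_filter.1 hx).2
  have h4' : (((Finset.range M).filter fun h : ℕ => h ∈ H).card : ℝ) ≤ H.card := by exact_mod_cast h4
  have h5 : ‖weylSum P M‖ ^ 2 ≤ 2 * (M + (M * (M / X ^ 5) + H.card * M)) := by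
    unfold weylSum
    refine h1.trans ?_
    gcongr
    refine h3.trans ?_
    gcongr
  have h6 : ((M : ℝ) / X) ^ 2 ≤ ‖weylSum P M‖ ^ 2 := by
    gcongr
    rw [div_le_iff₀ hX0]; linarith
  have h7 := h6.trans h5
  have h8 : (M : ℝ) / X ^ 2 ≤ 2 * (1 + (M / X ^ 5 + H.card)) := by
    have : ((M : ℝ) / X) ^ 2 = M * (M / X ^ 2) := by ring
    rw [this] at h7
    have h9 : (M : ℝ) * (M / X ^ 2) ≤ M * (2 * (1 + (M / X ^ 5 + H.card))) := by linarith
    exact le_of_mul_le_mul_left h9 hM0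
  have h9 : 1 ≤ (M : ℝ) / X ^ 5 := by rwa [le_div_iff₀ (by positivity), one_mul]
  have h10 : (M : ℝ) / X ^ 5 ≤ M / X ^ 2 / 8 := by
    rw [div_div]
    have : X ^ 2 * 8 ≤ X ^ 5 := by
      have : (2 : ℝ) ^ 3 ≤ X ^ 3 := by gcongr
      calc X ^ 2 * 8 ≤ X ^ 2 * X ^ 3 := by gcongr; linarith
        _ = X ^ 5 := by ring
    gcongr
  have h11 : (M : ℝ) / X ^ 4 ≤ M / X ^ 2 / 4 := by
    rw [div_div]
    have : X ^ 2 * 4 ≤ X ^ 4 := by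
      have : (2 : ℝ) ^ 2 ≤ X ^ 2 := by gcongr
      calc X ^ 2 * 4 ≤ X ^ 2 * X ^ 2 := by gcongr; linarith
        _ = X ^ 4 := by ring
    gcongr
  linarith

lemma WeylBound.leading_coeff {k K : ℕ} (hk : 1 ≤ k) (hW : WeylBound k K) (X : ℝ) (hX : 2 ≤ X)
    (M : ℕ) (hM : X ^ (10 * K + 5 * k + 13) ≤ M) (P : ℝ[X]) (hP : P.natDegree ≤ k + 1)
    (hS : M ≤ X * ‖weylSum P M‖) :
    ∃ q : ℕ, 1 ≤ q ∧ (q : ℝ) ≤ X ^ (15 * K + 5 * k + 13) ∧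
      Near (q * P.coeff (k + 1)) (X ^ (15 * K + 5 * k + 13) / (M : ℝ) ^ (k + 1)) := by
  classical
  have hX0 : 0 < X := by linarith
  have hX1 : 1 ≤ X := by linarith
  have hM0 : (0 : ℝ) < M := lt_of_lt_of_le (by positivity) hM
  have hM1 : 1 ≤ M := by exact_mod_cast hM0
  obtain ⟨H, hHsub, hHcard, hHlarge⟩ := exists_many_large_differences P X hX M
    ((pow_le_pow_right₀ hX1 (by omega)).trans hM) hS
  have hq : ∀ h ∈ H, ∃ q : ℕ, 1 ≤ q ∧ (q : ℝ) ≤ X ^ (5 * K) ∧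
      Near (q * ((k + 1) * P.coeff (k + 1) * h)) (X ^ (5 * K + 5 * k) / (M : ℝ) ^ k) := by
    intro h hh
    have hlarge := hHlarge h hh
    have hle := norm_weylSum_le (taylor (h : ℝ) P - P) (M - h)
    have hM' : (M : ℝ) / X ^ 5 ≤ (M - h : ℕ) := hlarge.trans hle
    have hM'0 : (0 : ℝ) < (M - h : ℕ) := lt_of_lt_of_le (by positivity) hM'
    obtain ⟨q, hq1, hq2, hq3⟩ := hW (X ^ 5) (by nlinarith [pow_le_pow_left₀ (by norm_num) hX 5])
      (M - h) (by exact_mod_cast hM'0) (taylor (h : ℝ) P - P)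
      (natDegree_taylor_sub_le P k hP h) (by
        rw [div_le_iff₀ (by positivity), mul_comm] at hlarge
        refine le_trans ?_ hlarge
        exact_mod_cast Nat.sub_le _ _)
    refine ⟨q, hq1, by rwa [pow_mul], ?_⟩
    have := hq3 k hk le_rfl
    rw [coeff_taylor_sub P k hP] at this
    refine this.mono ?_
    rw [pow_add, pow_mul X 5 k, pow_mul X 5 K, div_le_div_iff₀ (by positivity) (by positivity),
      mul_assoc, ← mul_pow]
    rw [div_le_iff₀ (by positivity)] at hM'
    gcongr
    linarith
  choose! qf hqf1 hqf2 hqf3 using hq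
  have hX5K : 0 < X ^ (5 * K) := by positivity
  obtain ⟨q, hqm, hqc⟩ : ∃ q ∈ Finset.Icc 1 ⌊X ^ (5 * K)⌋₊,
      (M : ℝ) / X ^ (5 * K + 4) ≤ ((H.filter fun h => qf h = q).card : ℝ) := by
    by_contra! hcon
    have h1 : (H.card : ℝ) = ∑ r ∈ Finset.Icc 1 ⌊X ^ (5 * K)⌋₊,
        ((H.filter fun h => qf h = r).card : ℝ) := by
      have := Finset.card_eq_sum_card_fiberwise (f := qf) (s := H)
        (t := Finset.Icc 1 ⌊X ^ (5 * K)⌋₊) (fun x hx => by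
          simp only [Finset.coe_Icc, Set.mem_Icc]
          exact ⟨hqf1 x hx, Nat.le_floor (hqf2 x hx)⟩)
      exact_mod_cast this
    have h2 : (H.card : ℝ) < ∑ r ∈ Finset.Icc 1 ⌊X ^ (5 * K)⌋₊, (M : ℝ) / X ^ (5 * K + 4) := by
      rw [h1]
      apply Finset.sum_lt_sum_of_nonempty _ hcon
      rw [Finset.nonempty_Icc]
      exact Nat.le_floor (by simpa using one_le_pow₀ hX1)
    rw [Finset.sum_const, Nat.card_Icc, nsmul_eq_mul, Nat.add_sub_cancel] at h2
    have h3 : (⌊X ^ (5 * K)⌋₊ : ℝ) * (M / X ^ (5 * K + 4)) ≤ X ^ (5 * K) * (M / X ^ (5 * K + 4)) := by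
      gcongr
      exact Nat.floor_le hX5K.le
    have h4 : X ^ (5 * K) * (M / X ^ (5 * K + 4)) = M / X ^ 4 := by
      rw [pow_add]; field_simp
    linarith
  rw [Finset.mem_Icc] at hqm
  have hq2 : (q : ℝ) ≤ X ^ (5 * K) := (Nat.le_floor_iff hX5K.le).1 hqm.2
  have h32 : (32 : ℝ) ≤ X ^ 5 := by
    calc (32 : ℝ) = 2 ^ 5 := by norm_num
      _ ≤ X ^ 5 := by gcongr
  obtain ⟨q', hq'1, hq'2, hq'3⟩ := exists_near_of_many_near (q * ((k + 1) * P.coeff (k + 1)))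
    (1 / X ^ (5 * K + 4)) (X ^ (5 * K + 5 * k) / (M : ℝ) ^ k) M (H.filter fun h => qf h = q)
    (by positivity) (by
      rw [div_le_one (by positivity)]
      exact one_le_pow₀ hX1)
    (by positivity)
    (by
      rw [div_div, div_le_div_iff₀ (by positivity) (by positivity), one_mul]
      calc X ^ (5 * K + 5 * k) * (X ^ (5 * K + 4) * 32)
          ≤ X ^ (5 * K + 5 * k) * (X ^ (5 * K + 4) * X ^ 5) := by gcongr
        _ = X ^ (10 * K + 5 * k + 9) := by rw [← pow_add, ← pow_add]; congr 1; ring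
        _ ≤ X ^ (10 * K + 5 * k + 13) := pow_le_pow_right₀ hX1 (by omega)
        _ ≤ M := hM
        _ ≤ (M : ℝ) ^ k := le_self_pow₀ (by exact_mod_cast hM1) (by omega))
    (by
      rw [one_div, inv_pow, div_inv_eq_mul]
      calc 24 * (X ^ (5 * K + 4)) ^ 2 ≤ X ^ 5 * (X ^ (5 * K + 4)) ^ 2 := by gcongr; linarith
        _ = X ^ (10 * K + 13) := by rw [← pow_mul, ← pow_add]; congr 1; ring
        _ ≤ X ^ (10 * K + 5 * k + 13) := pow_le_pow_right₀ hX1 (by omega)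
        _ ≤ M := hM)
    (fun h hh => by
      have := Finset.mem_Icc.1 (hHsub (Finset.mem_filter.1 hh).1)
      exact Finset.mem_Icc.2 ⟨this.1, by omega⟩)
    (by rwa [one_div, inv_mul_eq_div])
    (fun h hh => by
      rw [Finset.mem_filter] at hh
      have := hqf3 h hh.1
      rw [hh.2] at this
      rwa [mul_assoc])
  refine ⟨q' * q * (k + 1), ?_, ?_, ?_⟩
  · have := Nat.mul_le_mul (Nat.mul_le_mul hq'1 hqm.1) (show 1 ≤ k + 1 by omega)
    simpa using this
  · push_cast
    rw [one_div, div_inv_eq_mul] at hq'2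
    have hk1 : ((k : ℝ) + 1) ≤ X ^ (k + 1) := by
      calc ((k : ℝ) + 1) ≤ 2 ^ (k + 1) := by exact_mod_cast (Nat.lt_two_pow_self (n := k + 1)).le
        _ ≤ X ^ (k + 1) := by gcongr
    calc (q' : ℝ) * q * (k + 1) ≤ (X * X ^ (5 * K + 4)) * X ^ (5 * K) * X ^ (k + 1) := by
          gcongr
          exact hq'2.trans (by gcongr)
      _ = X ^ (10 * K + k + 6) := by
          rw [← pow_succ', ← pow_add, ← pow_add]; congr 1; ring
      _ ≤ _ := pow_le_pow_right₀ hX1 (by omega)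
  · push_cast
    rw [show ((q' : ℝ) * q * (k + 1)) * P.coeff (k + 1) =
      q' * (q * ((k + 1) * P.coeff (k + 1))) by ring]
    refine hq'3.mono ?_
    rw [one_div, inv_pow, ← div_eq_inv_mul, mul_div_assoc', div_div]
    have : (M : ℝ) ^ k * (M / (X ^ (5 * K + 4)) ^ 2) = M ^ (k + 1) / (X ^ (5 * K + 4)) ^ 2 := by
      rw [mul_div_assoc', ← pow_succ]
    rw [this, div_div_eq_mul_div]
    apply div_le_div_of_nonneg_right _ (by positivity)
    calc 32 * X ^ (5 * K + 5 * k) * (X ^ (5 * K + 4)) ^ 2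
        ≤ X ^ 5 * X ^ (5 * K + 5 * k) * (X ^ (5 * K + 4)) ^ 2 := by gcongr
      _ = X ^ (15 * K + 5 * k + 13) := by
          rw [← pow_mul, ← pow_add, ← pow_add]; congr 1; ring

lemma norm_sum_range_sub_shift_le (f : ℕ → ℂ) (hf : ∀ n, ‖f n‖ ≤ 1) (M s : ℕ) :
    ‖∑ n ∈ Finset.range M, f n - ∑ n ∈ Finset.range M, f (n + s)‖ ≤ 2 * s := by
  have h1 : ∑ n ∈ Finset.range (M + s), f n =
      ∑ n ∈ Finset.range M, f n + ∑ n ∈ Finset.range s, f (M + n) := Finset.sum_range_add f M s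
  have h2 : ∑ n ∈ Finset.range (s + M), f n =
      ∑ n ∈ Finset.range s, f n + ∑ n ∈ Finset.range M, f (s + n) := Finset.sum_range_add f s M
  rw [add_comm s M] at h2
  simp only [add_comm s] at h2
  have h3 : ∑ n ∈ Finset.range M, f n - ∑ n ∈ Finset.range M, f (n + s) =
      ∑ n ∈ Finset.range s, f n - ∑ n ∈ Finset.range s, f (M + n) := by
    linear_combination h2 - h1
  rw [h3]
  refine (norm_sub_le _ _).trans ?_
  have h4 : ∀ g : ℕ → ℂ, (∀ n, ‖g n‖ ≤ 1) → ‖∑ n ∈ Finset.range s, g n‖ ≤ s := fun g hg =>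
    (norm_sum_le_of_le _ fun n _ => hg n).trans (by simp)
  have := h4 f hf
  have := h4 (fun n => f (M + n)) (fun n => hf _)
  linarith

lemma exists_large_progression_sum (f : ℕ → ℂ) (hf : ∀ n, ‖f n‖ ≤ 1) (M J q : ℕ) (hM : 1 ≤ M) :
    ∃ n < M, J * ‖∑ n ∈ Finset.range M, f n‖ ≤
      M * ‖∑ t ∈ Finset.range J, f (n + q * t)‖ + 2 * q * (J : ℝ) ^ 2 := by
  by_contra! hcon
  set S := ∑ n ∈ Finset.range M, f n with hS
  have h1 : ‖∑ t ∈ Finset.range J, (S - ∑ n ∈ Finset.range M, f (n + q * t))‖ ≤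
      ∑ t ∈ Finset.range J, (2 * q * J : ℝ) := by
    apply norm_sum_le_of_le
    intro t ht
    refine (norm_sum_range_sub_shift_le f hf M (q * t)).trans ?_
    push_cast
    rw [mul_assoc]
    have : (t : ℝ) ≤ J := by exact_mod_cast (Finset.mem_range.1 ht).le
    gcongr
  rw [Finset.sum_sub_distrib, Finset.sum_const, Finset.card_range,
    Finset.sum_const, Finset.card_range, nsmul_eq_mul, nsmul_eq_mul, Finset.sum_comm] at h1
  have h2 : ‖(J : ℂ) * S‖ = J * ‖S‖ := by simp
  have h3 := norm_sub_norm_le ((J : ℂ) * S)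
    (∑ n ∈ Finset.range M, ∑ t ∈ Finset.range J, f (n + q * t))
  have h4 : ‖∑ n ∈ Finset.range M, ∑ t ∈ Finset.range J, f (n + q * t)‖ ≤
      ∑ n ∈ Finset.range M, ‖∑ t ∈ Finset.range J, f (n + q * t)‖ := norm_sum_le _ _
  have h5 : ∑ n ∈ Finset.range M, (M * ‖∑ t ∈ Finset.range J, f (n + q * t)‖) <
      ∑ n ∈ Finset.range M, (J * ‖S‖ - 2 * q * (J : ℝ) ^ 2) := by
    apply Finset.sum_lt_sum_of_nonempty (by simp; omega)
    intro n hn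
    have := hcon n (Finset.mem_range.1 hn)
    linarith
  rw [← Finset.mul_sum, Finset.sum_const, Finset.card_range, nsmul_eq_mul] at h5
  have h6 := lt_of_mul_lt_mul_left h5 (by positivity)
  nlinarith

/-- Passing from Taylor coefficients at an integer `n` back to the coefficients. -/
lemma near_coeff_of_near_taylor_coeff (P : ℝ[X]) (d : ℕ) (hP : P.natDegree ≤ d) (q n M : ℕ)
    (hM : 1 ≤ M) (hn : n ≤ M) (B : ℝ) (hB : 0 ≤ B)
    (h : ∀ i, 1 ≤ i → i ≤ d → Near (q * (taylor (n : ℝ) P).coeff i) (B / (M : ℝ) ^ i))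
    (j : ℕ) (hj : 1 ≤ j) :
    Near (q * P.coeff j) (2 ^ (3 * d + 1) * B / (M : ℝ) ^ j) := by
  have hM0 : (0 : ℝ) < M := by exact_mod_cast hM
  set c := taylor (n : ℝ) P with hc
  have hP' : P = taylor (-n : ℝ) c := by
    rw [hc, taylor_taylor]; simp
  have hcd : c.natDegree ≤ d := by rw [hc, natDegree_taylor]; exact hP
  rw [hP', taylor_coeff_eq_sum c d hcd, Finset.mul_sum]
  have hterm : ∀ i ∈ Finset.range (d + 1),
      Near (q * (((i + j).choose j : ℝ) * c.coeff (i + j) * (-n : ℝ) ^ i))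
        (2 ^ (2 * d) * B / (M : ℝ) ^ j) := by
    intro i hi
    by_cases hij : i + j ≤ d
    · have h1 := (h (i + j) (by omega) hij).int_mul (((i + j).choose j : ℤ) * (-n : ℤ) ^ i)
      push_cast at h1
      rw [show (q : ℝ) * (((i + j).choose j : ℝ) * c.coeff (i + j) * (-n : ℝ) ^ i) =
        ((i + j).choose j : ℝ) * (-n : ℝ) ^ i * (q * c.coeff (i + j)) by ring]
      refine h1.mono ?_
      rw [abs_mul, abs_pow, abs_neg, Nat.abs_cast, Nat.abs_cast, mul_div_assoc', pow_add,
        div_le_div_iff₀ (by positivity) (by positivity)]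
      have h2 : ((i + j).choose j : ℝ) ≤ 2 ^ (2 * d) := by
        have h3 : (i + j).choose j ≤ 2 ^ (i + j) := Nat.choose_le_two_pow _ _
        have h4 : 2 ^ (i + j) ≤ 2 ^ (2 * d) := Nat.pow_le_pow_right (by norm_num) (by omega)
        exact_mod_cast h3.trans h4
      have h5 : (n : ℝ) ^ i ≤ (M : ℝ) ^ i := by gcongr
      calc ((i + j).choose j : ℝ) * (n : ℝ) ^ i * B * M ^ j
          ≤ 2 ^ (2 * d) * (M : ℝ) ^ i * B * M ^ j := by gcongr
        _ = _ := by ring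
    · rw [coeff_eq_zero_of_natDegree_lt (by omega : c.natDegree < i + j)]
      simp only [mul_zero, zero_mul]
      exact near_zero (by positivity)
  refine (Near.sum _ _ _ hterm).mono ?_
  rw [Finset.sum_const, Finset.card_range, nsmul_eq_mul, mul_div_assoc', ← mul_assoc]
  gcongr
  have : ((d + 1 : ℕ) : ℝ) ≤ 2 ^ (d + 1) := by
    exact_mod_cast (Nat.lt_two_pow_self (n := d + 1)).le
  calc ((d + 1 : ℕ) : ℝ) * 2 ^ (2 * d) ≤ 2 ^ (d + 1) * 2 ^ (2 * d) := by gcongr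
    _ = 2 ^ (3 * d + 1) := by rw [← pow_add]; congr 1; ring

set_option maxHeartbeats 800000 in
lemma WeylBound.lower_coeffs {k K K₁ : ℕ} (hk : 1 ≤ k) (hW : WeylBound k K) (X : ℝ) (hX : 2 ≤ X)
    (M : ℕ) (hM : X ^ (K₁ + 4) ≤ M) (P : ℝ[X]) (hP : P.natDegree ≤ k + 1)
    (hS : M ≤ X * ‖weylSum P M‖) (q₁ : ℕ) (hq₁ : 1 ≤ q₁) (hq₁X : (q₁ : ℝ) ≤ X ^ K₁)
    (hlead : Near (q₁ * P.coeff (k + 1)) (X ^ K₁ / (M : ℝ) ^ (k + 1))) :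
    ∃ q : ℕ, 1 ≤ q ∧ (q : ℝ) ≤ X ^ (3 * K + (2 * K₁ + 7) * (k + 1) + 1) ∧
      ∀ i, 1 ≤ i → i ≤ k + 1 →
        Near (q * P.coeff i) (X ^ (3 * K + (2 * K₁ + 7) * (k + 1) + 1) / (M : ℝ) ^ i) := by
  have hX0 : 0 < X := by linarith
  have hX1 : 1 ≤ X := by linarith
  have hM0 : (0 : ℝ) < M := lt_of_lt_of_le (by positivity) hM
  have hM1 : 1 ≤ M := by exact_mod_cast hM0
  set J := ⌊(M : ℝ) / X ^ (K₁ + 3)⌋₊ with hJ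
  have hMX : X ≤ (M : ℝ) / X ^ (K₁ + 3) := by
    rw [le_div_iff₀ (by positivity), ← pow_succ']
    exact hM
  have hJle : (J : ℝ) ≤ M / X ^ (K₁ + 3) := Nat.floor_le (by positivity)
  have hJge : (M : ℝ) / X ^ (K₁ + 4) ≤ J := by
    have h1 := Nat.lt_floor_add_one ((M : ℝ) / X ^ (K₁ + 3))
    have h2 : (M : ℝ) / X ^ (K₁ + 4) ≤ M / X ^ (K₁ + 3) / 2 := by
      rw [pow_succ X (K₁ + 3), ← div_div]
      gcongr
    linarith
  have hJ0 : (0 : ℝ) < J := lt_of_lt_of_le (by positivity) hJge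
  have hJ1 : 1 ≤ J := by exact_mod_cast hJ0
  obtain ⟨n, hnM, hn⟩ := exists_large_progression_sum (fun n => expo (P.eval (n : ℝ)))
    (fun n => (norm_expo _).le) M J q₁ hM1
  have hT : (J : ℝ) / (2 * X) ≤
      ‖∑ t ∈ Finset.range J, expo (P.eval ((n + q₁ * t : ℕ) : ℝ))‖ := by
    have h1 : (M : ℝ) / X ≤ ‖weylSum P M‖ := by
      rw [div_le_iff₀ hX0]; linarith
    have h2 : 2 * q₁ * (J : ℝ) ≤ M / (2 * X) := by
      calc 2 * q₁ * (J : ℝ) ≤ 2 * X ^ K₁ * (M / X ^ (K₁ + 3)) := by gcongr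
        _ = 2 * M / X ^ 3 := by rw [pow_add]; field_simp
        _ ≤ M / (2 * X) := by
          rw [div_le_div_iff₀ (by positivity) (by positivity)]
          have : 4 * X ≤ X ^ 3 := by nlinarith [sq_nonneg (X - 2)]
          nlinarith
    have h3 : (J : ℝ) * (M / X) ≤ M * ‖∑ t ∈ Finset.range J, expo (P.eval ((n + q₁ * t : ℕ) : ℝ))‖
        + J * (M / (2 * X)) := by
      calc (J : ℝ) * (M / X) ≤ J * ‖weylSum P M‖ := by gcongr
        _ ≤ _ := hn
        _ ≤ _ := by
          have : 2 * q₁ * (J : ℝ) ^ 2 = J * (2 * q₁ * (J : ℝ)) := by ring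
          rw [this]
          gcongr
    have h4 : (M : ℝ) * (J / (2 * X)) ≤
        M * ‖∑ t ∈ Finset.range J, expo (P.eval ((n + q₁ * t : ℕ) : ℝ))‖ := by
      have : (M : ℝ) * (J / (2 * X)) = J * (M / X) - J * (M / (2 * X)) := by field_simp; ring
      linarith
    exact le_of_mul_le_mul_left h4 hM0
  set c := taylor (n : ℝ) P with hc
  have hcd : c.natDegree ≤ k + 1 := by rw [hc, natDegree_taylor]; exact hP
  have hctop : c.coeff (k + 1) = P.coeff (k + 1) := by
    have h0 := natDegree_taylor_sub_le P k hP (n : ℝ)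
    have := coeff_eq_zero_of_natDegree_lt (p := taylor (n : ℝ) P - P) (n := k + 1) (by omega)
    rw [coeff_sub] at this
    linarith
  set R : ℝ[X] := ∑ i ∈ Finset.range (k + 1), monomial i (c.coeff i * (q₁ : ℝ) ^ i) with hR
  have hRd : R.natDegree ≤ k := by
    apply natDegree_sum_le_of_forall_le
    intro i hi
    rw [Finset.mem_range] at hi
    exact (natDegree_monomial_le _).trans (by omega)
  have hRc : ∀ i ≤ k, R.coeff i = c.coeff i * (q₁ : ℝ) ^ i := by
    intro i hi
    rw [hR, finsetSum_coeff]
    simp only [coeff_monomial]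
    rw [Finset.sum_ite_eq', if_pos (by simp; omega)]
  have heval : ∀ t : ℕ, P.eval ((n + q₁ * t : ℕ) : ℝ) =
      R.eval (t : ℝ) + P.coeff (k + 1) * (q₁ * t : ℝ) ^ (k + 1) := by
    intro t
    have h1 : P.eval ((n + q₁ * t : ℕ) : ℝ) = c.eval (q₁ * t : ℝ) := by
      rw [hc, taylor_eval]; push_cast; ring_nf
    rw [h1, eval_eq_sum_range' (n := k + 2) (by omega), Finset.sum_range_succ, hctop, hR,
      eval_finsetSum]
    congr 1
    apply Finset.sum_congr rfl
    intro i _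
    rw [eval_monomial]; ring
  have hsmall : (q₁ : ℝ) ^ k * (J : ℝ) ^ (k + 1) * (X ^ K₁ / (M : ℝ) ^ (k + 1)) ≤ 1 / X ^ 6 := by
    have h1 : X ^ K₁ * J / M ≤ 1 / X ^ 3 := by
      rw [div_le_div_iff₀ hM0 (by positivity)]
      rw [le_div_iff₀ (by positivity), pow_add] at hJle
      linarith
    calc (q₁ : ℝ) ^ k * (J : ℝ) ^ (k + 1) * (X ^ K₁ / (M : ℝ) ^ (k + 1))
        ≤ (X ^ K₁) ^ k * (J : ℝ) ^ (k + 1) * (X ^ K₁ / (M : ℝ) ^ (k + 1)) := by gcongr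
      _ = (X ^ K₁ * J / M) ^ (k + 1) := by
          rw [div_pow, mul_pow, pow_succ (X ^ K₁)]; ring
      _ ≤ (1 / X ^ 3) ^ (k + 1) := by gcongr
      _ ≤ (1 / X ^ 3) ^ 2 := by
          apply pow_le_pow_of_le_one (by positivity) _ (by omega)
          rw [div_le_one (by positivity)]
          exact one_le_pow₀ hX1
      _ = 1 / X ^ 6 := by rw [div_pow, one_pow, ← pow_mul]
  have hdiff : ∀ t ∈ Finset.range J,
      ‖expo (P.eval ((n + q₁ * t : ℕ) : ℝ)) - expo (R.eval (t : ℝ))‖ ≤ 1 / (4 * X) := by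
    intro t ht
    have htJ : (t : ℝ) ≤ J := by exact_mod_cast (Finset.mem_range.1 ht).le
    obtain ⟨a, ha⟩ := hlead
    have h1 : P.eval ((n + q₁ * t : ℕ) : ℝ) = (R.eval (t : ℝ) +
        (q₁ * P.coeff (k + 1) - a) * (q₁ : ℝ) ^ k * (t : ℝ) ^ (k + 1)) +
          ((a * (q₁ : ℤ) ^ k * (t : ℤ) ^ (k + 1) : ℤ) : ℝ) := by
      rw [heval]; push_cast; ring
    rw [h1, expo_add_int]
    refine (norm_expo_sub_expo_le _ _).trans ?_
    rw [add_sub_cancel_left, abs_mul, abs_mul, abs_pow, abs_pow, Nat.abs_cast, Nat.abs_cast]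
    have h2 : |q₁ * P.coeff (k + 1) - a| * (q₁ : ℝ) ^ k * (t : ℝ) ^ (k + 1) ≤ 1 / X ^ 6 := by
      refine le_trans ?_ hsmall
      calc |q₁ * P.coeff (k + 1) - a| * (q₁ : ℝ) ^ k * (t : ℝ) ^ (k + 1)
          ≤ (X ^ K₁ / (M : ℝ) ^ (k + 1)) * (q₁ : ℝ) ^ k * (J : ℝ) ^ (k + 1) := by gcongr
        _ = _ := by ring
    have h3 : 2 * Real.pi ≤ 8 := by linarith [Real.pi_le_four]
    calc 2 * Real.pi * (|q₁ * P.coeff (k + 1) - a| * (q₁ : ℝ) ^ k * (t : ℝ) ^ (k + 1))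
        ≤ 8 * (1 / X ^ 6) := by gcongr
      _ ≤ 1 / (4 * X) := by
        rw [mul_one_div, div_le_div_iff₀ (by positivity) (by positivity)]
        have : (2 : ℝ) ^ 5 ≤ X ^ 5 := by gcongr
        have : 32 * X ≤ X ^ 5 * X := by gcongr; linarith
        nlinarith
  have hRlarge : (J : ℝ) ≤ X ^ 3 * ‖weylSum R J‖ := by
    have h1 : ‖∑ t ∈ Finset.range J, expo (P.eval ((n + q₁ * t : ℕ) : ℝ)) - weylSum R J‖ ≤
        J * (1 / (4 * X)) := by
      unfold weylSum
      rw [← Finset.sum_sub_distrib]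
      refine (norm_sum_le_of_le _ hdiff).trans ?_
      simp
    have h2 := norm_sub_norm_le (∑ t ∈ Finset.range J, expo (P.eval ((n + q₁ * t : ℕ) : ℝ)))
      (weylSum R J)
    have h3 : (J : ℝ) / (4 * X) ≤ ‖weylSum R J‖ := by
      have : (J : ℝ) / (2 * X) - J * (1 / (4 * X)) = J / (4 * X) := by field_simp; ring
      linarith
    rw [div_le_iff₀ (by positivity)] at h3
    refine h3.trans ?_
    rw [mul_comm]
    have : 4 * X ≤ X ^ 3 := by nlinarith [sq_nonneg (X - 2)]
    gcongr
  obtain ⟨q₂, hq₂1, hq₂X, hq₂⟩ := hW (X ^ 3)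
    (by nlinarith [pow_le_pow_left₀ (by norm_num) hX 3]) J hJ1 R hRd hRlarge
  rw [← pow_mul] at hq₂X
  set B := X ^ (3 * K + (2 * K₁ + 4) * (k + 1)) with hB
  have hB0 : 0 ≤ B := by positivity
  have hnear : ∀ i, 1 ≤ i → i ≤ k + 1 →
      Near ((q₂ * q₁ ^ (k + 1) : ℕ) * c.coeff i) (B / (M : ℝ) ^ i) := by
    intro i hi1 hi2
    rcases Nat.lt_or_ge k i with hki | hki
    · obtain rfl : i = k + 1 := by omega
      have := hlead.nat_mul (q₂ * q₁ ^ k)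
      rw [hctop]
      rw [show ((q₂ * q₁ ^ (k + 1) : ℕ) : ℝ) * P.coeff (k + 1) =
        ((q₂ * q₁ ^ k : ℕ) : ℝ) * (q₁ * P.coeff (k + 1)) by push_cast; ring]
      refine this.mono ?_
      push_cast
      rw [mul_div_assoc']
      gcongr
      calc (q₂ : ℝ) * q₁ ^ k * X ^ K₁ ≤ X ^ (3 * K) * (X ^ K₁) ^ k * X ^ K₁ := by gcongr
        _ = X ^ (3 * K + K₁ * (k + 1)) := by
          rw [← pow_mul, ← pow_add, ← pow_add]; congr 1; ring
        _ ≤ B := pow_le_pow_right₀ hX1 (by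
          have h4 : K₁ * (k + 1) ≤ (2 * K₁ + 4) * (k + 1) := Nat.mul_le_mul_right _ (by omega)
          have h5 : (2 * K₁ + 4) * (k + 1) ≤ (2 * K₁ + 7) * (k + 1) :=
            Nat.mul_le_mul_right _ (by omega)
          omega)
    · have := (hq₂ i hi1 hki).nat_mul (q₁ ^ (k + 1 - i))
      rw [hRc i hki] at this
      have hpow : (q₁ : ℝ) ^ (k + 1) = (q₁ : ℝ) ^ (k + 1 - i) * (q₁ : ℝ) ^ i := by
        rw [← pow_add]; congr 1; omega
      rw [show ((q₂ * q₁ ^ (k + 1) : ℕ) : ℝ) * c.coeff i =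
        ((q₁ ^ (k + 1 - i) : ℕ) : ℝ) * (q₂ * (c.coeff i * (q₁ : ℝ) ^ i)) by
          push_cast; rw [hpow]; ring]
      refine this.mono ?_
      push_cast
      rw [← pow_mul, mul_div_assoc', div_le_div_iff₀ (by positivity) (by positivity)]
      have h1 : (M : ℝ) ≤ X ^ (K₁ + 4) * J := by
        rw [div_le_iff₀ (by positivity)] at hJge
        linarith
      calc (q₁ : ℝ) ^ (k + 1 - i) * X ^ (3 * K) * (M : ℝ) ^ i
          ≤ (X ^ K₁) ^ (k + 1 - i) * X ^ (3 * K) * (X ^ (K₁ + 4) * J) ^ i := by gcongr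
        _ = X ^ (K₁ * (k + 1 - i) + 3 * K + (K₁ + 4) * i) * (J : ℝ) ^ i := by
          rw [mul_pow, ← pow_mul, ← pow_mul, pow_add, pow_add]; ring
        _ ≤ B * (J : ℝ) ^ i := by
          gcongr
          apply pow_le_pow_right₀ hX1
          have h2 : K₁ * (k + 1 - i) ≤ K₁ * (k + 1) := Nat.mul_le_mul_left _ (by omega)
          have h3 : (K₁ + 4) * i ≤ (K₁ + 4) * (k + 1) := Nat.mul_le_mul_left _ hi2
          have h4 : (2 * K₁ + 4) * (k + 1) = K₁ * (k + 1) + (K₁ + 4) * (k + 1) := by ring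
          omega
  refine ⟨q₂ * q₁ ^ (k + 1), Nat.mul_pos hq₂1 (pow_pos hq₁ _), ?_, ?_⟩
  · push_cast
    calc (q₂ : ℝ) * q₁ ^ (k + 1) ≤ X ^ (3 * K) * (X ^ K₁) ^ (k + 1) := by gcongr
      _ = X ^ (3 * K + K₁ * (k + 1)) := by rw [← pow_mul, ← pow_add]
      _ ≤ _ := pow_le_pow_right₀ hX1 (by
          have h4 : K₁ * (k + 1) ≤ (2 * K₁ + 4) * (k + 1) := Nat.mul_le_mul_right _ (by omega)
          have h5 : (2 * K₁ + 4) * (k + 1) ≤ (2 * K₁ + 7) * (k + 1) :=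
            Nat.mul_le_mul_right _ (by omega)
          omega)
  · intro i hi1 hi2
    refine (near_coeff_of_near_taylor_coeff P (k + 1) hP _ n M hM1 hnM.le B hB0 hnear i hi1).mono ?_
    gcongr
    calc 2 ^ (3 * (k + 1) + 1) * B ≤ X ^ (3 * (k + 1) + 1) * B := by gcongr
      _ = X ^ (3 * K + (2 * K₁ + 7) * (k + 1) + 1) := by
        rw [hB, ← pow_add]; congr 1; ring

lemma WeylBound.succ {k K : ℕ} (hk : 1 ≤ k) (hW : WeylBound k K) :
    ∃ K', WeylBound (k + 1) K' := by
  set K₁ := 15 * K + 5 * k + 13 with hK₁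
  refine ⟨(K₁ + 4) * (k + 1) + (3 * K + (2 * K₁ + 7) * (k + 1) + 1), ?_⟩
  intro X hX M hM P hP hS
  have hX1 : 1 ≤ X := by linarith
  have hM0 : (0 : ℝ) < M := by exact_mod_cast hM
  by_cases hMX : X ^ (K₁ + 4) ≤ M
  · obtain ⟨q₁, hq₁, hq₁X, hlead⟩ := hW.leading_coeff hk X hX M
      ((pow_le_pow_right₀ hX1 (by omega)).trans hMX) P hP hS
    obtain ⟨q, hq1, hq2, hq3⟩ := hW.lower_coeffs hk X hX M hMX P hP hS q₁ hq₁ hq₁X hlead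
    refine ⟨q, hq1, hq2.trans (pow_le_pow_right₀ hX1 (by omega)), fun i hi1 hi2 =>
      (hq3 i hi1 hi2).mono ?_⟩
    gcongr ?_ / _
    exact pow_le_pow_right₀ hX1 (by omega)
  · push Not at hMX
    refine ⟨1, le_rfl, by simpa using one_le_pow₀ hX1, fun i hi1 hi2 => ?_⟩
    refine (near_half _).mono ?_
    have : (1 : ℝ) ≤ X ^ ((K₁ + 4) * (k + 1) + (3 * K + (2 * K₁ + 7) * (k + 1) + 1)) /
        (M : ℝ) ^ i := by
      rw [one_le_div (by positivity)]
      calc (M : ℝ) ^ i ≤ (X ^ (K₁ + 4)) ^ i := by gcongr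
        _ = X ^ ((K₁ + 4) * i) := by rw [← pow_mul]
        _ ≤ _ := pow_le_pow_right₀ hX1 (by
          have : (K₁ + 4) * i ≤ (K₁ + 4) * (k + 1) := Nat.mul_le_mul_left _ hi2
          omega)
    linarith

theorem exists_weylBound (k : ℕ) (hk : 1 ≤ k) : ∃ K, WeylBound k K := by
  induction k, hk using Nat.le_induction with
  | base => exact ⟨1, weylBound_one⟩
  | succ k hk ih =>
    obtain ⟨K, hK⟩ := ih
    exact hK.succ hk

/-- Integer polynomials of degree `k` with coefficients bounded by `G` and whose non-constant
coefficients have no common factor. -/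
structure PrimitiveBounded (k : ℕ) (G : ℝ) (g : ℤ[X]) : Prop where
  natDegree_le : g.natDegree ≤ k
  coeff_ne : g.coeff k ≠ 0
  bound : ∀ i, |(g.coeff i : ℝ)| ≤ G
  primitive : ∀ d : ℕ, (∀ i, 1 ≤ i → (d : ℤ) ∣ g.coeff i) → d = 1

lemma PrimitiveBounded.one_le {k : ℕ} {G : ℝ} {g : ℤ[X]} (hg : PrimitiveBounded k G g) :
    1 ≤ G := by
  refine le_trans ?_ (hg.bound k)
  exact_mod_cast Int.one_le_abs hg.coeff_ne

/-- A large exponential sum of `α g` forces `α` itself to be close to a rational with small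
denominator. -/
lemma WeylBound.major_arc {k K : ℕ} (hk : 1 ≤ k) (hW : WeylBound k K) (X : ℝ) (hX : 2 ≤ X)
    (g : ℤ[X]) (G : ℝ) (hg : PrimitiveBounded k G g) (M : ℕ) (hM : 2 * G * X ^ K < M) (α : ℝ)
    (hS : M ≤ X * ‖∑ n ∈ Finset.range M, expo (α * (g.eval (n : ℤ) : ℤ))‖) :
    ∃ q : ℕ, 1 ≤ q ∧ (q : ℝ) ≤ X ^ K ∧
      Near (q * α) (X ^ K / (|(g.coeff k : ℝ)| * (M : ℝ) ^ k)) := by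
  have hX0 : 0 < X := by linarith
  have hG : 1 ≤ G := hg.one_le
  have hM0 : (0 : ℝ) < M := lt_of_le_of_lt (by positivity) hM
  have hM1 : 1 ≤ M := by exact_mod_cast hM0
  have hM1' : (1 : ℝ) ≤ M := by exact_mod_cast hM1
  set P : ℝ[X] := C α * g.map (Int.castRingHom ℝ) with hP
  have hPd : P.natDegree ≤ k :=
    (natDegree_C_mul_le _ _).trans (natDegree_map_le.trans hg.natDegree_le)
  have hPc : ∀ i, P.coeff i = α * g.coeff i := by intro i; simp [hP]
  have hsum : weylSum P M = ∑ n ∈ Finset.range M, expo (α * (g.eval (n : ℤ) : ℤ)) := by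
    unfold weylSum
    apply Finset.sum_congr rfl
    intro n _
    congr 1
    rw [hP, eval_mul, eval_C]
    congr 1
    simp
  rw [← hsum] at hS
  obtain ⟨q, hq1, hqX, hq⟩ := hW X hX M hM1 P hPd hS
  refine ⟨q, hq1, hqX, ?_⟩
  choose! a ha using hq
  set b := g.coeff k with hb
  have hkey : ∀ i, 1 ≤ i → i ≤ k → b * a i = g.coeff i * a k := by
    intro i hi hik
    have h1 := ha i hi hik
    have h2 := ha k hk le_rfl
    rw [hPc] at h1 h2
    have h3 : |((g.coeff i * a k - b * a i : ℤ) : ℝ)| < 1 := by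
      have h4 : ((g.coeff i * a k - b * a i : ℤ) : ℝ) =
          b * (q * (α * g.coeff i) - a i) - g.coeff i * (q * (α * b) - a k) := by
        push_cast; ring
      rw [h4]
      refine (abs_sub _ _).trans_lt ?_
      rw [abs_mul, abs_mul]
      have h5 : ∀ j, 1 ≤ j → X ^ K / (M : ℝ) ^ j ≤ X ^ K / M := fun j hj => by
        gcongr
        exact le_self_pow₀ hM1' (by omega)
      calc |(b : ℝ)| * |q * (α * g.coeff i) - a i| + |(g.coeff i : ℝ)| * |q * (α * b) - a k|
          ≤ G * (X ^ K / M) + G * (X ^ K / M) := by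
            gcongr
            · exact hg.bound k
            · exact h1.trans (h5 i hi)
            · exact hg.bound i
            · exact h2.trans (h5 k hk)
        _ = 2 * G * X ^ K / M := by ring
        _ < 1 := by rwa [div_lt_one hM0]
    have h6 : |g.coeff i * a k - b * a i| < 1 := by exact_mod_cast h3
    rw [Int.abs_lt_one_iff] at h6
    omega
  have hdvd : b ∣ a k := by
    have hb0 : 0 < Int.gcd b (a k) := Int.gcd_pos_of_ne_zero_left _ hg.coeff_ne
    obtain ⟨e, b', a', he, hcop, hb', ha'⟩ := Int.exists_gcd_one' hb0
    have h1 : b'.natAbs = 1 := by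
      apply hg.primitive
      intro i hi
      rw [Int.natAbs_dvd]
      by_cases hik : i ≤ k
      swap
      · rw [coeff_eq_zero_of_natDegree_lt (by have := hg.natDegree_le; omega)]
        exact dvd_zero _
      have h2 := hkey i hi hik
      rw [hb', ha'] at h2
      have h3 : b' * a i = g.coeff i * a' := by
        have he' : (e : ℤ) ≠ 0 := by exact_mod_cast he.ne'
        apply mul_right_cancel₀ he'
        linarith
      have h4 : b' ∣ g.coeff i * a' := ⟨a i, h3.symm⟩
      exact (Int.isCoprime_iff_gcd_eq_one.2 hcop).dvd_of_dvd_mul_right h4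
    rw [hb', ha']
    exact mul_dvd_mul_right ((Int.natAbs_dvd).1 (by rw [h1]; simp)) _
  obtain ⟨c, hc⟩ := hdvd
  refine ⟨c, ?_⟩
  have h2 := ha k hk le_rfl
  rw [hPc, hc] at h2
  have hb0 : (0 : ℝ) < |(b : ℝ)| := by
    rw [abs_pos]; exact_mod_cast hg.coeff_ne
  rw [← div_div, div_right_comm, le_div_iff₀ hb0, ← abs_mul]
  have h3 : (q * α - c) * (b : ℝ) = q * (α * b) - ((b * c : ℤ) : ℝ) := by
    push_cast; ring
  rw [h3]
  exact h2

lemma pow_mul_le_add_pow (u w : ℝ) (hu : 0 ≤ u) (hw : 0 ≤ w) (a b : ℕ) (hb : 1 ≤ b) :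
    u ^ a * w ^ b ≤ u ^ (a + b - 1) * w + w ^ (a + b) := by
  rcases le_total u w with h | h
  · have h1 : u ^ a * w ^ b ≤ w ^ a * w ^ b := by gcongr
    rw [← pow_add] at h1
    have : 0 ≤ u ^ (a + b - 1) * w := by positivity
    linarith
  · obtain ⟨b, rfl⟩ : ∃ c, b = c + 1 := ⟨b - 1, by omega⟩
    have h1 : u ^ a * w ^ (b + 1) ≤ u ^ a * (u ^ b * w) := by
      rw [pow_succ]; gcongr
    rw [show a + (b + 1) - 1 = a + b by omega]
    have : 0 ≤ w ^ (a + (b + 1)) := by positivity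
    have h2 : u ^ a * (u ^ b * w) = u ^ (a + b) * w := by ring
    linarith

lemma exists_pow_taylor_bound (m : ℕ) (hm : 1 ≤ m) : ∃ A : ℝ, 0 ≤ A ∧ ∀ ρ u v w : ℝ,
    0 ≤ ρ → ρ ≤ 1 → 0 ≤ u → 0 ≤ w → v ^ 2 ≤ u * w →
      (u + (2 * ρ * v + ρ ^ 2 * w)) ^ m ≤ u ^ m + m * u ^ (m - 1) * (2 * ρ * v + ρ ^ 2 * w) +
        A * ρ ^ 2 * (u ^ (m - 1) * w + w ^ m) := by
  induction m, hm using Nat.le_induction with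
  | base =>
    refine ⟨0, le_rfl, ?_⟩
    intro ρ u v w _ _ _ _ _
    simp
  | succ m hm ih =>
    obtain ⟨A, hA, ih⟩ := ih
    refine ⟨16 * m + 8 * A, by positivity, ?_⟩
    intro ρ u v w hρ hρ1 hu hw hv
    have ih' := ih ρ u v w hρ hρ1 hu hw hv
    set y := 2 * ρ * v + ρ ^ 2 * w with hy
    have hvabs : 2 * |v| ≤ u + w := by
      have : (2 * |v|) ^ 2 ≤ (u + w) ^ 2 := by
        rw [mul_pow, sq_abs]; nlinarith [sq_nonneg (u - w)]
      exact le_of_sq_le_sq this (by positivity)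
    have hρ2 : ρ ^ 2 ≤ 1 := pow_le_one₀ hρ hρ1
    have hρ2' : 0 ≤ ρ ^ 2 := by positivity
    have huy0 : 0 ≤ u + y := by
      have h1 : 0 ≤ u * (u + y) := by
        have : u * (u + y) = (u + ρ * v) ^ 2 + ρ ^ 2 * (u * w - v ^ 2) := by rw [hy]; ring
        rw [this]
        have : 0 ≤ ρ ^ 2 * (u * w - v ^ 2) := mul_nonneg hρ2' (by linarith)
        positivity
      rcases hu.eq_or_lt with h | h
      · have hv0 : v = 0 := by
          rw [← h, zero_mul] at hv
          exact pow_eq_zero_iff (two_ne_zero) |>.1 (le_antisymm hv (sq_nonneg _))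
        rw [hy, hv0, ← h]
        have : 0 ≤ ρ ^ 2 * w := by positivity
        linarith
      · exact nonneg_of_mul_nonneg_right h1 h
    have huy : u + y ≤ 2 * u + 2 * w := by
      have h1 : 2 * ρ * v ≤ u + w := by
        have : ρ * (2 * v) ≤ 1 * (u + w) := by
          have h2 : 2 * v ≤ u + w := by linarith [le_abs_self v]
          calc ρ * (2 * v) ≤ ρ * (u + w) := by gcongr
            _ ≤ 1 * (u + w) := by gcongr
        linarith
      have h2 : ρ ^ 2 * w ≤ 1 * w := by gcongr
      rw [hy]; linarith
    have hy2 : y ^ 2 ≤ 8 * ρ ^ 2 * (u * w + w ^ 2) := by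
      have h1 : y ^ 2 ≤ 2 * (2 * ρ * v) ^ 2 + 2 * (ρ ^ 2 * w) ^ 2 := by
        rw [hy]; nlinarith [sq_nonneg (2 * ρ * v - ρ ^ 2 * w)]
      have h2 : (2 * ρ * v) ^ 2 ≤ 4 * ρ ^ 2 * (u * w) := by
        have : (2 * ρ * v) ^ 2 = 4 * ρ ^ 2 * v ^ 2 := by ring
        rw [this]; gcongr
      have h3 : (ρ ^ 2 * w) ^ 2 ≤ ρ ^ 2 * w ^ 2 := by
        have : (ρ ^ 2 * w) ^ 2 = ρ ^ 2 * (ρ ^ 2 * w ^ 2) := by ring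
        rw [this]
        calc ρ ^ 2 * (ρ ^ 2 * w ^ 2) ≤ 1 * (ρ ^ 2 * w ^ 2) := by gcongr
          _ = _ := one_mul _
      have h4 : 0 ≤ ρ ^ 2 * w ^ 2 := by positivity
      linarith
    set Y := u ^ m * w + w ^ (m + 1) with hY
    have e1 : u ^ (m - 1) * w ^ 2 ≤ Y := by
      have := pow_mul_le_add_pow u w hu hw (m - 1) 2 (by norm_num)
      rwa [show m - 1 + 2 - 1 = m by omega, show m - 1 + 2 = m + 1 by omega] at this
    have e2 : u * w ^ m ≤ Y := by
      have := pow_mul_le_add_pow u w hu hw 1 m hm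
      rwa [show 1 + m - 1 = m by omega, show 1 + m = m + 1 by omega, pow_one] at this
    have hum : u ^ (m - 1) * u = u ^ m := by
      rw [← pow_succ]; congr 1; omega
    have e3 : u ^ (m - 1) * w * u ≤ Y := by
      have : u ^ (m - 1) * w * u = u ^ m * w := by rw [← hum]; ring
      rw [this, hY]
      have : 0 ≤ w ^ (m + 1) := by positivity
      linarith
    have e4 : w ^ (m + 1) ≤ Y := by
      rw [hY]
      have : 0 ≤ u ^ m * w := by positivity
      linarith
    have hstep := mul_le_mul_of_nonneg_right ih' huy0
    rw [← pow_succ] at hstep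
    refine hstep.trans ?_
    have t1 : u ^ (m - 1) * y ^ 2 ≤ 16 * ρ ^ 2 * Y := by
      calc u ^ (m - 1) * y ^ 2 ≤ u ^ (m - 1) * (8 * ρ ^ 2 * (u * w + w ^ 2)) := by gcongr
        _ = 8 * ρ ^ 2 * (u ^ (m - 1) * w * u + u ^ (m - 1) * w ^ 2) := by ring
        _ ≤ 8 * ρ ^ 2 * (Y + Y) := by gcongr
        _ = _ := by ring
    have t2 : (u ^ (m - 1) * w + w ^ m) * (u + y) ≤ 8 * Y := by
      calc (u ^ (m - 1) * w + w ^ m) * (u + y)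
          ≤ (u ^ (m - 1) * w + w ^ m) * (2 * u + 2 * w) := by gcongr
        _ = 2 * (u ^ (m - 1) * w * u + u ^ (m - 1) * w ^ 2 + u * w ^ m + w ^ (m + 1)) := by ring
        _ ≤ 2 * (Y + Y + Y + Y) := by gcongr
        _ = _ := by ring
    have t3 : A * ρ ^ 2 * (u ^ (m - 1) * w + w ^ m) * (u + y) ≤ A * ρ ^ 2 * (8 * Y) := by
      rw [mul_assoc]; gcongr
    rw [Nat.add_sub_cancel]
    push_cast
    have expand : (u ^ m + m * u ^ (m - 1) * y + A * ρ ^ 2 * (u ^ (m - 1) * w + w ^ m)) * (u + y) =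
        u ^ (m + 1) + u ^ m * y + m * (u ^ (m - 1) * u) * y + m * (u ^ (m - 1) * y ^ 2) +
          A * ρ ^ 2 * (u ^ (m - 1) * w + w ^ m) * (u + y) := by ring
    rw [expand, hum]
    have t4 : (m : ℝ) * (u ^ (m - 1) * y ^ 2) ≤ m * (16 * ρ ^ 2 * Y) := by gcongr
    linarith

/-- Two-point style inequality for a small noise parameter `ρ`. -/
lemma exists_noise_parameter (m : ℕ) (hm : 1 ≤ m) : ∃ ρ : ℝ, 0 < ρ ∧ ρ ≤ 1 ∧ ∀ u v w : ℝ,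
    0 ≤ u → 0 ≤ w → v ^ 2 ≤ u * w →
      (u + (2 * ρ * v + ρ ^ 2 * w)) ^ m ≤
        u ^ m + 2 * ρ * m * (u ^ (m - 1) * v) + u ^ (m - 1) * w + w ^ m := by
  obtain ⟨A, hA, h⟩ := exists_pow_taylor_bound m hm
  refine ⟨1 / (m + A + 1), by positivity, ?_, ?_⟩
  · rw [div_le_one (by positivity)]
    have : (0 : ℝ) ≤ m := by positivity
    linarith
  set ρ : ℝ := 1 / (m + A + 1) with hρ
  have hρ0 : 0 < ρ := by positivity
  have hρ1 : ρ ≤ 1 := by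
    rw [hρ, div_le_one (by positivity)]
    have : (0 : ℝ) ≤ m := by positivity
    linarith
  have hρA : (m + A) * ρ ^ 2 ≤ 1 := by
    have : (m + A + 1) * ρ = 1 := by rw [hρ]; field_simp
    have h2 : ρ ^ 2 ≤ ρ := by nlinarith
    calc (m + A) * ρ ^ 2 ≤ (m + A) * ρ := by gcongr
      _ ≤ 1 := by linarith
  intro u v w hu hw hv
  refine (h ρ u v w hρ0.le hρ1 hu hw hv).trans ?_
  have h1 : (m : ℝ) * u ^ (m - 1) * (2 * ρ * v + ρ ^ 2 * w) =
      2 * ρ * m * (u ^ (m - 1) * v) + m * ρ ^ 2 * (u ^ (m - 1) * w) := by ring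
  have h2 : 0 ≤ u ^ (m - 1) * w := by positivity
  have h3 : 0 ≤ w ^ m := by positivity
  have h4 : (m + A) * ρ ^ 2 * (u ^ (m - 1) * w) ≤ 1 * (u ^ (m - 1) * w) := by gcongr
  have h5 : A * ρ ^ 2 * w ^ m ≤ 1 * w ^ m := by
    gcongr
    have : 0 ≤ (m : ℝ) * ρ ^ 2 := by positivity
    linarith
  linarith

section Averaging

open scoped Classical

variable {G : Type} [AddCommGroup G] [Fintype G]

/-- Translation of functions on `G` as a linear operator. -/
def shiftOp (K : Type*) [Field K] (t : G) : Module.End K (G → K) :=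
  LinearMap.funLeft K K (fun x => x + t)

lemma shiftOp_apply (K : Type*) [Field K] (t : G) (f : G → K) (x : G) :
    shiftOp K t f x = f (x + t) := rfl

/-- Averaging over the cosets of a subgroup as a linear operator. -/
noncomputable def avgOp (K : Type*) [Field K] (H : AddSubgroup G) : Module.End K (G → K) :=
  (Fintype.card H : K)⁻¹ • ∑ t : H, shiftOp K (t : G)

lemma avgOp_apply (K : Type*) [Field K] (H : AddSubgroup G) (f : G → K) (x : G) :
    avgOp K H f x = (Fintype.card H : K)⁻¹ * ∑ t : H, f (x + t) := by
  simp [avgOp, shiftOp_apply]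

lemma shiftOp_commute (K : Type*) [Field K] (s t : G) :
    Commute (shiftOp K s) (shiftOp K t) := by
  ext f x
  simp only [Module.End.mul_apply, LinearMap.comp_apply, shiftOp_apply]
  rw [add_right_comm]

lemma avgOp_commute_shiftOp (K : Type*) [Field K] (H : AddSubgroup G) (s : G) :
    Commute (avgOp K H) (shiftOp K s) := by
  unfold avgOp
  exact (Commute.sum_left _ _ _ fun t _ => shiftOp_commute K _ s).smul_left _

lemma avgOp_commute (K : Type*) [Field K] (H H' : AddSubgroup G) :
    Commute (avgOp K H) (avgOp K H') := by
  conv_rhs => unfold avgOp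
  exact (Commute.sum_right _ _ _ fun t _ => avgOp_commute_shiftOp K H _).smul_right _

lemma avgOp_apply_add (K : Type*) [Field K] (H : AddSubgroup G) (f : G → K) (x : G) (t : H) :
    avgOp K H f (x + t) = avgOp K H f x := by
  rw [avgOp_apply, avgOp_apply]
  congr 1
  refine Fintype.sum_equiv (Equiv.addLeft t) _ _ fun s => ?_
  simp [add_assoc]

lemma avgOp_of_invariant (K : Type*) [Field K] [CharZero K] (H : AddSubgroup G) (f : G → K)
    (hf : ∀ (x : G) (t : H), f (x + t) = f x) : avgOp K H f = f := by
  ext x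
  rw [avgOp_apply]
  simp only [hf, Finset.sum_const, Finset.card_univ, nsmul_eq_mul]
  rw [inv_mul_cancel_left₀]
  exact_mod_cast Fintype.card_ne_zero

lemma avgOp_mul_self (K : Type*) [Field K] [CharZero K] (H : AddSubgroup G) :
    avgOp K H * avgOp K H = avgOp K H := by
  refine LinearMap.ext fun f => ?_
  exact avgOp_of_invariant K H _ (avgOp_apply_add K H f)

lemma avgOp_sub_avgOp (K : Type*) [Field K] [CharZero K] (H : AddSubgroup G) (f : G → K) :
    avgOp K H (f - avgOp K H f) = 0 := by
  have := congrArg (fun T => T f) (avgOp_mul_self K H)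
  simp only [Module.End.mul_apply] at this
  rw [map_sub, this, sub_self]

lemma sum_mul_avgOp (H : AddSubgroup G) (φ g : G → ℝ)
    (hφ : ∀ (x : G) (t : H), φ (x + t) = φ x) :
    ∑ x, φ x * avgOp ℝ H g x = ∑ x, φ x * g x := by
  have h1 : ∀ t : H, ∑ x, φ x * g (x + t) = ∑ x, φ x * g x := by
    intro t
    refine Fintype.sum_equiv (Equiv.addRight (t : G)) _ _ fun x => ?_
    simp [hφ]
  simp only [avgOp_apply, Finset.mul_sum]
  rw [Finset.sum_comm]
  have h2 : ∀ t : H, ∑ x, φ x * ((Fintype.card H : ℝ)⁻¹ * g (x + t)) =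
      (Fintype.card H : ℝ)⁻¹ * ∑ x, φ x * g x := by
    intro t
    rw [← h1 t, Finset.mul_sum]
    exact Finset.sum_congr rfl fun x _ => by ring
  simp only [h2, Finset.sum_const, Finset.card_univ, nsmul_eq_mul]
  rw [mul_inv_cancel_left₀]
  exact_mod_cast Fintype.card_ne_zero

lemma avgOp_nonneg (H : AddSubgroup G) (g : G → ℝ) (hg : ∀ x, 0 ≤ g x) (x : G) :
    0 ≤ avgOp ℝ H g x := by
  rw [avgOp_apply]
  exact mul_nonneg (by positivity) (Finset.sum_nonneg fun t _ => hg _)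

lemma add_pow_ge_aux (u e : ℝ) (hu : 0 ≤ u) (he : 0 ≤ e) (m : ℕ) (hm : 1 ≤ m) :
    u ^ m + u ^ (m - 1) * e ≤ (u + e) ^ m := by
  obtain ⟨m, rfl⟩ : ∃ c, m = c + 1 := ⟨m - 1, by omega⟩
  rw [Nat.add_sub_cancel, pow_succ, pow_succ, ← mul_add]
  gcongr
  linarith

/-- One step of the hypercontractive induction. -/
lemma sum_noise_pow_le (m : ℕ) (hm : 1 ≤ m) (ρ : ℝ)
    (hρ : ∀ u v w : ℝ, 0 ≤ u → 0 ≤ w → v ^ 2 ≤ u * w →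
      (u + (2 * ρ * v + ρ ^ 2 * w)) ^ m ≤
        u ^ m + 2 * ρ * m * (u ^ (m - 1) * v) + u ^ (m - 1) * w + w ^ m)
    (H : AddSubgroup G) {κ : Type*} [Fintype κ] (F : κ → G → ℂ) :
    ∑ x, (∑ j, ‖avgOp ℂ H (F j) x + ρ * (F j - avgOp ℂ H (F j)) x‖ ^ 2) ^ m ≤
      ∑ x, (avgOp ℝ H (fun x => ∑ j, ‖F j x‖ ^ 2) x) ^ m +
        ∑ x, (∑ j, ‖(F j - avgOp ℂ H (F j)) x‖ ^ 2) ^ m := by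
  set a : κ → G → ℂ := fun j => avgOp ℂ H (F j) with ha
  set b : κ → G → ℂ := fun j => F j - avgOp ℂ H (F j) with hb
  set u : G → ℝ := fun x => ∑ j, ‖a j x‖ ^ 2 with hu
  set w : G → ℝ := fun x => ∑ j, ‖b j x‖ ^ 2 with hw
  set v : G → ℝ := fun x => ∑ j, (a j x * (starRingEnd ℂ) (b j x)).re with hv
  have hexp : ∀ (r : ℝ) (x : G), ∑ j, ‖a j x + r * b j x‖ ^ 2 =
      u x + (2 * r * v x + r ^ 2 * w x) := by
    intro r x
    rw [hu, hv, hw]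
    simp only [Finset.mul_sum, ← Finset.sum_add_distrib]
    apply Finset.sum_congr rfl
    intro j _
    rw [← Complex.normSq_eq_norm_sq, Complex.normSq_add, map_mul (starRingEnd ℂ),
      Complex.conj_ofReal, Complex.normSq_mul, Complex.normSq_ofReal,
      ← Complex.normSq_eq_norm_sq, ← Complex.normSq_eq_norm_sq,
      show a j x * ((r : ℂ) * (starRingEnd ℂ) (b j x)) =
        (r : ℂ) * (a j x * (starRingEnd ℂ) (b j x)) by ring, Complex.re_ofReal_mul]
    ring
  have hu0 : ∀ x, 0 ≤ u x := fun x => Finset.sum_nonneg fun j _ => by positivity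
  have hw0 : ∀ x, 0 ≤ w x := fun x => Finset.sum_nonneg fun j _ => by positivity
  have hCS : ∀ x, v x ^ 2 ≤ u x * w x := by
    intro x
    have h1 : |v x| ≤ ∑ j, ‖a j x‖ * ‖b j x‖ := by
      refine (Finset.abs_sum_le_sum_abs _ _).trans (Finset.sum_le_sum fun j _ => ?_)
      refine (Complex.abs_re_le_norm _).trans ?_
      rw [norm_mul, RCLike.norm_conj]
    calc v x ^ 2 = |v x| ^ 2 := (sq_abs _).symm
      _ ≤ (∑ j, ‖a j x‖ * ‖b j x‖) ^ 2 := by gcongr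
      _ ≤ u x * w x := Finset.sum_mul_sq_le_sq_mul_sq _ _ _
  have hainv : ∀ j (x : G) (t : H), a j (x + t) = a j x := fun j x t =>
    avgOp_apply_add ℂ H (F j) x t
  have huinv : ∀ (x : G) (t : H), u (x + t) = u x := fun x t => by simp [hu, hainv]
  have hv0 : avgOp ℝ H v = 0 := by
    ext x
    rw [avgOp_apply, hv]
    simp only [hainv]
    rw [Finset.sum_comm]
    have : ∀ j, ∑ t : H, (a j x * (starRingEnd ℂ) (b j (x + t))).re = 0 := by
      intro j
      rw [← Complex.re_sum, ← Finset.mul_sum, ← map_sum]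
      have h1 := congrFun (avgOp_sub_avgOp ℂ H (F j)) x
      rw [avgOp_apply] at h1
      have h2 : ∑ t : H, b j (x + t) = 0 := by
        rcases mul_eq_zero.1 h1 with h | h
        · exact absurd h (inv_ne_zero (by exact_mod_cast Fintype.card_ne_zero))
        · exact h
      rw [h2]; simp
    rw [Finset.sum_eq_zero fun j _ => this j, mul_zero]
    rfl
  have hE : avgOp ℝ H (fun x => ∑ j, ‖F j x‖ ^ 2) = u + avgOp ℝ H w := by
    have h1 : (fun x => ∑ j, ‖F j x‖ ^ 2) = u + ((2 : ℝ) • v + w) := by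
      ext x
      have := hexp 1 x
      simp only [Pi.add_apply, Pi.smul_apply, smul_eq_mul]
      rw [show u x + (2 * v x + w x) = u x + (2 * 1 * v x + 1 ^ 2 * w x) by ring, ← this]
      apply Finset.sum_congr rfl
      intro j _
      simp [ha, hb]
    rw [h1, map_add, map_add, map_smul, hv0, avgOp_of_invariant ℝ H u huinv]
    simp
  have hupinv : ∀ (x : G) (t : H), u (x + t) ^ (m - 1) = u x ^ (m - 1) := fun x t => by
    rw [huinv]
  have s1 : ∑ x, u x ^ (m - 1) * v x = 0 := by
    rw [← sum_mul_avgOp H (fun x => u x ^ (m - 1)) v hupinv, hv0]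
    simp
  have s2 := sum_mul_avgOp H (fun x => u x ^ (m - 1)) w hupinv
  calc ∑ x, (∑ j, ‖a j x + ρ * b j x‖ ^ 2) ^ m
      ≤ ∑ x, (u x ^ m + 2 * ρ * m * (u x ^ (m - 1) * v x) + u x ^ (m - 1) * w x + w x ^ m) := by
        apply Finset.sum_le_sum
        intro x _
        rw [hexp]
        exact hρ _ _ _ (hu0 x) (hw0 x) (hCS x)
    _ = ∑ x, (u x ^ m + u x ^ (m - 1) * avgOp ℝ H w x) + ∑ x, w x ^ m := by
        simp only [Finset.sum_add_distrib]
        rw [← Finset.mul_sum, s1, s2]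
        ring
    _ ≤ _ := by
        gcongr with x _
        rw [hE]
        exact add_pow_ge_aux _ _ (hu0 x) (avgOp_nonneg H w hw0 x) m hm

/-- The noise operator associated with a list of subgroups. -/
noncomputable def noiseOp (ρ : ℝ) (R : List (AddSubgroup G)) : Module.End ℂ (G → ℂ) :=
  (R.map fun H => avgOp ℂ H + (ρ : ℂ) • (1 - avgOp ℂ H)).prod

/-- The projection killing everything invariant under one of the subgroups. -/
noncomputable def diffOp (S : List (AddSubgroup G)) : Module.End ℂ (G → ℂ) :=
  (S.map fun H => 1 - avgOp ℂ H).prod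

/-- The iterated average over a list of subgroups. -/
noncomputable def avgListOp (W : List (AddSubgroup G)) : Module.End ℝ (G → ℝ) :=
  (W.map fun H => avgOp ℝ H).prod

/-- All ways of splitting a list into two complementary sublists. -/
def listSplits {α : Type*} : List α → List (List α × List α)
  | [] => [([], [])]
  | a :: l => (listSplits l).map (fun p => (p.1, a :: p.2)) ++
      (listSplits l).map (fun p => (a :: p.1, p.2))

lemma noise_commute_of_commute (ρ : ℝ) (H : AddSubgroup G) (T : Module.End ℂ (G → ℂ))
    (hT : Commute T (avgOp ℂ H)) :
    Commute T (avgOp ℂ H + (ρ : ℂ) • (1 - avgOp ℂ H)) :=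
  hT.add_right (((Commute.one_right T).sub_right hT).smul_right _)

lemma noiseOp_commute_of (ρ : ℝ) (R : List (AddSubgroup G)) (T : Module.End ℂ (G → ℂ))
    (hT : ∀ H, Commute T (avgOp ℂ H)) : Commute T (noiseOp ρ R) := by
  apply Commute.list_prod_right
  intro A hA
  obtain ⟨H, _, rfl⟩ := List.mem_map.1 hA
  exact noise_commute_of_commute ρ H T (hT H)

lemma diffOp_commute_of (R : List (AddSubgroup G)) (T : Module.End ℂ (G → ℂ))
    (hT : ∀ H, Commute T (avgOp ℂ H)) : Commute T (diffOp R) := by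
  apply Commute.list_prod_right
  intro A hA
  obtain ⟨H, _, rfl⟩ := List.mem_map.1 hA
  exact (Commute.one_right T).sub_right (hT H)

/-- The translates of a family by the elements of `H`, normalised. -/
noncomputable def translateFamily {κ : Type*} (H : AddSubgroup G) (f : κ → G → ℂ) :
    κ × H → G → ℂ :=
  fun p => ((Real.sqrt (Fintype.card H) : ℂ))⁻¹ • shiftOp ℂ (p.2 : G) (f p.1)

lemma sum_norm_translateFamily {κ : Type*} [Fintype κ] (H : AddSubgroup G) (f : κ → G → ℂ)
    (T : Module.End ℂ (G → ℂ)) (hT : ∀ s : G, Commute T (shiftOp ℂ s)) (x : G) :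
    ∑ p, ‖T (translateFamily H f p) x‖ ^ 2 =
      avgOp ℝ H (fun x => ∑ j, ‖T (f j) x‖ ^ 2) x := by
  rw [avgOp_apply, Fintype.sum_prod_type, Finset.sum_comm, Finset.mul_sum]
  apply Finset.sum_congr rfl
  intro t _
  rw [Finset.mul_sum]
  apply Finset.sum_congr rfl
  intro j _
  have h1 : T (translateFamily H f (j, t)) x =
      ((Real.sqrt (Fintype.card H) : ℂ))⁻¹ * T (f j) (x + t) := by
    unfold translateFamily
    rw [map_smul]
    have := congrArg (fun A => A (f j) x) (hT t).eq
    simp only [Module.End.mul_apply, shiftOp_apply] at this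
    rw [Pi.smul_apply, this, smul_eq_mul]
  rw [h1, norm_mul, mul_pow, norm_inv, Complex.norm_real, inv_pow, Real.norm_eq_abs, sq_abs,
    Real.sq_sqrt (by positivity)]

lemma avgOp_commute_diffOp (H : AddSubgroup G) (S : List (AddSubgroup G)) :
    Commute (avgOp ℂ H) (diffOp S) :=
  diffOp_commute_of S _ fun H' => avgOp_commute ℂ H H'

lemma avgOp_commute_noiseOp (ρ : ℝ) (H : AddSubgroup G) (S : List (AddSubgroup G)) :
    Commute (avgOp ℂ H) (noiseOp ρ S) :=
  noiseOp_commute_of ρ S _ fun H' => avgOp_commute ℂ H H'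

lemma shiftOp_commute_diffOp (s : G) (S : List (AddSubgroup G)) :
    Commute (diffOp S) (shiftOp ℂ s) :=
  (diffOp_commute_of S _ fun H' => (avgOp_commute_shiftOp ℂ H' s).symm).symm

lemma shiftOp_commute_noiseOp (ρ : ℝ) (s : G) (S : List (AddSubgroup G)) :
    Commute (noiseOp ρ S) (shiftOp ℂ s) :=
  (noiseOp_commute_of ρ S _ fun H' => (avgOp_commute_shiftOp ℂ H' s).symm).symm

lemma avgListOp_cons_apply (H : AddSubgroup G) (W : List (AddSubgroup G)) (g : G → ℝ) :
    avgListOp W (avgOp ℝ H g) = avgListOp (H :: W) g := by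
  have h : Commute (avgOp ℝ H) (avgListOp W) := by
    apply Commute.list_prod_right
    intro A hA
    obtain ⟨H', _, rfl⟩ := List.mem_map.1 hA
    exact avgOp_commute ℝ H H'
  have h1 : avgListOp (H :: W) = avgOp ℝ H * avgListOp W := by simp [avgListOp]
  rw [h1, h.eq, Module.End.mul_apply]

lemma noiseOp_cons_apply (ρ : ℝ) (H : AddSubgroup G) (R : List (AddSubgroup G)) (f : G → ℂ)
    (x : G) : noiseOp ρ (H :: R) f x = avgOp ℂ H (noiseOp ρ R f) x +
      ρ * (noiseOp ρ R f - avgOp ℂ H (noiseOp ρ R f)) x := by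
  have h1 : noiseOp ρ (H :: R) = (avgOp ℂ H + (ρ : ℂ) • (1 - avgOp ℂ H)) * noiseOp ρ R := by
    simp [noiseOp]
  rw [h1]
  rfl

lemma diffOp_cons_apply (H : AddSubgroup G) (S : List (AddSubgroup G)) (f : G → ℂ) :
    diffOp S (f - avgOp ℂ H f) = diffOp (H :: S) f := by
  have h1 : diffOp (H :: S) = (1 - avgOp ℂ H) * diffOp S := by simp [diffOp]
  have h2 := congrArg (fun A => A f) (avgOp_commute_diffOp H S).eq
  simp only [Module.End.mul_apply] at h2
  rw [h1, map_sub, ← h2]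
  rfl

theorem sum_noiseOp_pow_le (m : ℕ) (hm : 1 ≤ m) (ρ : ℝ)
    (hρ : ∀ u v w : ℝ, 0 ≤ u → 0 ≤ w → v ^ 2 ≤ u * w →
      (u + (2 * ρ * v + ρ ^ 2 * w)) ^ m ≤
        u ^ m + 2 * ρ * m * (u ^ (m - 1) * v) + u ^ (m - 1) * w + w ^ m)
    (R : List (AddSubgroup G)) : ∀ {κ : Type} [Fintype κ] (f : κ → G → ℂ),
    ∑ x, (∑ j, ‖noiseOp ρ R (f j) x‖ ^ 2) ^ m ≤
      ((listSplits R).map fun p =>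
        ∑ x, (avgListOp p.2 (fun x => ∑ j, ‖diffOp p.1 (f j) x‖ ^ 2) x) ^ m).sum := by
  induction R with
  | nil =>
    intro κ _ f
    simp [noiseOp, diffOp, avgListOp, listSplits]
  | cons H R ih =>
    intro κ _ f
    simp only [noiseOp_cons_apply]
    refine (sum_noise_pow_le m hm ρ hρ H fun j => noiseOp ρ R (f j)).trans ?_
    rw [listSplits, List.map_append, List.sum_append, List.map_map, List.map_map]
    refine add_le_add ?_ ?_
    · refine (le_of_eq ?_).trans ((ih (translateFamily H f)).trans (le_of_eq ?_))
      · refine Finset.sum_congr rfl fun x _ => ?_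
        rw [sum_norm_translateFamily H f _ fun s => shiftOp_commute_noiseOp ρ s R]
      · congr 1
        refine List.map_congr_left fun p _ => ?_
        simp only [Function.comp_apply]
        rw [← avgListOp_cons_apply]
        have : (fun x => ∑ j, ‖diffOp p.1 (translateFamily H f j) x‖ ^ 2) =
            avgOp ℝ H (fun x => ∑ j, ‖diffOp p.1 (f j) x‖ ^ 2) := by
          funext x
          exact sum_norm_translateFamily H f _ (fun s => shiftOp_commute_diffOp s p.1) x
        rw [this]
    · refine (le_of_eq ?_).trans
        ((ih fun j => f j - avgOp ℂ H (f j)).trans (le_of_eq ?_))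
      · refine Finset.sum_congr rfl fun x _ => ?_
        have h2 : ∀ j, noiseOp ρ R (f j - avgOp ℂ H (f j)) =
            noiseOp ρ R (f j) - avgOp ℂ H (noiseOp ρ R (f j)) := by
          intro j
          have h2 := congrArg (fun A => A (f j)) (avgOp_commute_noiseOp ρ H R).eq
          simp only [Module.End.mul_apply] at h2
          rw [map_sub, ← h2]
        simp only [h2]
      · congr 1
        refine List.map_congr_left fun p _ => ?_
        simp only [Function.comp_apply, diffOp_cons_apply]

end Averaging

lemma exists_pow_card_le (κ C₀ : ℝ) (hκ : 0 < κ) (hC₀ : 1 ≤ C₀) :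
    ∃ C : ℝ, 1 ≤ C ∧ ∀ S : Finset ℕ, (∀ p ∈ S, 1 ≤ p) →
      C₀ ^ S.card ≤ C * ((∏ p ∈ S, p : ℕ) : ℝ) ^ κ := by
  obtain ⟨P, hP⟩ := exists_nat_ge (C₀ ^ κ⁻¹)
  have hP' : ∀ p : ℕ, P ≤ p → C₀ ≤ (p : ℝ) ^ κ := by
    intro p hp
    have h1 : C₀ ^ κ⁻¹ ≤ p := hP.trans (by exact_mod_cast hp)
    calc C₀ = (C₀ ^ κ⁻¹) ^ κ := by
          rw [← Real.rpow_mul (by linarith), inv_mul_cancel₀ hκ.ne', Real.rpow_one]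
      _ ≤ _ := Real.rpow_le_rpow (by positivity) h1 hκ.le
  refine ⟨C₀ ^ P, one_le_pow₀ hC₀, fun S hS => ?_⟩
  rw [Nat.cast_prod, ← Real.finsetProd_rpow _ _ (fun i _ => by positivity)]
  rw [← Finset.prod_const, ← Finset.prod_filter_mul_prod_filter_not S (fun p => p < P),
    ← Finset.prod_filter_mul_prod_filter_not S (fun p => p < P) (fun p : ℕ => (p : ℝ) ^ κ), ← mul_assoc]
  have h1 : ∀ p ∈ S, (1 : ℝ) ≤ (p : ℝ) ^ κ := fun p hp =>
    Real.one_le_rpow (by exact_mod_cast hS p hp) hκ.le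
  gcongr with p hp
  · have : C₀ ^ (S.filter (fun p => p < P)).card ≤ C₀ ^ P := by
      apply pow_le_pow_right₀ hC₀
      calc (S.filter (fun p => p < P)).card ≤ (Finset.range P).card := by
            apply Finset.card_le_card
            intro p hp
            simpa using (Finset.mem_filter.1 hp).2
        _ = P := Finset.card_range P
    rw [Finset.prod_const]
    refine this.trans (le_mul_of_one_le_right (by positivity) ?_)
    calc (1 : ℝ) = ∏ p ∈ S with p < P, (1 : ℝ) := by simp
      _ ≤ _ := Finset.prod_le_prod (fun _ _ => zero_le_one)
        fun p hp => h1 p (Finset.mem_filter.1 hp).1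
  · exact hP' p (not_lt.1 (Finset.mem_filter.1 hp).2)

lemma card_factored_le (κ : ℝ) (hκ : 0 < κ) (Q : ℕ) (S : Finset ℕ)
    (hS : ∀ p ∈ S, p.Prime) :
    (((Finset.Icc 1 Q).filter fun n => n.primeFactors ⊆ S).card : ℝ) ≤
      (Q : ℝ) ^ κ * ((1 - (2 : ℝ) ^ (-κ))⁻¹) ^ S.card := by
  let f : ℕ →* ℝ :=
    { toFun := fun n => (n : ℝ) ^ (-κ)
      map_one' := by simp
      map_mul' := fun a b => by
        push_cast
        exact Real.mul_rpow (by positivity) (by positivity) }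
  have hf : ∀ n, f n = (n : ℝ) ^ (-κ) := fun n => rfl
  have hlt : ∀ p : ℕ, 2 ≤ p → (p : ℝ) ^ (-κ) ≤ (2 : ℝ) ^ (-κ) := fun p hp =>
    Real.rpow_le_rpow_of_nonpos (by norm_num) (by exact_mod_cast hp) (by linarith)
  have h2 : (2 : ℝ) ^ (-κ) < 1 := Real.rpow_lt_one_of_one_lt_of_neg (by norm_num) (by linarith)
  have hn : ∀ {p : ℕ}, p.Prime → ‖f p‖ < 1 := by
    intro p hp
    rw [hf, Real.norm_of_nonneg (by positivity)]
    exact (hlt p hp.two_le).trans_lt h2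
  obtain ⟨hs, hsum⟩ := EulerProduct.summable_and_hasSum_factoredNumbers_prod_filter_prime_geometric
    hn S
  have hsub : ∀ n ∈ (Finset.Icc 1 Q).filter fun n => n.primeFactors ⊆ S,
      n ∈ Nat.factoredNumbers S := by
    intro n hn
    rw [Finset.mem_filter, Finset.mem_Icc] at hn
    rw [Nat.mem_factoredNumbers_iff_primeFactors_subset]
    exact ⟨by omega, hn.2⟩
  set T := (Finset.Icc 1 Q).filter fun n => n.primeFactors ⊆ S with hT
  have hQ0 : (0 : ℝ) ≤ (Q : ℝ) ^ κ := by positivity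
  calc (T.card : ℝ) = ∑ n ∈ T, 1 := by simp
    _ ≤ ∑ n ∈ T, (Q : ℝ) ^ κ * f n := by
      apply Finset.sum_le_sum
      intro n hn
      have hn' := Finset.mem_Icc.1 (Finset.mem_filter.1 hn).1
      have hn0 : (0 : ℝ) < n := by exact_mod_cast hn'.1
      rw [hf, Real.rpow_neg hn0.le, ← div_eq_mul_inv, one_le_div (by positivity)]
      exact Real.rpow_le_rpow hn0.le (by exact_mod_cast hn'.2) hκ.le
    _ = (Q : ℝ) ^ κ * ∑ n ∈ T.subtype (· ∈ Nat.factoredNumbers S), f n := by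
      rw [← Finset.mul_sum, Finset.sum_subtype_of_mem (fun n => f n) hsub]
    _ ≤ (Q : ℝ) ^ κ * ∏ p ∈ S with p.Prime, (1 - f p)⁻¹ := by
      gcongr
      exact sum_le_hasSum _ (fun n _ => by rw [hf]; positivity) hsum
    _ ≤ (Q : ℝ) ^ κ * ((1 - (2 : ℝ) ^ (-κ))⁻¹) ^ S.card := by
      gcongr
      rw [Finset.filter_true_of_mem hS]
      rw [← Finset.prod_const]
      have h3 : ∀ p ∈ S, (0 : ℝ) < 1 - f p := fun p hp => by
        have := hlt p (hS p hp).two_le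
        rw [hf]; linarith
      refine Finset.prod_le_prod (fun p hp => (inv_pos.2 (h3 p hp)).le) fun p hp => ?_
      have := hlt p (hS p hp).two_le
      rw [hf]
      gcongr

lemma exists_card_factored_le (κ : ℝ) (hκ : 0 < κ) :
    ∃ C : ℝ, 1 ≤ C ∧ ∀ (Q : ℕ) (S : Finset ℕ), (∀ p ∈ S, p.Prime) → ∏ p ∈ S, p ≤ Q →
      (((Finset.Icc 1 Q).filter fun n => n.primeFactors ⊆ S).card : ℝ) ≤ C * (Q : ℝ) ^ κ := by
  have h2 : (2 : ℝ) ^ (-(κ / 2)) < 1 :=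
    Real.rpow_lt_one_of_one_lt_of_neg (by norm_num) (by linarith)
  have h2' : (0 : ℝ) < (2 : ℝ) ^ (-(κ / 2)) := by positivity
  obtain ⟨C, hC, h⟩ := exists_pow_card_le (κ / 2) ((1 - (2 : ℝ) ^ (-(κ / 2)))⁻¹) (by linarith)
    ((one_le_inv₀ (by linarith)).2 (by linarith))
  refine ⟨C, hC, fun Q S hS hQ => ?_⟩
  have hpos : 0 < ∏ p ∈ S, p := Finset.prod_pos fun p hp => (hS p hp).pos
  have hQ0 : (0 : ℝ) < Q := by exact_mod_cast hpos.trans_le hQ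
  calc _ ≤ _ := card_factored_le (κ / 2) (by linarith) Q S hS
    _ ≤ (Q : ℝ) ^ (κ / 2) * (C * ((∏ p ∈ S, p : ℕ) : ℝ) ^ (κ / 2)) := by
      gcongr
      exact h S fun p hp => (hS p hp).one_le
    _ ≤ (Q : ℝ) ^ (κ / 2) * (C * (Q : ℝ) ^ (κ / 2)) := by
      gcongr
    _ = C * (Q : ℝ) ^ κ := by
      rw [mul_left_comm, ← Real.rpow_add hQ0]
      ring_nf

/-- Arithmetic losses in the moment estimate are absorbed by a single power of `Q`. -/
lemma exists_loss_bound (m : ℕ) (hm : 1 ≤ m) (ρ : ℝ) (hρ : 0 < ρ) (hρ1 : ρ ≤ 1) :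
    ∃ C : ℝ, 1 ≤ C ∧ ∀ Q : ℕ, 1 ≤ Q → ∃ A : ℝ, 0 ≤ A ∧
      (∀ T : Finset ℕ, (∀ p ∈ T, p.Prime) → ∏ p ∈ T, p ≤ Q → ρ⁻¹ ^ T.card ≤ A) ∧
      ∀ S : Finset ℕ, (∀ p ∈ S, p.Prime) → ∏ p ∈ S, p ≤ Q →
      ((A * (((Finset.Icc 1 Q).filter fun n => n.primeFactors ⊆ S).card : ℝ) ^ 2) ^ 2) ^ m
        ≤ C * Q := by
  have hm0 : (0 : ℝ) < m := by exact_mod_cast hm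
  set κ : ℝ := 1 / (6 * m) with hκ
  have hκ0 : 0 < κ := by positivity
  obtain ⟨C, hC, h⟩ := exists_card_factored_le κ hκ0
  obtain ⟨C', hC', h'⟩ := exists_pow_card_le κ ρ⁻¹ hκ0 ((one_le_inv₀ hρ).2 hρ1)
  refine ⟨((C' * C ^ 2) ^ 2) ^ m, ?_, ?_⟩
  · have : 1 ≤ C' * C ^ 2 := one_le_mul_of_one_le_of_one_le hC' (one_le_pow₀ hC)
    exact one_le_pow₀ (one_le_pow₀ this)
  intro Q hQ
  have hQ0 : (0 : ℝ) < Q := by exact_mod_cast hQ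
  refine ⟨C' * (Q : ℝ) ^ κ, by positivity, ?_, ?_⟩
  · intro T hT hTQ
    have hposT : 0 < ∏ p ∈ T, p := Finset.prod_pos fun p hp => (hT p hp).pos
    refine (h' T fun p hp => (hT p hp).one_le).trans ?_
    gcongr
  intro S hS hSQ
  calc _ ≤ ((C' * (Q : ℝ) ^ κ * (C * (Q : ℝ) ^ κ) ^ 2) ^ 2) ^ m := by
        gcongr
        exact h Q S hS hSQ
    _ = ((C' * C ^ 2) ^ 2) ^ m * ((Q : ℝ) ^ κ) ^ (6 * m) := by ring
    _ = _ := by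
      rw [← Real.rpow_mul_natCast hQ0.le]
      congr 1
      rw [hκ]; push_cast
      rw [one_div_mul_cancel (by positivity), Real.rpow_one]

section CyclicCharacters

open scoped Classical

variable {D : ℕ} [NeZero D]

/-- The additive characters of `ℤ/D`. -/
noncomputable def chi (k : ZMod D) : ZMod D → ℂ := fun x => ZMod.stdAddChar (k * x)

lemma chi_apply_add (k x y : ZMod D) : chi k (x + y) = chi k x * chi k y := by
  simp only [chi, mul_add, AddChar.map_add_eq_mul]

lemma chi_add_apply (k l x : ZMod D) : chi (k + l) x = chi k x * chi l x := by
  simp only [chi, add_mul, AddChar.map_add_eq_mul]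

lemma chi_zero_apply (x : ZMod D) : chi (0 : ZMod D) x = 1 := by simp [chi]

lemma conj_chi (k x : ZMod D) : (starRingEnd ℂ) (chi k x) = chi (-k) x := by
  simp only [chi]
  rw [← AddChar.map_neg_eq_conj, neg_mul]

lemma norm_chi (k x : ZMod D) : ‖chi k x‖ = 1 := AddChar.norm_apply _ _

lemma chi_eq_one_iff (k x : ZMod D) : chi k x = 1 ↔ k * x = 0 := by
  rw [chi, ← AddChar.map_zero_eq_one (ZMod.stdAddChar (N := D))]
  exact ZMod.injective_stdAddChar.eq_iff

lemma sum_chi (k : ZMod D) : ∑ x, chi k x = if k = 0 then (D : ℂ) else 0 := by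
  have := AddChar.sum_mulShift k (ZMod.isPrimitive_stdAddChar D)
  simp only [chi]
  simp_rw [mul_comm k]
  rw [this, ZMod.card]
  split_ifs <;> simp

/-- The `p`-part of `ℤ/D`, described by duality. -/
def primePart (D : ℕ) (p : ℕ) : AddSubgroup (ZMod D) where
  carrier := {t | ∀ k : ZMod D, ¬ p ∣ addOrderOf k → k * t = 0}
  zero_mem' := fun k _ => mul_zero k
  add_mem' := fun {s t} hs ht k hk => by rw [mul_add, hs k hk, ht k hk, add_zero]
  neg_mem' := fun {s} hs k hk => by rw [mul_neg, hs k hk, neg_zero]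

lemma addOrderOf_dvd_modulus (k : ZMod D) : addOrderOf k ∣ D := by
  have := addOrderOf_dvd_card (x := k)
  rwa [ZMod.card] at this

lemma addOrderOf_dvd_iff (k : ZMod D) (n : ℕ) : addOrderOf k ∣ n ↔ k * (n : ZMod D) = 0 := by
  rw [addOrderOf_dvd_iff_nsmul_eq_zero, nsmul_eq_mul, mul_comm]

lemma exists_mem_primePart {p : ℕ} (hp : p.Prime) (k : ZMod D) (hk : p ∣ addOrderOf k) :
    ∃ t ∈ primePart D p, k * t ≠ 0 := by
  have hD := NeZero.ne D
  refine ⟨(ordCompl[p] D : ℕ), ?_, ?_⟩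
  · intro k' hk'
    rw [← addOrderOf_dvd_iff]
    have h1 : addOrderOf k' ∣ ordProj[p] D * ordCompl[p] D :=
      (addOrderOf_dvd_modulus k').trans (Nat.ordProj_mul_ordCompl_eq_self D p).symm.dvd
    exact (Nat.Coprime.pow_right _ ((Nat.Prime.coprime_iff_not_dvd hp).2 hk').symm).dvd_of_dvd_mul_left h1
  · rw [Ne, ← addOrderOf_dvd_iff]
    intro h
    exact (Nat.Prime.coprime_iff_not_dvd hp).1 (Nat.coprime_ordCompl hp hD) (hk.trans h)

lemma avgOp_primePart_chi {p : ℕ} (hp : p.Prime) (k : ZMod D) :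
    avgOp ℂ (primePart D p) (chi k) = (if p ∣ addOrderOf k then (0 : ℂ) else 1) • chi k := by
  split_ifs with h
  · rw [zero_smul]
    obtain ⟨t, ht, hkt⟩ := exists_mem_primePart hp k h
    funext x
    have h1 : avgOp ℂ (primePart D p) (chi k) x = chi k t * avgOp ℂ (primePart D p) (chi k) x := by
      have h2 := avgOp_apply_add ℂ (primePart D p) (chi k) x ⟨t, ht⟩
      conv_lhs => rw [← h2]
      rw [avgOp_apply, avgOp_apply]
      simp only [chi_apply_add, Finset.mul_sum]
      exact Finset.sum_congr rfl fun s _ => by ring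
    have h3 : chi k t ≠ 1 := fun h3 => hkt ((chi_eq_one_iff k t).1 h3)
    have h4 : (1 - chi k t) * avgOp ℂ (primePart D p) (chi k) x = 0 := by
      rw [sub_mul, one_mul, ← h1, sub_self]
    rcases mul_eq_zero.1 h4 with h5 | h5
    · exact absurd (sub_eq_zero.1 h5).symm h3
    · simpa using h5
  · rw [one_smul]
    refine avgOp_of_invariant ℂ _ _ fun x t => ?_
    rw [chi_apply_add, (chi_eq_one_iff k t).2 (t.2 k h), mul_one]

/-- The list of prime parts attached to a list of primes. -/
def primeParts (D : ℕ) (R : List ℕ) : List (AddSubgroup (ZMod D)) := R.map (primePart D)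

lemma noiseOp_chi (ρ : ℝ) (R : List ℕ) (hR : ∀ p ∈ R, p.Prime) (k : ZMod D) :
    noiseOp ρ (primeParts D R) (chi k) =
      ((ρ : ℂ) ^ (R.filter (fun p => p ∣ addOrderOf k)).length) • chi k := by
  induction R with
  | nil => simp [noiseOp, primeParts]
  | cons p R ih =>
    have h1 := ih fun q hq => hR q (List.mem_cons_of_mem _ hq)
    have h2 := avgOp_primePart_chi (hR p List.mem_cons_self) k
    funext x
    rw [primeParts, List.map_cons, noiseOp_cons_apply]
    change avgOp ℂ _ (noiseOp ρ (primeParts D R) (chi k)) x + _ *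
      (noiseOp ρ (primeParts D R) (chi k) - avgOp ℂ _ (noiseOp ρ (primeParts D R) (chi k))) x = _
    rw [h1, map_smul, h2, List.filter_cons]
    by_cases h : p ∣ addOrderOf k
    · simp [h, pow_succ]; ring
    · simp [h]

lemma diffOp_chi (R : List ℕ) (hR : ∀ p ∈ R, p.Prime) (k : ZMod D) :
    diffOp (primeParts D R) (chi k) =
      (if ∀ p ∈ R, p ∣ addOrderOf k then (1 : ℂ) else 0) • chi k := by
  induction R with
  | nil => simp [diffOp, primeParts]
  | cons p R ih =>
    have h1 := ih fun q hq => hR q (List.mem_cons_of_mem _ hq)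
    have h2 := avgOp_primePart_chi (hR p List.mem_cons_self) k
    rw [primeParts, List.map_cons, ← diffOp_cons_apply, h2, map_sub, map_smul]
    change diffOp (primeParts D R) (chi k) - _ • diffOp (primeParts D R) (chi k) = _
    rw [h1]
    by_cases h : p ∣ addOrderOf k
    · simp [h]
    · simp [h]

/-- The complex version of `avgListOp`. -/
noncomputable def avgListOpC {G : Type} [AddCommGroup G] [Fintype G] (W : List (AddSubgroup G)) :
    Module.End ℂ (G → ℂ) :=
  (W.map fun H => avgOp ℂ H).prod

lemma ofReal_avgListOp {G : Type} [AddCommGroup G] [Fintype G] (W : List (AddSubgroup G))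
    (g : G → ℝ) (x : G) :
    ((avgListOp W g x : ℝ) : ℂ) = avgListOpC W (fun y => (g y : ℂ)) x := by
  induction W generalizing x with
  | nil => simp [avgListOp, avgListOpC]
  | cons H W ih =>
    have h1 : avgListOp (H :: W) g = avgOp ℝ H (avgListOp W g) := by simp [avgListOp]
    have h2 : avgListOpC (H :: W) (fun y => (g y : ℂ)) =
        avgOp ℂ H (avgListOpC W (fun y => (g y : ℂ))) := by simp [avgListOpC]
    rw [h1, h2, avgOp_apply, avgOp_apply]
    push_cast
    simp only [ih]

lemma avgListOpC_chi (R : List ℕ) (hR : ∀ p ∈ R, p.Prime) (k : ZMod D) :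
    avgListOpC (primeParts D R) (chi k) =
      (if ∀ p ∈ R, ¬ p ∣ addOrderOf k then (1 : ℂ) else 0) • chi k := by
  induction R with
  | nil => simp [avgListOpC, primeParts]
  | cons p R ih =>
    have h1 := ih fun q hq => hR q (List.mem_cons_of_mem _ hq)
    have h2 := avgOp_primePart_chi (hR p List.mem_cons_self) k
    have h3 : avgListOpC (primeParts D (p :: R)) (chi k) =
        avgOp ℂ (primePart D p) (avgListOpC (primeParts D R) (chi k)) := by
      simp [avgListOpC, primeParts]
    rw [h3, h1, map_smul, h2]
    by_cases h : p ∣ addOrderOf k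
    · simp [h]
    · simp [h]

lemma prime_dvd_addOrderOf_add_iff {p d : ℕ} (hp : p.Prime) (hpd : ¬ p ∣ d) (k e : ZMod D)
    (he : (d : ZMod D) * e = 0) : p ∣ addOrderOf (k + e) ↔ p ∣ addOrderOf k := by
  constructor
  · intro h
    have h1 : addOrderOf (k + e) ∣ addOrderOf k * d := by
      have h3 := (addOrderOf_dvd_iff k (addOrderOf k)).1 dvd_rfl
      rw [addOrderOf_dvd_iff]
      push_cast
      linear_combination (d : ZMod D) * h3 + (addOrderOf k : ZMod D) * he
    exact ((Nat.Prime.dvd_mul hp).1 (h.trans h1)).resolve_right hpd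
  · intro h
    have h1 : addOrderOf k ∣ addOrderOf (k + e) * d := by
      have h3 := (addOrderOf_dvd_iff (k + e) (addOrderOf (k + e))).1 dvd_rfl
      rw [addOrderOf_dvd_iff]
      push_cast
      linear_combination (d : ZMod D) * h3 - (addOrderOf (k + e) : ZMod D) * he
    exact ((Nat.Prime.dvd_mul hp).1 (h.trans h1)).resolve_right hpd

lemma normSq_eq_mul_conj (z : ℂ) : ((‖z‖ ^ 2 : ℝ) : ℂ) = z * (starRingEnd ℂ) z := by
  rw [Complex.mul_conj, Complex.normSq_eq_norm_sq]

lemma sum_coset_pairs (d₁ d₂ : ℕ) (hD : d₁ * d₂ = D) (hcop : d₁.Coprime d₂) (c : ZMod D → ℂ) :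
    ∑ p ∈ (Finset.univ : Finset (ZMod D × ZMod D)).filter
        (fun p => (d₁ : ZMod D) * (p.1 - p.2) = 0), c p.1 * (starRingEnd ℂ) (c p.2) =
      ∑ e ∈ Finset.univ.filter (fun e : ZMod D => (d₂ : ZMod D) * e = 0),
        ((‖∑ k ∈ Finset.univ.filter (fun k : ZMod D => (d₁ : ZMod D) * k = 0), c (k + e)‖ ^ 2 : ℝ) : ℂ)
      := by
  have hDz : (d₁ : ZMod D) * d₂ = 0 := by
    rw [← Nat.cast_mul, hD, ZMod.natCast_self]
  obtain ⟨u, v, huv⟩ : ∃ u v : ZMod D, u * d₁ + v * d₂ = 1 := by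
    have h := (Nat.isCoprime_iff_coprime.2 hcop)
    obtain ⟨u, v, h⟩ := h
    refine ⟨u, v, ?_⟩
    have := congrArg (Int.cast : ℤ → ZMod D) h
    push_cast at this
    exact this
  simp only [normSq_eq_mul_conj, map_sum, Finset.sum_mul_sum]
  have : ∀ e, ∑ i ∈ Finset.univ.filter (fun k : ZMod D => (d₁ : ZMod D) * k = 0),
      ∑ j ∈ Finset.univ.filter (fun k : ZMod D => (d₁ : ZMod D) * k = 0),
        c (i + e) * (starRingEnd ℂ) (c (j + e)) =
      ∑ q ∈ Finset.univ.filter (fun k : ZMod D => (d₁ : ZMod D) * k = 0) ×ˢ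
        Finset.univ.filter (fun k : ZMod D => (d₁ : ZMod D) * k = 0),
        c (q.1 + e) * (starRingEnd ℂ) (c (q.2 + e)) := fun e => by
    rw [Finset.sum_product]
  simp only [this]
  rw [← Finset.sum_product']
  symm
  refine Finset.sum_nbij' (fun t => (t.2.1 + t.1, t.2.2 + t.1))
    (fun p => (u * d₁ * p.1, v * d₂ * p.1, v * d₂ * p.2)) ?_ ?_ ?_ ?_ ?_
  · rintro ⟨e, i, j⟩ h
    simp only [Finset.mem_product, Finset.mem_filter, Finset.mem_univ, true_and] at h ⊢
    linear_combination h.2.1 - h.2.2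
  · rintro ⟨k, l⟩ h
    simp only [Finset.mem_product, Finset.mem_filter, Finset.mem_univ, true_and] at h ⊢
    refine ⟨?_, ?_, ?_⟩
    · linear_combination (u * k) * hDz
    · linear_combination (v * k) * hDz
    · linear_combination (v * l) * hDz
  · rintro ⟨e, i, j⟩ h
    simp only [Finset.mem_product, Finset.mem_filter, Finset.mem_univ, true_and] at h ⊢
    obtain ⟨h1, h2, h3⟩ := h
    refine Prod.ext ?_ (Prod.ext ?_ ?_)
    · linear_combination u * h2 - v * h1 + e * huv
    · linear_combination v * h1 - u * h2 + i * huv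
    · linear_combination v * h1 - u * h3 + j * huv
  · rintro ⟨k, l⟩ h
    simp only [Finset.mem_filter, Finset.mem_univ, true_and] at h ⊢
    refine Prod.ext ?_ ?_
    · linear_combination k * huv
    · linear_combination l * huv + u * h
  · rintro ⟨e, i, j⟩ _
    rfl

lemma avgListOp_normSq_diffOp (S W : List ℕ) (hS : ∀ p ∈ S, p.Prime) (hW : ∀ p ∈ W, p.Prime)
    (d₁ d₂ : ℕ) (hD : d₁ * d₂ = D) (hcop : d₁.Coprime d₂) (hS₁ : ∀ p ∈ S, p ∣ d₁)
    (hW₂ : ∀ p : ℕ, p.Prime → (p ∈ W ↔ p ∣ d₂)) (a : ZMod D → ℂ) (x : ZMod D) :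
    avgListOp (primeParts D W)
        (fun x => ‖diffOp (primeParts D S) (∑ k, a k • chi k) x‖ ^ 2) x =
      ∑ e ∈ Finset.univ.filter (fun e : ZMod D => (d₂ : ZMod D) * e = 0),
        ‖∑ k ∈ Finset.univ.filter
          (fun k : ZMod D => (d₁ : ZMod D) * k = 0 ∧ ∀ p ∈ S, p ∣ addOrderOf k),
            a (k + e) * chi k x‖ ^ 2 := by
  set b : ZMod D → ℂ := fun k => (if ∀ p ∈ S, p ∣ addOrderOf k then (1 : ℂ) else 0) * a k with hb
  have h1 : diffOp (primeParts D S) (∑ k, a k • chi k) = ∑ k, b k • chi k := by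
    rw [map_sum]
    refine Finset.sum_congr rfl fun k _ => ?_
    rw [map_smul, diffOp_chi S hS, smul_smul, mul_comm]
  rw [← Complex.ofReal_inj, ofReal_avgListOp, h1]
  have h2 : (fun y => ((‖(∑ k, b k • chi k) y‖ ^ 2 : ℝ) : ℂ)) =
      ∑ p : ZMod D × ZMod D, (b p.1 * (starRingEnd ℂ) (b p.2)) • chi (p.1 - p.2) := by
    funext y
    rw [normSq_eq_mul_conj, Finset.sum_apply, Finset.sum_apply, map_sum, Finset.sum_mul_sum,
      ← Finset.sum_product']
    refine Finset.sum_congr rfl fun p _ => ?_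
    simp only [Pi.smul_apply, smul_eq_mul, map_mul, conj_chi, sub_eq_add_neg, chi_add_apply]
    ring
  have hord : ∀ k : ZMod D, (∀ p ∈ W, ¬ p ∣ addOrderOf k) ↔ (d₁ : ZMod D) * k = 0 := by
    intro k
    rw [mul_comm, ← addOrderOf_dvd_iff]
    constructor
    · intro h
      have h3 : addOrderOf k ∣ d₁ * d₂ := hD ▸ addOrderOf_dvd_modulus k
      refine Nat.Coprime.dvd_of_dvd_mul_right ?_ h3
      refine Nat.Coprime.symm (Nat.coprime_of_dvd fun p hp hp2 hpk => ?_)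
      exact h p ((hW₂ p hp).2 hp2) hpk
    · intro h p hpW hpk
      have hp := hW p hpW
      have h4 := Nat.dvd_gcd (hpk.trans h) ((hW₂ p hp).1 hpW)
      rw [hcop] at h4
      exact hp.one_lt.ne' (Nat.dvd_one.1 h4)
  rw [h2, map_sum, Finset.sum_apply]
  simp only [map_smul, avgListOpC_chi W hW, hord]
  have h3 := sum_coset_pairs d₁ d₂ hD hcop fun k => b k * chi k x
  rw [Finset.sum_filter] at h3
  refine (Finset.sum_congr rfl fun p _ => ?_).trans (h3.trans ?_)
  · simp only [Pi.smul_apply, smul_eq_mul, map_mul, conj_chi, sub_eq_add_neg, chi_add_apply]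
    split_ifs <;> ring
  · rw [Complex.ofReal_sum]
    refine Finset.sum_congr rfl fun e he => ?_
    have he := (Finset.mem_filter.1 he).2
    congr 2
    rw [← one_mul ‖_‖, ← norm_chi (-e) x, ← norm_mul, Finset.mul_sum, ← Finset.filter_filter,
      Finset.sum_filter (fun k => ∀ p ∈ S, p ∣ addOrderOf k)]
    congr 1
    refine Finset.sum_congr rfl fun k _ => ?_
    have h5 : (∀ p ∈ S, p ∣ addOrderOf (k + e)) ↔ (∀ p ∈ S, p ∣ addOrderOf k) := by
      refine forall₂_congr fun p hp => prime_dvd_addOrderOf_add_iff (hS p hp) ?_ k e he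
      intro hp2
      have h4 := Nat.dvd_gcd (hS₁ p hp) hp2
      rw [hcop] at h4
      exact (hS p hp).one_lt.ne' (Nat.dvd_one.1 h4)
    have h6 : chi (-e) x * chi (k + e) x = chi k x := by
      rw [← chi_add_apply]; congr 1; ring
    simp only [hb, h5]
    split_ifs
    · linear_combination (a (k + e)) * h6
    · ring

lemma sum_chi_torsion (w : ℕ) (hw : w ∣ D) (z : ℤ) :
    ∑ k ∈ Finset.univ.filter (fun k : ZMod D => (w : ZMod D) * k = 0), chi k (z : ZMod D) =
      if (w : ℤ) ∣ z then (w : ℂ) else 0 := by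
  obtain ⟨c, hc⟩ := hw
  have hD := NeZero.pos D
  have hw0 : 0 < w := Nat.pos_of_ne_zero fun h => by simp [h] at hc; omega
  have hc0 : 0 < c := Nat.pos_of_ne_zero fun h => by simp [h] at hc; omega
  have h1 : Finset.univ.filter (fun k : ZMod D => (w : ZMod D) * k = 0) =
      (Finset.range w).image fun j : ℕ => ((c * j : ℕ) : ZMod D) := by
    ext k
    simp only [Finset.mem_filter, Finset.mem_univ, true_and, Finset.mem_image, Finset.mem_range]
    constructor
    · intro h
      have h2 : D ∣ w * k.val := by
        rw [← ZMod.natCast_eq_zero_iff]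
        push_cast
        rw [ZMod.natCast_zmod_val, h]
      have h3 : c ∣ k.val := by
        obtain ⟨e, he⟩ := h2
        refine ⟨e, Nat.eq_of_mul_eq_mul_left hw0 ?_⟩
        rw [he]
        conv_lhs => rw [hc]
        ring
      obtain ⟨j, hj⟩ := h3
      refine ⟨j, ?_, ?_⟩
      · have h4 : c * j < c * w := by
          have h5 := ZMod.val_lt k
          rw [hj] at h5
          calc c * j < D := h5
            _ = c * w := by rw [mul_comm c w]; exact hc
        exact lt_of_mul_lt_mul_left h4 hc0.le
      · rw [← hj, ZMod.natCast_zmod_val]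
    · rintro ⟨j, _, rfl⟩
      have h2 : ((D * j : ℕ) : ZMod D) = 0 := by simp
      rw [← h2]
      have h3 : D * j = w * (c * j) := by rw [← mul_assoc, ← hc]
      rw [h3]
      push_cast; rfl
  rw [h1, Finset.sum_image]
  · have h2 : ∀ j : ℕ, chi ((c * j : ℕ) : ZMod D) (z : ZMod D) =
        (chi (c : ZMod D) (z : ZMod D)) ^ j := by
      intro j
      rw [chi, chi, ← AddChar.map_nsmul_eq_pow]
      congr 1
      rw [nsmul_eq_mul]; push_cast; ring
    simp only [h2]
    have h4 : chi (c : ZMod D) (z : ZMod D) = 1 ↔ (w : ℤ) ∣ z := by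
      rw [chi_eq_one_iff]
      have h5 : (c : ZMod D) * (z : ZMod D) = ((c * z : ℤ) : ZMod D) := by push_cast; rfl
      rw [h5, ZMod.intCast_zmod_eq_zero_iff_dvd]
      have h6 : (D : ℤ) = c * w := by rw [hc]; push_cast; ring
      rw [h6]
      exact mul_dvd_mul_iff_left (by exact_mod_cast hc0.ne')
    split_ifs with h
    · rw [h4.2 h]; simp
    · have h5 : chi (c : ZMod D) (z : ZMod D) - 1 ≠ 0 := sub_ne_zero.2 fun h' => h (h4.1 h')
      have h6 := geom_sum_mul (chi (c : ZMod D) (z : ZMod D)) w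
      have h7 : chi (c : ZMod D) (z : ZMod D) ^ w = 1 := by
        rw [← h2, chi_eq_one_iff]
        have : ((c * w : ℕ) : ZMod D) = 0 := by
          rw [ZMod.natCast_eq_zero_iff, mul_comm]
          exact hc.dvd
        rw [this, zero_mul]
      rw [h7, sub_self] at h6
      exact (mul_eq_zero.1 h6).resolve_right h5
  · intro i hi j hj hij
    have hi := Finset.mem_range.1 hi
    have hj := Finset.mem_range.1 hj
    have hij : ((c * i : ℕ) : ZMod D) = ((c * j : ℕ) : ZMod D) := hij
    rw [ZMod.natCast_eq_natCast_iff'] at hij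
    have hb : ∀ j, j < w → c * j < D := fun j hj => by
      calc c * j < c * w := by gcongr
        _ = D := by rw [mul_comm c w]; exact hc.symm
    rw [Nat.mod_eq_of_lt (hb i hi), Nat.mod_eq_of_lt (hb j hj)] at hij
    exact Nat.eq_of_mul_eq_mul_left hc0 hij

/-- Normalised Fourier coefficient of a set restricted to a residue class. -/
noncomputable def windowCoef (B : Finset ℤ) (L w : ℕ) (r : ℤ) (k : ZMod D) : ℂ :=
  (w / L : ℝ) * ∑ n ∈ B.filter (fun n => (w : ℤ) ∣ n - r), chi (-k) (n : ZMod D)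

/-- Frequencies compatible with a modulus at level `Q`. -/
def GoodFreq (Q w : ℕ) (k : ZMod D) : Prop :=
  addOrderOf k * w ≤ Q ∧ (addOrderOf k).Coprime w

noncomputable def windowEnergy (D : ℕ) [NeZero D] (B : Finset ℤ) (L Q w : ℕ) (r : ℤ) : ℝ :=
  ∑ k ∈ Finset.univ.filter (fun k : ZMod D => GoodFreq Q w k), ‖windowCoef B L w r k‖ ^ 2

lemma exists_crt (w v : ℕ) (h : w.Coprime v) (r x : ℤ) :
    ∃ s : ℤ, ∀ n : ℤ, ((w : ℤ) ∣ n - r ∧ (v : ℤ) ∣ n - x) ↔ ((w * v : ℕ) : ℤ) ∣ n - s := by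
  have hc := Nat.isCoprime_iff_coprime.2 h
  obtain ⟨a, b, hab⟩ := id hc
  refine ⟨r + w * a * (x - r), fun n => ?_⟩
  have h1 : (w : ℤ) ∣ (r + w * a * (x - r)) - r := ⟨a * (x - r), by ring⟩
  have h2 : (v : ℤ) ∣ (r + w * a * (x - r)) - x := ⟨b * (r - x), by
    linear_combination -(r - x) * hab⟩
  push_cast
  constructor
  · rintro ⟨h3, h4⟩
    apply hc.mul_dvd
    · have := dvd_sub h3 h1
      rwa [sub_sub_sub_cancel_right] at this
    · have := dvd_sub h4 h2
      rwa [sub_sub_sub_cancel_right] at this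
  · intro h3
    constructor
    · have := dvd_add ((Dvd.intro _ rfl).trans h3) h1
      rwa [sub_add_sub_cancel] at this
    · have := dvd_add ((Dvd.intro_left _ rfl).trans h3) h2
      rwa [sub_add_sub_cancel] at this

lemma sum_torsion_windowCoef (B : Finset ℤ) (L w v : ℕ) (hv : v ∣ D) (hc : w.Coprime v) (r : ℤ)
    (x : ZMod D) : ∃ s : ℤ, ∀ e : ZMod D,
      ∑ k ∈ Finset.univ.filter (fun k : ZMod D => (v : ZMod D) * k = 0),
        windowCoef B L w r (k + e) * chi k x = windowCoef B L (w * v) s e := by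
  obtain ⟨s, hs⟩ := exists_crt w v hc r (x.val : ℤ)
  refine ⟨s, fun e => ?_⟩
  simp only [windowCoef, Finset.mul_sum, Finset.sum_mul]
  rw [Finset.sum_comm]
  have h1 : B.filter (fun n => ((w * v : ℕ) : ℤ) ∣ n - s) =
      (B.filter (fun n => (w : ℤ) ∣ n - r)).filter (fun n => (v : ℤ) ∣ n - (x.val : ℤ)) := by
    rw [Finset.filter_filter]
    exact Finset.filter_congr fun n _ => (hs n).symm
  rw [h1, Finset.sum_filter (fun n => (v : ℤ) ∣ n - (x.val : ℤ))]
  refine Finset.sum_congr rfl fun n _ => ?_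
  have h2 : ∀ k : ZMod D, ((w / L : ℝ) : ℂ) * chi (-(k + e)) (n : ZMod D) * chi k x =
      (w / L : ℝ) * chi (-e) (n : ZMod D) * chi k (((x.val : ℤ) - n : ℤ) : ZMod D) := by
    intro k
    have h3 : (((x.val : ℤ) - n : ℤ) : ZMod D) = x + -(n : ZMod D) := by
      push_cast
      rw [ZMod.natCast_zmod_val, sub_eq_add_neg]
    have h4 : chi k (-(n : ZMod D)) = chi (-k) (n : ZMod D) := by simp [chi]
    rw [h3, chi_apply_add, h4, neg_add, chi_add_apply]
    ring
  simp only [h2]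
  rw [← Finset.mul_sum, sum_chi_torsion v hv]
  have h5 : (v : ℤ) ∣ (x.val : ℤ) - n ↔ (v : ℤ) ∣ n - (x.val : ℤ) := dvd_sub_comm
  simp only [h5]
  split_ifs
  · push_cast; ring
  · simp

lemma norm_sum_order_le (v : ℕ) (hv : 0 < v) (f : ZMod D → ℂ) :
    ‖∑ k ∈ Finset.univ.filter (fun k : ZMod D => addOrderOf k = v), f k‖ ≤
      ∑ u ∈ v.divisors,
        ‖∑ k ∈ Finset.univ.filter (fun k : ZMod D => (u : ZMod D) * k = 0), f k‖ := by
  have h1 := (ArithmeticFunction.sum_eq_iff_sum_mul_moebius_eq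
    (f := fun v => ∑ k ∈ Finset.univ.filter (fun k : ZMod D => addOrderOf k = v), f k)
    (g := fun v => ∑ k ∈ Finset.univ.filter (fun k : ZMod D => (v : ZMod D) * k = 0), f k)).1 ?_
    v hv
  · rw [← h1]
    refine (norm_sum_le _ _).trans ?_
    rw [← Nat.sum_divisorsAntidiagonal' (fun _ u =>
      ‖∑ k ∈ Finset.univ.filter (fun k : ZMod D => (u : ZMod D) * k = 0), f k‖)]
    refine Finset.sum_le_sum fun p _ => ?_
    rw [norm_mul]
    refine mul_le_of_le_one_left (norm_nonneg _) ?_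
    rw [Complex.norm_intCast]
    exact_mod_cast ArithmeticFunction.abs_moebius_le_one
  · intro n hn
    have : ∀ k : ZMod D, (n : ZMod D) * k = 0 ↔ addOrderOf k ∣ n := fun k => by
      rw [addOrderOf_dvd_iff, mul_comm]
    simp only [this]
    rw [← Finset.sum_fiberwise_of_maps_to
      (s := Finset.univ.filter (fun k : ZMod D => addOrderOf k ∣ n)) (t := n.divisors)
      (g := fun k : ZMod D => addOrderOf k)]
    · refine Finset.sum_congr rfl fun u hu => ?_
      rw [Finset.filter_filter]
      refine Finset.sum_congr (Finset.filter_congr fun k _ => ?_) fun _ _ => rfl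
      constructor
      · intro h
        exact ⟨h ▸ (Nat.mem_divisors.1 hu).1, h⟩
      · exact fun h => h.2
    · intro k hk
      exact Nat.mem_divisors.2 ⟨(Finset.mem_filter.1 hk).2, hn.ne'⟩

/-- Coefficients rescaled so that the noise operator brings them back. -/
noncomputable def boostedCoef (B : Finset ℤ) (L Q w : ℕ) (r : ℤ) (ρ : ℝ) (k : ZMod D) : ℂ :=
  if GoodFreq Q w k then ((ρ⁻¹ ^ (addOrderOf k).primeFactors.card : ℝ) : ℂ) * windowCoef B L w r k
  else 0

lemma GoodFreq.prod_primeFactors_le {Q w : ℕ} {k : ZMod D} (h : GoodFreq Q w k) (hw : 1 ≤ w) :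
    ∏ p ∈ (addOrderOf k).primeFactors, p ≤ Q := by
  refine (Nat.le_of_dvd (addOrderOf_pos k) (Nat.prod_primeFactors_dvd _)).trans ?_
  exact (Nat.le_mul_of_pos_right _ hw).trans h.1

lemma addOrderOf_add_of_coprime {d₁ d₂ : ℕ} (hcop : d₁.Coprime d₂) (k e : ZMod D)
    (hk : (d₁ : ZMod D) * k = 0) (he : (d₂ : ZMod D) * e = 0) :
    (addOrderOf k).Coprime (addOrderOf e) ∧
      addOrderOf (k + e) = addOrderOf k * addOrderOf e := by
  have h1 : addOrderOf k ∣ d₁ := by rw [addOrderOf_dvd_iff, mul_comm, hk]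
  have h2 : addOrderOf e ∣ d₂ := by rw [addOrderOf_dvd_iff, mul_comm, he]
  have h3 := Nat.Coprime.of_dvd h1 h2 hcop
  exact ⟨h3, AddCommute.addOrderOf_add_eq_mul_addOrderOf_of_coprime (add_comm k e) h3⟩

lemma norm_sum_boostedCoef_le (B : Finset ℤ) (L Q w : ℕ) (hw : 1 ≤ w) (r : ℤ) (ρ A : ℝ)
    (hρ : 0 < ρ) (hA0 : 0 ≤ A)
    (hA : ∀ T : Finset ℕ, (∀ p ∈ T, p.Prime) → ∏ p ∈ T, p ≤ Q → ρ⁻¹ ^ T.card ≤ A)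
    (S : List ℕ) (d₁ d₂ : ℕ) (hD : d₁ * d₂ = D) (hcop : d₁.Coprime d₂)
    (hS₁ : ∀ p : ℕ, p.Prime → (p ∈ S ↔ p ∣ d₁)) (hS : ∀ p ∈ S, p.Prime)
    (x : ZMod D) (s : ℕ → ℤ)
    (hs : ∀ v, v ∣ D → w.Coprime v → ∀ e : ZMod D,
      ∑ k ∈ Finset.univ.filter (fun k : ZMod D => (v : ZMod D) * k = 0),
        windowCoef B L w r (k + e) * chi k x = windowCoef B L (w * v) (s v) e)
    (e : ZMod D) (he : (d₂ : ZMod D) * e = 0) :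
    ‖∑ k ∈ Finset.univ.filter
        (fun k : ZMod D => (d₁ : ZMod D) * k = 0 ∧ ∀ p ∈ S, p ∣ addOrderOf k),
          boostedCoef B L Q w r ρ (k + e) * chi k x‖ ≤
      A * ((((Finset.Icc 1 Q).filter fun n => n.primeFactors ⊆ S.toFinset).card : ℝ) *
        ∑ v ∈ (Finset.Icc 1 Q).filter fun n => n.primeFactors ⊆ S.toFinset,
          if GoodFreq Q (w * v) e then ‖windowCoef B L (w * v) (s v) e‖ else 0) := by
  set cand := (Finset.Icc 1 Q).filter fun n => n.primeFactors ⊆ S.toFinset with hcand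
  set K := Finset.univ.filter
    (fun k : ZMod D => ((d₁ : ZMod D) * k = 0 ∧ ∀ p ∈ S, p ∣ addOrderOf k) ∧
      GoodFreq Q w (k + e)) with hK
  set c : ℝ := ρ⁻¹ ^ (S.toFinset.card + (addOrderOf e).primeFactors.card) with hc
  have hprimes : ∀ k : ZMod D, (d₁ : ZMod D) * k = 0 → (∀ p ∈ S, p ∣ addOrderOf k) →
      (addOrderOf k).primeFactors = S.toFinset := by
    intro k hk hkS
    have h1 : addOrderOf k ∣ d₁ := by rw [addOrderOf_dvd_iff, mul_comm, hk]
    ext p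
    rw [List.mem_toFinset, Nat.mem_primeFactors]
    constructor
    · rintro ⟨hp, hpk, _⟩
      exact (hS₁ p hp).2 (hpk.trans h1)
    · intro hp
      exact ⟨hS p hp, hkS p hp, (addOrderOf_pos k).ne'⟩
  have hcard : ∀ k : ZMod D, (d₁ : ZMod D) * k = 0 → (∀ p ∈ S, p ∣ addOrderOf k) →
      (addOrderOf (k + e)).primeFactors.card =
        S.toFinset.card + (addOrderOf e).primeFactors.card := by
    intro k hk hkS
    obtain ⟨h1, h2⟩ := addOrderOf_add_of_coprime hcop k e hk he
    rw [h2, h1.primeFactors_mul, Finset.card_union_of_disjoint h1.disjoint_primeFactors,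
      hprimes k hk hkS]
  have hstep : ∑ k ∈ Finset.univ.filter
        (fun k : ZMod D => (d₁ : ZMod D) * k = 0 ∧ ∀ p ∈ S, p ∣ addOrderOf k),
          boostedCoef B L Q w r ρ (k + e) * chi k x =
      (c : ℂ) * ∑ k ∈ K, windowCoef B L w r (k + e) * chi k x := by
    have hKK : K = (Finset.univ.filter
        (fun k : ZMod D => (d₁ : ZMod D) * k = 0 ∧ ∀ p ∈ S, p ∣ addOrderOf k)).filter
          (fun k => GoodFreq Q w (k + e)) := by rw [hK, Finset.filter_filter]
    rw [hKK, Finset.sum_filter (fun k => GoodFreq Q w (k + e)), Finset.mul_sum]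
    refine Finset.sum_congr rfl fun k hk => ?_
    have hk := (Finset.mem_filter.1 hk).2
    unfold boostedCoef
    rw [hcard k hk.1 hk.2]
    split_ifs
    · rw [hc]; ring
    · simp
  rw [hstep, norm_mul, Complex.norm_real, Real.norm_of_nonneg (by positivity)]
  rcases K.eq_empty_or_nonempty with hKe | ⟨k₀, hk₀⟩
  · rw [hKe]
    simp only [Finset.sum_empty, norm_zero, mul_zero]
    refine mul_nonneg hA0 (mul_nonneg (by positivity) (Finset.sum_nonneg fun v _ => ?_))
    split_ifs <;> positivity
  have hcA : c ≤ A := by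
    have hk := (Finset.mem_filter.1 hk₀).2
    rw [hc, ← hcard k₀ hk.1.1 hk.1.2]
    exact hA _ (fun p hp => Nat.prime_of_mem_primeFactors hp) (hk.2.prod_primeFactors_le hw)
  refine mul_le_mul hcA ?_ (norm_nonneg _) hA0
  have hmaps : ∀ k ∈ K, addOrderOf k ∈ cand := by
    intro k hk
    have hk := (Finset.mem_filter.1 hk).2
    rw [hcand, Finset.mem_filter, Finset.mem_Icc]
    refine ⟨⟨addOrderOf_pos k, ?_⟩, (hprimes k hk.1.1 hk.1.2).le⟩
    have h2 := hk.2.1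
    rw [(addOrderOf_add_of_coprime hcop k e hk.1.1 he).2] at h2
    calc addOrderOf k = addOrderOf k * 1 * 1 := by ring
      _ ≤ addOrderOf k * addOrderOf e * w := by
        gcongr
        exact addOrderOf_pos e
      _ ≤ Q := h2
  rw [← Finset.sum_fiberwise_of_maps_to hmaps]
  refine (norm_sum_le _ _).trans ?_
  rw [← nsmul_eq_mul]
  refine Finset.sum_le_card_nsmul _ _ _ fun q hq => ?_
  rcases (K.filter (fun k => addOrderOf k = q)).eq_empty_or_nonempty with hE | ⟨k₁, hk₁⟩
  · rw [hE]
    simp only [Finset.sum_empty, norm_zero]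
    refine Finset.sum_nonneg fun v _ => ?_
    split_ifs <;> positivity
  rw [Finset.mem_filter] at hk₁
  obtain ⟨hk₁K, hk₁q⟩ := hk₁
  have hk₁' := (Finset.mem_filter.1 hk₁K).2
  obtain ⟨hcop₁, hord₁⟩ := addOrderOf_add_of_coprime hcop k₁ e hk₁'.1.1 he
  have hq0 : 0 < q := hk₁q ▸ addOrderOf_pos k₁
  have hqd : q ∣ d₁ := by rw [← hk₁q, addOrderOf_dvd_iff, mul_comm, hk₁'.1.1]
  have hgood : q * addOrderOf e * w ≤ Q := by
    have := hk₁'.2.1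
    rwa [hord₁, hk₁q] at this
  have hgc : (q * addOrderOf e).Coprime w := by
    have := hk₁'.2.2
    rwa [hord₁, hk₁q] at this
  have hset : K.filter (fun k => addOrderOf k = q) =
      Finset.univ.filter (fun k : ZMod D => addOrderOf k = q) := by
    ext k
    simp only [hK, Finset.mem_filter, Finset.mem_univ, true_and]
    constructor
    · exact fun h => h.2
    · intro h
      have hk : (d₁ : ZMod D) * k = 0 := by
        rw [mul_comm, ← addOrderOf_dvd_iff, h]; exact hqd
      obtain ⟨h1, h2⟩ := addOrderOf_add_of_coprime hcop k e hk he
      refine ⟨⟨⟨hk, fun p hp => ?_⟩, ?_, ?_⟩, h⟩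
      · rw [h, ← hk₁q]; exact hk₁'.1.2 p hp
      · rw [h2, h]; exact hgood
      · rw [h2, h]; exact hgc
  rw [hset]
  refine (norm_sum_order_le q hq0 _).trans ?_
  have hdiv : ∀ v ∈ q.divisors, v ∈ cand ∧ GoodFreq Q (w * v) e ∧
      ∑ k ∈ Finset.univ.filter (fun k : ZMod D => (v : ZMod D) * k = 0),
        windowCoef B L w r (k + e) * chi k x = windowCoef B L (w * v) (s v) e := by
    intro v hv
    have hvq := (Nat.mem_divisors.1 hv).1
    have hvle := Nat.le_of_dvd hq0 hvq
    have hv0 := Nat.pos_of_dvd_of_pos hvq hq0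
    rw [hcand, Finset.mem_filter, Finset.mem_Icc] at hq ⊢
    refine ⟨⟨⟨hv0, hvle.trans hq.1.2⟩, (Nat.primeFactors_mono hvq hq0.ne').trans hq.2⟩,
      ⟨?_, ?_⟩, ?_⟩
    · calc addOrderOf e * (w * v) = v * addOrderOf e * w := by ring
        _ ≤ q * addOrderOf e * w := by gcongr
        _ ≤ Q := hgood
    · refine Nat.Coprime.mul_right (Nat.Coprime.coprime_mul_left hgc) ?_
      rw [hk₁q] at hcop₁
      exact (Nat.Coprime.coprime_dvd_left hvq hcop₁).symm
    · refine hs v (hvq.trans (hqd.trans (hD ▸ Dvd.intro _ rfl))) ?_ e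
      exact (Nat.Coprime.coprime_dvd_left hvq (Nat.Coprime.coprime_mul_right hgc)).symm
  calc _ ≤ ∑ v ∈ q.divisors,
        if GoodFreq Q (w * v) e then ‖windowCoef B L (w * v) (s v) e‖ else 0 := by
        refine Finset.sum_le_sum fun v hv => ?_
        obtain ⟨_, h2, h3⟩ := hdiv v hv
        rw [if_pos h2, h3]
    _ ≤ _ := by
        refine Finset.sum_le_sum_of_subset_of_nonneg (fun v hv => (hdiv v hv).1) fun v _ _ => ?_
        split_ifs <;> positivity

lemma avgListOp_boosted_le (B : Finset ℤ) (L Q w : ℕ) (hw : 1 ≤ w) (r : ℤ) (ρ A M : ℝ)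
    (hρ : 0 < ρ) (hA0 : 0 ≤ A)
    (hA : ∀ T : Finset ℕ, (∀ p ∈ T, p.Prime) → ∏ p ∈ T, p ≤ Q → ρ⁻¹ ^ T.card ≤ A)
    (hM : ∀ v : ℕ, 1 ≤ v → ∀ s : ℤ, windowEnergy D B L Q v s ≤ M)
    (S W : List ℕ) (hS : ∀ p ∈ S, p.Prime) (hW : ∀ p ∈ W, p.Prime)
    (d₁ d₂ : ℕ) (hD : d₁ * d₂ = D) (hcop : d₁.Coprime d₂)
    (hS₁ : ∀ p : ℕ, p.Prime → (p ∈ S ↔ p ∣ d₁))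
    (hW₂ : ∀ p : ℕ, p.Prime → (p ∈ W ↔ p ∣ d₂)) (x : ZMod D) :
    avgListOp (primeParts D W) (fun x =>
        ‖diffOp (primeParts D S) (∑ k, boostedCoef B L Q w r ρ k • chi k) x‖ ^ 2) x ≤
      (A * (((Finset.Icc 1 Q).filter fun n => n.primeFactors ⊆ S.toFinset).card : ℝ) ^ 2) ^ 2
        * M := by
  rw [avgListOp_normSq_diffOp S W hS hW d₁ d₂ hD hcop (fun p hp => (hS₁ p (hS p hp)).1 hp) hW₂]
  set cand := (Finset.Icc 1 Q).filter fun n => n.primeFactors ⊆ S.toFinset with hcand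
  have hex : ∀ v : ℕ, ∃ s : ℤ, v ∣ D → w.Coprime v → ∀ e : ZMod D,
      ∑ k ∈ Finset.univ.filter (fun k : ZMod D => (v : ZMod D) * k = 0),
        windowCoef B L w r (k + e) * chi k x = windowCoef B L (w * v) s e := by
    intro v
    by_cases h1 : v ∣ D
    · by_cases h2 : w.Coprime v
      · obtain ⟨s, hs⟩ := sum_torsion_windowCoef B L w v h1 h2 r x
        exact ⟨s, fun _ _ => hs⟩
      · exact ⟨0, fun _ h => absurd h h2⟩
    · exact ⟨0, fun h => absurd h h1⟩
  choose s hs using hex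
  set t : ZMod D → ℕ → ℝ := fun e v =>
    if GoodFreq Q (w * v) e then ‖windowCoef B L (w * v) (s v) e‖ else 0 with ht
  calc _ ≤ ∑ e ∈ Finset.univ.filter (fun e : ZMod D => (d₂ : ZMod D) * e = 0),
        A ^ 2 * (cand.card : ℝ) ^ 3 * ∑ v ∈ cand, t e v ^ 2 := by
        refine Finset.sum_le_sum fun e he => ?_
        have h1 := norm_sum_boostedCoef_le B L Q w hw r ρ A hρ hA0 hA S d₁ d₂ hD hcop hS₁ hS x s
          hs e (Finset.mem_filter.1 he).2
        calc _ ≤ (A * (cand.card * ∑ v ∈ cand, t e v)) ^ 2 := by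
              gcongr
          _ = A ^ 2 * (cand.card : ℝ) ^ 2 * (∑ v ∈ cand, t e v) ^ 2 := by ring
          _ ≤ A ^ 2 * (cand.card : ℝ) ^ 2 * (cand.card * ∑ v ∈ cand, t e v ^ 2) := by
              gcongr
              exact sq_sum_le_card_mul_sum_sq
          _ = _ := by ring
    _ = A ^ 2 * (cand.card : ℝ) ^ 3 * ∑ v ∈ cand,
          ∑ e ∈ Finset.univ.filter (fun e : ZMod D => (d₂ : ZMod D) * e = 0), t e v ^ 2 := by
        rw [← Finset.mul_sum, Finset.sum_comm]
    _ ≤ A ^ 2 * (cand.card : ℝ) ^ 3 * (cand.card • M) := by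
        gcongr
        refine Finset.sum_le_card_nsmul _ _ _ fun v hv => ?_
        have hv1 : 1 ≤ v := (Finset.mem_Icc.1 (Finset.mem_filter.1 hv).1).1
        refine le_trans ?_ (hM (w * v) (Nat.one_le_iff_ne_zero.2 (by positivity)) (s v))
        rw [windowEnergy, Finset.sum_filter (fun k : ZMod D => GoodFreq Q (w * v) k)]
        refine (Finset.sum_le_sum_of_subset_of_nonneg (Finset.filter_subset _ _)
          fun e _ _ => by positivity).trans (Finset.sum_le_sum fun e _ => ?_)
        simp only [ht]
        split_ifs <;> simp
    _ = _ := by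
        rw [nsmul_eq_mul]; ring

end CyclicCharacters

lemma listSplits_map {α β : Type*} (f : α → β) (l : List α) :
    listSplits (l.map f) = (listSplits l).map fun p => (p.1.map f, p.2.map f) := by
  induction l with
  | nil => simp [listSplits]
  | cons a l ih =>
    simp [listSplits, ih, List.map_append, List.map_map, Function.comp_def]

lemma perm_of_mem_listSplits {α : Type*} (l : List α) : ∀ p ∈ listSplits l,
    (p.1 ++ p.2).Perm l := by
  induction l with
  | nil => simp [listSplits]
  | cons a l ih =>
    intro p hp
    rw [listSplits, List.mem_append, List.mem_map, List.mem_map] at hp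
    rcases hp with ⟨q, hq, rfl⟩ | ⟨q, hq, rfl⟩
    · exact List.perm_middle.trans ((ih q hq).cons a)
    · exact (ih q hq).cons a

lemma nodup_listSplits_prod (l : List ℕ) (hl : l.Nodup) (hp : ∀ p ∈ l, p.Prime) :
    ((listSplits l).map fun p => p.1.prod).Nodup := by
  induction l with
  | nil => simp [listSplits]
  | cons a l ih =>
    have ha := hp a List.mem_cons_self
    have hl' := List.nodup_cons.1 hl
    have ih := ih hl'.2 fun p h => hp p (List.mem_cons_of_mem _ h)
    rw [listSplits, List.map_append, List.map_map, List.map_map]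
    refine List.Nodup.append ih ?_ ?_
    · have : ((listSplits l).map ((fun p => p.1.prod) ∘ fun p => (a :: p.1, p.2))) =
          ((listSplits l).map fun p => p.1.prod).map fun n => a * n := by
        rw [List.map_map]
        refine List.map_congr_left fun p _ => ?_
        simp
      rw [this]
      exact ih.map fun x y h => Nat.eq_of_mul_eq_mul_left ha.pos h
    · intro n hn hn'
      simp only [List.mem_map, Function.comp_apply, List.prod_cons] at hn hn'
      obtain ⟨q, hq, rfl⟩ := hn
      obtain ⟨q', hq', h⟩ := hn'
      have h1 : a ∣ q.1.prod := h ▸ Dvd.intro _ rfl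
      obtain ⟨b, hb, hab⟩ := (Prime.dvd_prod_iff ha.prime).1 h1
      have hbl : b ∈ l := (perm_of_mem_listSplits l q hq).subset (List.mem_append_left _ hb)
      rw [(Nat.prime_dvd_prime_iff_eq ha (hp b (List.mem_cons_of_mem _ hbl))).1 hab] at hl'
      exact hl'.1 hbl

lemma list_sum_le_of_nodup {α : Type*} (l : List α) (g : α → ℕ) (f : α → ℝ) (Q : ℕ) (b : ℝ)
    (hb : 0 ≤ b) (hg : (l.map g).Nodup) (hg1 : ∀ a ∈ l, 1 ≤ g a)
    (h : ∀ a ∈ l, f a ≤ if g a ≤ Q then b else 0) : (l.map f).sum ≤ Q * b := by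
  calc (l.map f).sum ≤ (l.map fun a => if g a ≤ Q then b else 0).sum := List.sum_le_sum h
    _ = ((l.map g).map fun n => if n ≤ Q then b else 0).sum := by
      rw [List.map_map]; rfl
    _ = ∑ n ∈ (l.map g).toFinset, if n ≤ Q then b else 0 := (List.sum_toFinset _ hg).symm
    _ = ((l.map g).toFinset.filter (fun n => n ≤ Q)).card * b := by
      rw [← Finset.sum_filter, Finset.sum_const, nsmul_eq_mul]
    _ ≤ Q * b := by
      gcongr
      calc _ ≤ (Finset.Icc 1 Q).card := by
            apply Finset.card_le_card
            intro n hn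
            simp only [Finset.mem_filter, List.mem_toFinset, List.mem_map] at hn
            obtain ⟨⟨a, ha, rfl⟩, h2⟩ := hn
            exact Finset.mem_Icc.2 ⟨hg1 a ha, h2⟩
        _ = Q := by simp

section CyclicCharacters

open scoped Classical

variable {D : ℕ} [NeZero D]

lemma split_modulus (S W : List ℕ) (hperm : (S ++ W).Perm D.primeFactors.toList) :
    ∃ d₁ d₂ : ℕ, d₁ * d₂ = D ∧ d₁.Coprime d₂ ∧ (∀ p : ℕ, p.Prime → (p ∈ S ↔ p ∣ d₁)) ∧
      (∀ p : ℕ, p.Prime → (p ∈ W ↔ p ∣ d₂)) := by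
  have hmem : ∀ p, p ∈ S ++ W → p.Prime ∧ p ∣ D := fun p hp => by
    have := hperm.subset hp
    rw [Finset.mem_toList] at this
    exact ⟨Nat.prime_of_mem_primeFactors this, Nat.dvd_of_mem_primeFactors this⟩
  have hdvd : ∀ T : List ℕ, (∀ p ∈ T, p.Prime ∧ p ∣ D) → ∀ p : ℕ, p.Prime →
      (p ∈ T ↔ p ∣ (T.map fun p => p ^ D.factorization p).prod) := by
    intro T hT p hp
    rw [Prime.dvd_prod_iff hp.prime]
    constructor
    · intro h
      refine ⟨_, List.mem_map_of_mem h, dvd_pow_self p ?_⟩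
      exact (hp.factorization_pos_of_dvd (NeZero.ne D) (hT p h).2).ne'
    · rintro ⟨a, ha, hpa⟩
      obtain ⟨q, hq, rfl⟩ := List.mem_map.1 ha
      rwa [(Nat.prime_dvd_prime_iff_eq hp (hT q hq).1).1 (hp.dvd_of_dvd_pow hpa)]
  have h1 := hdvd S fun p hp => hmem p (List.mem_append_left _ hp)
  have h2 := hdvd W fun p hp => hmem p (List.mem_append_right _ hp)
  refine ⟨_, _, ?_, ?_, h1, h2⟩
  · rw [← List.prod_append, ← List.map_append, (hperm.map _).prod_eq, Finset.prod_map_toList]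
    exact Nat.prod_factorization_pow_eq_self (NeZero.ne D)
  · refine Nat.coprime_of_dvd fun p hp hp1 hp2 => ?_
    have hnd : (S ++ W).Nodup := hperm.nodup_iff.2 (Finset.nodup_toList _)
    exact (List.disjoint_of_nodup_append hnd) ((h1 p hp).2 hp1) ((h2 p hp).2 hp2)

/-- The trigonometric polynomial carrying the good frequencies. -/
noncomputable def windowPoly (B : Finset ℤ) (L Q w : ℕ) (r : ℤ) (x : ZMod D) : ℂ :=
  ∑ k ∈ Finset.univ.filter (fun k : ZMod D => GoodFreq Q w k), windowCoef B L w r k * chi k x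

lemma noiseOp_boosted (B : Finset ℤ) (L Q w : ℕ) (r : ℤ) (ρ : ℝ) (hρ : 0 < ρ) :
    noiseOp ρ (primeParts D D.primeFactors.toList) (∑ k, boostedCoef B L Q w r ρ k • chi k) =
      windowPoly B L Q w r := by
  have hpr : ∀ p ∈ D.primeFactors.toList, p.Prime := fun p hp =>
    Nat.prime_of_mem_primeFactors (Finset.mem_toList.1 hp)
  funext x
  rw [map_sum, Finset.sum_apply, windowPoly, Finset.sum_filter]
  refine Finset.sum_congr rfl fun k _ => ?_
  rw [map_smul, noiseOp_chi ρ _ hpr, Pi.smul_apply, Pi.smul_apply, smul_eq_mul, smul_eq_mul]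
  have hlen : (D.primeFactors.toList.filter (fun p => p ∣ addOrderOf k)).length =
      (addOrderOf k).primeFactors.card := by
    rw [← List.toFinset_card_of_nodup ((Finset.nodup_toList _).filter _)]
    congr 1
    ext p
    simp only [List.mem_toFinset, List.mem_filter, Finset.mem_toList, decide_eq_true_eq,
      Nat.mem_primeFactors]
    constructor
    · rintro ⟨⟨h1, _, _⟩, h3⟩
      exact ⟨h1, h3, (addOrderOf_pos k).ne'⟩
    · rintro ⟨h1, h2, _⟩
      exact ⟨⟨h1, h2.trans (addOrderOf_dvd_modulus k), NeZero.ne D⟩, h2⟩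
  rw [hlen, boostedCoef]
  split_ifs
  · have h0 : (ρ : ℂ) ≠ 0 := by exact_mod_cast hρ.ne'
    push_cast
    rw [inv_pow]
    field_simp
  · simp

lemma sum_windowPoly_pow_le (m : ℕ) (hm : 1 ≤ m) (ρ : ℝ) (hρ : 0 < ρ)
    (hρm : ∀ u v w : ℝ, 0 ≤ u → 0 ≤ w → v ^ 2 ≤ u * w →
      (u + (2 * ρ * v + ρ ^ 2 * w)) ^ m ≤
        u ^ m + 2 * ρ * m * (u ^ (m - 1) * v) + u ^ (m - 1) * w + w ^ m)
    (B : Finset ℤ) (L Q w : ℕ) (hw : 1 ≤ w) (r : ℤ) (A M C : ℝ) (hA0 : 0 ≤ A) (hM0 : 0 ≤ M)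
    (hA : ∀ T : Finset ℕ, (∀ p ∈ T, p.Prime) → ∏ p ∈ T, p ≤ Q → ρ⁻¹ ^ T.card ≤ A)
    (hC : ∀ S : Finset ℕ, (∀ p ∈ S, p.Prime) → ∏ p ∈ S, p ≤ Q →
      ((A * (((Finset.Icc 1 Q).filter fun n => n.primeFactors ⊆ S).card : ℝ) ^ 2) ^ 2) ^ m
        ≤ C * Q) (hC0 : 0 ≤ C)
    (hM : ∀ v : ℕ, 1 ≤ v → ∀ s : ℤ, windowEnergy D B L Q v s ≤ M) :
    ∑ x : ZMod D, (‖windowPoly B L Q w r x‖ ^ 2) ^ m ≤ Q * (D * (C * Q * M ^ m)) := by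
  set R := D.primeFactors.toList with hR
  have hpr : ∀ p ∈ R, p.Prime := fun p hp =>
    Nat.prime_of_mem_primeFactors (Finset.mem_toList.1 hp)
  have hnd : R.Nodup := Finset.nodup_toList _
  have h1 := sum_noiseOp_pow_le m hm ρ hρm (primeParts D R) (κ := Unit)
    fun _ => ∑ k, boostedCoef B L Q w r ρ k • chi k
  simp only [Finset.univ_unique, Finset.sum_singleton, noiseOp_boosted B L Q w r ρ hρ, hR] at h1
  refine h1.trans ?_
  rw [← hR, primeParts, listSplits_map, List.map_map]
  refine list_sum_le_of_nodup _ (fun p => p.1.prod) _ Q _ (by positivity)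
    (nodup_listSplits_prod R hnd hpr) ?_ ?_
  · intro p hp
    refine Nat.one_le_iff_ne_zero.2 (List.prod_ne_zero fun h0 => ?_)
    exact Nat.not_prime_zero
      (hpr 0 ((perm_of_mem_listSplits R p hp).subset (List.mem_append_left _ h0)))
  · rintro ⟨S, W⟩ hp
    have hperm := perm_of_mem_listSplits R _ hp
    have hS : ∀ p ∈ S, p.Prime := fun p h => hpr p (hperm.subset (List.mem_append_left _ h))
    have hW : ∀ p ∈ W, p.Prime := fun p h => hpr p (hperm.subset (List.mem_append_right _ h))
    have hSnd : S.Nodup := (hperm.nodup_iff.2 hnd).of_append_left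
    have hprod : ∏ p ∈ S.toFinset, p = S.prod := by
      rw [List.prod_toFinset _ hSnd, List.map_id']
    simp only [Function.comp_apply]
    change ∑ x, (avgListOp (primeParts D W) (fun x => ‖diffOp (primeParts D S) _ x‖ ^ 2) x) ^ m ≤ _
    split_ifs with hQ
    · obtain ⟨d₁, d₂, hd, hcop, h3, h4⟩ := split_modulus S W hperm
      have h5 : ∀ x ∈ (Finset.univ : Finset (ZMod D)),
          (avgListOp (primeParts D W) (fun x => ‖diffOp (primeParts D S)
            (∑ k, boostedCoef B L Q w r ρ k • chi k) x‖ ^ 2) x) ^ m ≤ C * Q * M ^ m := by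
        intro x _
        have h6 := avgListOp_boosted_le B L Q w hw r ρ A M hρ hA0 hA hM S W hS hW d₁ d₂ hd hcop
          h3 h4 x
        have h7 : 0 ≤ avgListOp (primeParts D W) (fun x => ‖diffOp (primeParts D S)
            (∑ k, boostedCoef B L Q w r ρ k • chi k) x‖ ^ 2) x := by
          rw [avgListOp_normSq_diffOp S W hS hW d₁ d₂ hd hcop (fun p hp => (h3 p (hS p hp)).1 hp) h4]
          positivity
        calc _ ≤ _ := pow_le_pow_left₀ h7 h6 m
          _ ≤ _ := by
            rw [mul_pow]
            gcongr
            refine hC S.toFinset (fun p hp => hS p (List.mem_toFinset.1 hp)) ?_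
            rw [hprod]; exact hQ
      refine (Finset.sum_le_card_nsmul _ _ _ h5).trans ?_
      rw [Finset.card_univ, ZMod.card, nsmul_eq_mul]
    · have h6 : diffOp (primeParts D S) (∑ k, boostedCoef B L Q w r ρ k • chi k) = 0 := by
        rw [map_sum]
        refine Finset.sum_eq_zero fun k _ => ?_
        rw [map_smul, diffOp_chi S hS, smul_smul]
        split_ifs with h7
        · rw [boostedCoef, if_neg, zero_mul, zero_smul]
          intro hg
          apply hQ
          have h8 := hg.prod_primeFactors_le hw
          rw [← hprod]
          refine le_trans (Nat.le_of_dvd (Finset.prod_pos fun p hp =>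
            (Nat.prime_of_mem_primeFactors hp).pos) (Finset.prod_dvd_prod_of_subset _ _ _ ?_)) h8
          intro p hp
          rw [List.mem_toFinset] at hp
          exact Nat.mem_primeFactors.2 ⟨hS p hp, h7 p hp, (addOrderOf_pos k).ne'⟩
        · simp
      rw [h6]
      have h7 : (fun x : ZMod D => ‖(0 : ZMod D → ℂ) x‖ ^ 2) = 0 := by
        funext x; simp
      rw [h7, map_zero]
      simp [show m ≠ 0 by omega]

/-- Trigonometric polynomials with controlled frequencies and bounded coefficient sum. -/
def TrigClass (w q : ℕ) (a : ℝ) (f : ZMod D → ℂ) : Prop :=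
  ∃ (ι : Type) (_ : Fintype ι) (b : ι → ℂ) (k : ι → ZMod D),
    (∀ i, addOrderOf (k i) ≤ q ∧ (addOrderOf (k i)).Coprime w) ∧ ∑ i, ‖b i‖ ≤ a ∧
      ∀ x, f x = ∑ i, b i * chi (k i) x

lemma TrigClass.one (w : ℕ) : TrigClass w 1 1 (fun _ : ZMod D => (1 : ℂ)) :=
  ⟨Unit, inferInstance, fun _ => 1, fun _ => 0, by simp, by simp, by simp [chi_zero_apply]⟩

lemma TrigClass.conj {w q : ℕ} {a : ℝ} {f : ZMod D → ℂ} (hf : TrigClass w q a f) :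
    TrigClass w q a (fun x => (starRingEnd ℂ) (f x)) := by
  obtain ⟨ι, hι, b, k, h1, h2, h3⟩ := hf
  refine ⟨ι, hι, fun i => (starRingEnd ℂ) (b i), fun i => -k i, ?_, ?_, ?_⟩
  · intro i
    rw [addOrderOf_neg]
    exact h1 i
  · simpa using h2
  · intro x
    simp only [h3, map_sum, map_mul, conj_chi]

lemma TrigClass.mul {w q q' : ℕ} {a a' : ℝ} {f f' : ZMod D → ℂ} (hf : TrigClass w q a f)
    (hf' : TrigClass w q' a' f') : TrigClass w (q * q') (a * a') (fun x => f x * f' x) := by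
  obtain ⟨ι, hι, b, k, h1, h2, h3⟩ := hf
  obtain ⟨ι', hι', b', k', h1', h2', h3'⟩ := hf'
  refine ⟨ι × ι', inferInstance, fun i => b i.1 * b' i.2, fun i => k i.1 + k' i.2, ?_, ?_, ?_⟩
  · rintro ⟨i, j⟩
    have h4 : addOrderOf (k i + k' j) ∣ addOrderOf (k i) * addOrderOf (k' j) :=
      (AddCommute.all (k i) (k' j)).addOrderOf_add_dvd_mul_addOrderOf
    constructor
    · refine (Nat.le_of_dvd (Nat.mul_pos (addOrderOf_pos _) (addOrderOf_pos _)) h4).trans ?_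
      exact Nat.mul_le_mul (h1 i).1 (h1' j).1
    · exact Nat.Coprime.coprime_dvd_left h4 (Nat.Coprime.mul_left (h1 i).2 (h1' j).2)
  · simp only [norm_mul, Fintype.sum_prod_type]
    rw [← Finset.sum_mul_sum]
    have : 0 ≤ ∑ i, ‖b i‖ := by positivity
    gcongr
    exact this.trans h2
  · intro x
    simp only [h3, h3', Finset.sum_mul_sum, Fintype.sum_prod_type]
    refine Finset.sum_congr rfl fun i _ => Finset.sum_congr rfl fun j _ => ?_
    simp only [chi_add_apply]
    ring

lemma TrigClass.pow {w q : ℕ} {a : ℝ} {f : ZMod D → ℂ} (hf : TrigClass w q a f) (m : ℕ) :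
    TrigClass w (q ^ m) (a ^ m) (fun x => f x ^ m) := by
  induction m with
  | zero => simpa using TrigClass.one w
  | succ m ih => simpa only [pow_succ] using ih.mul hf

lemma norm_geom_sum_le (z : ℂ) (hz : ‖z‖ = 1) (hz1 : z ≠ 1) (q : ℕ) (hq : 1 ≤ q) (hzq : z ^ q = 1)
    (J : ℕ) : ‖∑ j ∈ Finset.range J, z ^ j‖ ≤ q := by
  induction J using Nat.strong_induction_on with
  | _ J ih =>
    rcases lt_or_ge J q with h | h
    · refine (norm_sum_le _ _).trans ?_
      simp only [norm_pow, hz, one_pow, Finset.sum_const, Finset.card_range, nsmul_eq_mul, mul_one]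
      exact_mod_cast h.le
    · obtain ⟨J, rfl⟩ := Nat.exists_eq_add_of_le h
      rw [Finset.sum_range_add]
      have h1 : ∑ j ∈ Finset.range q, z ^ j = 0 := by
        have := geom_sum_mul z q
        rw [hzq, sub_self] at this
        exact (mul_eq_zero.1 this).resolve_right (sub_ne_zero.2 hz1)
      simp only [pow_add, hzq, one_mul, h1, zero_add]
      exact ih J (by omega)

lemma int_window_filter_eq (y r : ℤ) (L w : ℕ) (hw : 1 ≤ w) :
    ∃ (t : ℤ) (J : ℕ), (J : ℝ) ≤ L / w + 1 ∧
      (Finset.Ico y (y + L)).filter (fun n => (w : ℤ) ∣ n - r) =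
        (Finset.range J).image fun j : ℕ => (t + j) * w + r := by
  have hw0 : (0 : ℤ) < w := by exact_mod_cast hw
  set t₀ := ⌈((y : ℚ) - r) / (w : ℤ)⌉ with ht₀
  set t₁ := ⌈(((y + L : ℤ) : ℚ) - r) / (w : ℤ)⌉ with ht₁
  refine ⟨t₀, (t₁ - t₀).toNat, ?_, ?_⟩
  · have h2 : ((t₁ : ℚ) - t₀) ≤ L / w + 1 := by
      have h3 := Int.ceil_lt_add_one ((((y + L : ℤ) : ℚ) - r) / (w : ℤ))
      have h4 := Int.le_ceil (((y : ℚ) - r) / (w : ℤ))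
      have h5 : (((y + L : ℤ) : ℚ) - r) / (w : ℤ) = ((y : ℚ) - r) / (w : ℤ) + L / w := by
        push_cast; ring
      rw [← ht₁] at h3; rw [← ht₀] at h4
      rw [h5] at h3
      linarith
    have h3 : ((t₁ - t₀).toNat : ℚ) ≤ L / w + 1 := by
      rcases le_total (t₁ - t₀) 0 with h | h
      · rw [Int.toNat_of_nonpos h]; positivity
      · have h4 : (((t₁ - t₀).toNat : ℤ) : ℚ) = t₁ - t₀ := by
          rw [Int.toNat_of_nonneg h]; push_cast; ring
        rw [Int.cast_natCast] at h4
        rw [h4]; exact h2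
    have h4 : ((((t₁ - t₀).toNat : ℚ)) : ℝ) ≤ ((L / w + 1 : ℚ) : ℝ) := by exact_mod_cast h3
    push_cast at h4
    exact h4
  · have hwq : (0 : ℚ) < ((w : ℤ) : ℚ) := by exact_mod_cast hw0
    have h1 : ∀ t : ℤ, y ≤ t * w + r ↔ t₀ ≤ t := by
      intro t
      rw [ht₀, Int.ceil_le, div_le_iff₀ hwq, sub_le_iff_le_add]
      exact_mod_cast Iff.rfl
    have h2 : ∀ t : ℤ, t * w + r < y + L ↔ t < t₁ := by
      intro t
      rw [ht₁, Int.lt_ceil, lt_div_iff₀ hwq, lt_sub_iff_add_lt]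
      exact_mod_cast Iff.rfl
    ext n
    simp only [Finset.mem_filter, Finset.mem_Ico, Finset.mem_image, Finset.mem_range]
    constructor
    · rintro ⟨⟨h4, h5⟩, t, ht⟩
      have hn : n = t * w + r := by linarith
      subst hn
      rw [h1] at h4
      rw [h2] at h5
      refine ⟨(t - t₀).toNat, by omega, ?_⟩
      rw [Int.toNat_of_nonneg (by omega)]
      ring
    · rintro ⟨j, hj, rfl⟩
      exact ⟨⟨(h1 _).2 (by omega), (h2 _).2 (by omega)⟩, t₀ + j, by ring⟩

lemma norm_sum_window_chi_le (t r : ℤ) (J w : ℕ) (k : ZMod D) (hk : k ≠ 0)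
    (hkw : (addOrderOf k).Coprime w) :
    ‖∑ j ∈ Finset.range J, chi k (((t + j) * w + r : ℤ) : ZMod D)‖ ≤ addOrderOf k := by
  set z := chi k (w : ZMod D) with hz
  have h1 : ∀ j : ℕ, chi k (((t + j) * w + r : ℤ) : ZMod D) =
      chi k ((t * w + r : ℤ) : ZMod D) * z ^ j := by
    intro j
    rw [hz, chi, chi, chi, ← AddChar.map_nsmul_eq_pow, ← AddChar.map_add_eq_mul]
    congr 1
    rw [nsmul_eq_mul]; push_cast; ring
  simp only [h1]
  rw [← Finset.mul_sum, norm_mul, norm_chi, one_mul]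
  refine norm_geom_sum_le z (norm_chi _ _) ?_ _ (addOrderOf_pos k) ?_ J
  · intro h
    rw [hz, chi_eq_one_iff, ← addOrderOf_dvd_iff] at h
    have h2 : addOrderOf k = 1 := Nat.Coprime.eq_one_of_dvd hkw h
    exact hk (AddMonoid.addOrderOf_eq_one_iff.1 h2)
  · rw [hz, chi, ← AddChar.map_nsmul_eq_pow]
    have h2 := (addOrderOf_dvd_iff k (addOrderOf k)).1 dvd_rfl
    have h3 : addOrderOf k • (k * (w : ZMod D)) = 0 := by
      rw [nsmul_eq_mul]
      linear_combination (w : ZMod D) * h2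
    rw [h3, AddChar.map_zero_eq_one]

lemma TrigClass.discrepancy {w q : ℕ} {a : ℝ} {f : ZMod D → ℂ} (hf : TrigClass w q a f)
    (t r : ℤ) (J : ℕ) :
    ‖∑ j ∈ Finset.range J, f (((t + j) * w + r : ℤ) : ZMod D) - (J / D : ℝ) * ∑ x, f x‖ ≤
      q * a := by
  obtain ⟨ι, hι, b, k, h1, h2, h3⟩ := hf
  have hD : (D : ℂ) ≠ 0 := by exact_mod_cast NeZero.ne D
  have h4 : ∑ j ∈ Finset.range J, f (((t + j) * w + r : ℤ) : ZMod D) - (J / D : ℝ) * ∑ x, f x =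
      ∑ i, b i * (∑ j ∈ Finset.range J, chi (k i) (((t + j) * w + r : ℤ) : ZMod D) -
        (J / D : ℝ) * ∑ x, chi (k i) x) := by
    simp only [h3, mul_sub, Finset.sum_sub_distrib, Finset.mul_sum]
    rw [Finset.sum_comm (γ := ι), Finset.sum_comm (γ := ι)]
    congr 1
    refine Finset.sum_congr rfl fun i _ => Finset.sum_congr rfl fun x _ => ?_
    ring
  rw [h4]
  calc _ ≤ ∑ i, ‖b i‖ * q := by
        refine (norm_sum_le _ _).trans (Finset.sum_le_sum fun i _ => ?_)
        rw [norm_mul]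
        gcongr
        rw [sum_chi]
        by_cases hk : k i = 0
        · simp only [hk, chi_zero_apply, if_true]
          simp [div_mul_cancel₀ _ hD]
        · rw [if_neg hk, mul_zero, sub_zero]
          exact (norm_sum_window_chi_le t r J w (k i) hk (h1 i).2).trans (by exact_mod_cast (h1 i).1)
    _ = q * ∑ i, ‖b i‖ := by rw [← Finset.sum_mul, mul_comm]
    _ ≤ q * a := by gcongr

lemma card_torsion (w : ℕ) (hw : w ∣ D) :
    (Finset.univ.filter (fun k : ZMod D => (w : ZMod D) * k = 0)).card = w := by
  have h := sum_chi_torsion (D := D) w hw 0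
  simp only [Int.cast_zero, dvd_zero, if_true] at h
  have h1 : ∀ k : ZMod D, chi k 0 = 1 := fun k => by simp [chi]
  simp only [h1, Finset.sum_const, nsmul_eq_mul, mul_one] at h
  exact_mod_cast h

lemma card_order_le (Q : ℕ) :
    (Finset.univ.filter (fun k : ZMod D => addOrderOf k ≤ Q)).card ≤ Q ^ 2 := by
  calc _ ≤ ((Finset.Icc 1 Q).biUnion fun q =>
        Finset.univ.filter (fun k : ZMod D => addOrderOf k = q)).card := by
        apply Finset.card_le_card
        intro k hk
        have hk := (Finset.mem_filter.1 hk).2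
        rw [Finset.mem_biUnion]
        exact ⟨addOrderOf k, Finset.mem_Icc.2 ⟨addOrderOf_pos k, hk⟩, by simp⟩
    _ ≤ (Finset.Icc 1 Q).card * Q := by
        refine Finset.card_biUnion_le_card_mul _ _ _ fun q hq => ?_
        by_cases hqD : q ∣ D
        · refine (Finset.card_le_card ?_).trans ((card_torsion q hqD).le.trans (Finset.mem_Icc.1 hq).2)
          intro k hk
          have hk := (Finset.mem_filter.1 hk).2
          rw [Finset.mem_filter, mul_comm, ← addOrderOf_dvd_iff, hk]
          exact ⟨Finset.mem_univ _, dvd_rfl⟩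
        · rw [Finset.filter_eq_empty_iff.2]
          · simp
          · intro k _ hk
            exact hqD (hk ▸ addOrderOf_dvd_modulus k)
    _ = Q ^ 2 := by simp [sq]

lemma norm_windowCoef_le (B : Finset ℤ) (L w : ℕ) (hL : 1 ≤ L) (hw : 1 ≤ w) (r : ℤ) (k : ZMod D)
    (σ : ℝ) (hB : ((B.filter fun n => (w : ℤ) ∣ n - r).card : ℝ) ≤ σ * L / w) :
    ‖windowCoef B L w r k‖ ≤ σ := by
  have hL0 : (0 : ℝ) < L := by exact_mod_cast hL
  have hw0 : (0 : ℝ) < w := by exact_mod_cast hw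
  rw [windowCoef, norm_mul, Complex.norm_real, Real.norm_of_nonneg (by positivity)]
  calc _ ≤ (w / L : ℝ) * (σ * L / w) := by
        gcongr
        refine (norm_sum_le _ _).trans ?_
        simpa only [norm_chi, Finset.sum_const, nsmul_eq_mul, mul_one] using hB
    _ = σ := by field_simp

lemma windowEnergy_pow_le (m : ℕ) (hm : 1 ≤ m) (B : Finset ℤ) (L Q w : ℕ) (hL : 1 ≤ L)
    (hw : 1 ≤ w) (r : ℤ) (σ : ℝ)
    (hB : ((B.filter fun n => (w : ℤ) ∣ n - r).card : ℝ) ≤ σ * L / w) :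
    windowEnergy D B L Q w r ^ (2 * m) ≤ σ ^ (2 * m - 1) * ((w / L : ℝ) *
      ∑ n ∈ B.filter (fun n => (w : ℤ) ∣ n - r),
        (‖windowPoly B L Q w r (n : ZMod D)‖ ^ 2) ^ m) := by
  have hL0 : (0 : ℝ) < L := by exact_mod_cast hL
  have hw0 : (0 : ℝ) < w := by exact_mod_cast hw
  set B' := B.filter (fun n => (w : ℤ) ∣ n - r) with hB'
  have h1 : ((windowEnergy D B L Q w r : ℝ) : ℂ) =
      (w / L : ℝ) * ∑ n ∈ B', windowPoly B L Q w r (n : ZMod D) := by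
    simp only [windowPoly]
    rw [Finset.sum_comm, Finset.mul_sum, windowEnergy]
    push_cast
    refine Finset.sum_congr rfl fun k _ => ?_
    rw [← Finset.mul_sum, ← Complex.mul_conj']
    have h2 : (starRingEnd ℂ) (windowCoef B L w r k) =
        (w / L : ℝ) * ∑ n ∈ B', chi k (n : ZMod D) := by
      rw [windowCoef, map_mul, Complex.conj_ofReal, map_sum]
      simp only [conj_chi, neg_neg, hB']
    rw [h2]; push_cast; ring
  have hE0 : 0 ≤ windowEnergy D B L Q w r := Finset.sum_nonneg fun _ _ => by positivity
  have h2 : windowEnergy D B L Q w r ≤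
      (w / L : ℝ) * ∑ n ∈ B', ‖windowPoly B L Q w r (n : ZMod D)‖ := by
    have h3 : windowEnergy D B L Q w r = ‖((windowEnergy D B L Q w r : ℝ) : ℂ)‖ := by
      rw [Complex.norm_real, Real.norm_of_nonneg hE0]
    rw [h3, h1, norm_mul, Complex.norm_real, Real.norm_of_nonneg (by positivity)]
    gcongr
    exact norm_sum_le _ _
  obtain ⟨j, hj⟩ : ∃ j, 2 * m = j + 1 := ⟨2 * m - 1, by omega⟩
  have h3 : (∑ n ∈ B', ‖windowPoly B L Q w r (n : ZMod D)‖) ^ (j + 1) ≤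
      (B'.card : ℝ) ^ j * ∑ n ∈ B', ‖windowPoly B L Q w r (n : ZMod D)‖ ^ (j + 1) :=
    pow_sum_le_card_mul_sum_pow (fun _ _ => norm_nonneg _) j
  have hj' : 2 * m - 1 = j := by omega
  rw [hj']
  simp only [← pow_mul]
  rw [hj]
  calc _ ≤ ((w / L : ℝ) * ∑ n ∈ B', ‖windowPoly B L Q w r (n : ZMod D)‖) ^ (j + 1) := by gcongr
    _ ≤ (w / L : ℝ) ^ (j + 1) * ((σ * L / w) ^ j *
        ∑ n ∈ B', ‖windowPoly B L Q w r (n : ZMod D)‖ ^ (j + 1)) := by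
        rw [mul_pow]
        refine mul_le_mul_of_nonneg_left (h3.trans ?_)
          (pow_nonneg (div_nonneg hw0.le hL0.le) _)
        exact mul_le_mul_of_nonneg_right (pow_le_pow_left₀ (Nat.cast_nonneg _) hB j)
          (Finset.sum_nonneg fun _ _ => by positivity)
    _ = _ := by
        have h5 : (w / L : ℝ) ^ (j + 1) * (σ * L / w) ^ j = σ ^ j * (w / L) := by
          rw [pow_succ, mul_right_comm, ← mul_pow]
          congr 2
          field_simp
        rw [← mul_assoc, h5, mul_assoc]

lemma trigClass_windowPoly (B : Finset ℤ) (L Q w : ℕ) (hL : 1 ≤ L)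
    (hw : 1 ≤ w) (r : ℤ) (σ : ℝ) (hσ : 0 ≤ σ)
    (hB : ((B.filter fun n => (w : ℤ) ∣ n - r).card : ℝ) ≤ σ * L / w) :
    TrigClass w Q (Q ^ 2 * σ) (windowPoly B L Q w r : ZMod D → ℂ) := by
  set S := Finset.univ.filter (fun k : ZMod D => GoodFreq Q w k) with hS
  refine ⟨S, inferInstance, fun k => windowCoef B L w r (k : ZMod D), fun k => k, ?_, ?_, ?_⟩
  · rintro ⟨k, hk⟩
    rw [hS, Finset.mem_filter] at hk
    exact ⟨(Nat.le_mul_of_pos_right _ hw).trans hk.2.1, hk.2.2⟩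
  · rw [Finset.sum_coe_sort S (fun k => ‖windowCoef B L w r k‖)]
    calc _ ≤ S.card • σ :=
          Finset.sum_le_card_nsmul _ _ _ fun k _ => norm_windowCoef_le B L w hL hw r k σ hB
      _ = S.card * σ := nsmul_eq_mul _ _
      _ ≤ Q ^ 2 * σ := by
        gcongr
        have : S.card ≤ Q ^ 2 := by
          refine (Finset.card_le_card ?_).trans (card_order_le (D := D) Q)
          intro k hk
          have hk := (Finset.mem_filter.1 hk).2
          exact Finset.mem_filter.2 ⟨Finset.mem_univ _, (Nat.le_mul_of_pos_right _ hw).trans hk.1⟩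
        exact_mod_cast this
  · intro x
    rw [windowPoly, ← Finset.sum_coe_sort]

lemma sum_window_windowPoly_le (m : ℕ) (B : Finset ℤ) (L Q w : ℕ) (hQ : 1 ≤ Q)
    (hL : Q ^ (6 * m + 1) ≤ L) (hw : 1 ≤ w) (hwQ : w ≤ Q) (y r : ℤ) (σ : ℝ) (hσ : 0 ≤ σ)
    (hB : ((B.filter fun n => (w : ℤ) ∣ n - r).card : ℝ) ≤ σ * L / w) (V : ℝ)
    (hV : ∑ x : ZMod D, (‖windowPoly B L Q w r x‖ ^ 2) ^ m ≤ D * V) :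
    (w / L : ℝ) * ∑ n ∈ (Finset.Ico y (y + L)).filter (fun n => (w : ℤ) ∣ n - r),
        (‖windowPoly B L Q w r (n : ZMod D)‖ ^ 2) ^ m ≤ 2 * V + σ ^ (2 * m) := by
  have hQL : Q ≤ L := (Nat.le_self_pow (by omega) Q).trans hL
  have hL1 : 1 ≤ L := hQ.trans hQL
  have hL0 : (0 : ℝ) < L := by exact_mod_cast hL1
  have hw0 : (0 : ℝ) < w := by exact_mod_cast hw
  have hD0 : (0 : ℝ) < D := by exact_mod_cast NeZero.pos D
  have hV0 : 0 ≤ V := by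
    have : 0 ≤ D * V := (Finset.sum_nonneg fun x _ => by positivity).trans hV
    exact nonneg_of_mul_nonneg_right this hD0
  obtain ⟨t, J, hJ, hP⟩ := int_window_filter_eq y r L w hw
  have hc := trigClass_windowPoly (D := D) B L Q w hL1 hw r σ hσ hB
  have h1 := ((hc.mul hc.conj).pow m).discrepancy t r J
  simp only [Complex.mul_conj'] at h1
  have h2 : ∑ n ∈ (Finset.Ico y (y + L)).filter (fun n => (w : ℤ) ∣ n - r),
        (‖windowPoly B L Q w r (n : ZMod D)‖ ^ 2) ^ m =
      ∑ j ∈ Finset.range J,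
        (‖windowPoly B L Q w r (((t + j) * w + r : ℤ) : ZMod D)‖ ^ 2) ^ m := by
    rw [hP, Finset.sum_image]
    intro i _ j _ hij
    have h3 : ((t + i) * (w : ℤ)) = (t + j) * w := by simpa using hij
    have h4 := mul_right_cancel₀ (by exact_mod_cast hw0.ne') h3
    simpa using h4
  rw [h2]
  set S := ∑ j ∈ Finset.range J,
        (‖windowPoly B L Q w r (((t + j) * w + r : ℤ) : ZMod D)‖ ^ 2) ^ m with hS
  set W := ∑ x : ZMod D, (‖windowPoly B L Q w r x‖ ^ 2) ^ m with hW
  have h3 : |S - J / D * W| ≤ ((Q * Q) ^ m : ℕ) * (Q ^ 2 * σ * (Q ^ 2 * σ)) ^ m := by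
    rw [← Real.norm_eq_abs, ← Complex.norm_real]
    refine le_trans (le_of_eq ?_) h1
    rw [hS, hW]
    push_cast
    rfl
  have h4 : S ≤ J / D * W + ((Q * Q) ^ m : ℕ) * (Q ^ 2 * σ * (Q ^ 2 * σ)) ^ m := by
    linarith [le_abs_self (S - J / D * W)]
  have h5 : (J : ℝ) / D * W ≤ J * V := by
    calc (J : ℝ) / D * W ≤ J / D * (D * V) := by gcongr
      _ = J * V := by field_simp
  have hwL : (w : ℝ) / L ≤ 1 := by
    rw [div_le_one hL0]; exact_mod_cast hwQ.trans hQL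
  have h6 : (w / L : ℝ) * J ≤ 2 := by
    calc (w / L : ℝ) * J ≤ w / L * (L / w + 1) := by gcongr
      _ = 1 + w / L := by field_simp
      _ ≤ 2 := by linarith
  have h7 : (w / L : ℝ) * (((Q * Q) ^ m : ℕ) * (Q ^ 2 * σ * (Q ^ 2 * σ)) ^ m) ≤ σ ^ (2 * m) := by
    calc _ = (w * Q ^ (6 * m) : ℕ) / L * σ ^ (2 * m) := by
          push_cast; ring
      _ ≤ 1 * σ ^ (2 * m) := by
          gcongr
          rw [div_le_one hL0]
          have : w * Q ^ (6 * m) ≤ L := by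
            refine le_trans ?_ hL
            rw [pow_succ, mul_comm]
            gcongr
          exact_mod_cast this
      _ = _ := one_mul _
  calc (w / L : ℝ) * S ≤ w / L * (J * V + ((Q * Q) ^ m : ℕ) * (Q ^ 2 * σ * (Q ^ 2 * σ)) ^ m) := by
        gcongr; linarith
    _ = (w / L * J) * V + w / L * (((Q * Q) ^ m : ℕ) * (Q ^ 2 * σ * (Q ^ 2 * σ)) ^ m) := by ring
    _ ≤ 2 * V + σ ^ (2 * m) := by gcongr

lemma exists_windowEnergy_max (B : Finset ℤ) (L Q : ℕ) (hQ : 1 ≤ Q) :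
    ∃ (w₀ : ℕ) (r₀ : ℤ), 1 ≤ w₀ ∧ w₀ ≤ Q ∧ ∀ v : ℕ, 1 ≤ v → ∀ s : ℤ,
      windowEnergy D B L Q v s ≤ windowEnergy D B L Q w₀ r₀ := by
  set I := (Finset.Icc 1 Q) ×ˢ (Finset.Ico (0 : ℤ) Q) with hI
  have hne : I.Nonempty := ⟨(1, 0), by simp [hI, hQ]; omega⟩
  obtain ⟨⟨w₀, r₀⟩, h0, hmax⟩ :=
    Finset.exists_max_image I (fun p => windowEnergy D B L Q p.1 p.2) hne
  simp only [hI, Finset.mem_product, Finset.mem_Icc, Finset.mem_Ico] at h0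
  refine ⟨w₀, r₀, h0.1.1, h0.1.2, fun v hv s => ?_⟩
  have hE0 : 0 ≤ windowEnergy D B L Q w₀ r₀ := Finset.sum_nonneg fun _ _ => by positivity
  by_cases hvQ : v ≤ Q
  · have hv0 : (0 : ℤ) < v := by exact_mod_cast hv
    have h1 : windowEnergy D B L Q v s = windowEnergy D B L Q v (s % v) := by
      have h2 : ∀ n : ℤ, (v : ℤ) ∣ n - s ↔ (v : ℤ) ∣ n - s % v := by
        intro n
        have h3 : n - s % v = (n - s) + v * (s / v) := by
          have := Int.emod_add_mul_ediv s v; linarith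
        rw [h3]
        exact (dvd_add_left (dvd_mul_right _ _)).symm
      simp only [windowEnergy, windowCoef, h2]
    rw [h1]
    have h2 := Int.emod_nonneg s hv0.ne'
    have h3 := Int.emod_lt_of_pos s hv0
    exact hmax (v, s % v) (by
      simp only [hI, Finset.mem_product, Finset.mem_Icc, Finset.mem_Ico]
      exact ⟨⟨hv, hvQ⟩, h2, by omega⟩)
  · refine le_trans (le_of_eq ?_) hE0
    rw [windowEnergy, Finset.filter_eq_empty_iff.2, Finset.sum_empty]
    intro k _ hk
    have := Nat.le_mul_of_pos_left v (addOrderOf_pos k)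
    have := hk.1
    omega

theorem exists_moment_bound (m : ℕ) (hm : 1 ≤ m) : ∃ C : ℝ, 1 ≤ C ∧ ∀ (D : ℕ) [NeZero D]
    (Q L : ℕ) (y : ℤ) (B : Finset ℤ) (σ : ℝ), 1 ≤ Q → Q ^ (6 * m + 1) ≤ L →
    B ⊆ Finset.Ico y (y + L) → 0 < σ → σ ≤ 4 →
    (∀ w : ℕ, 1 ≤ w → w ≤ Q → ∀ r : ℤ,
      ((B.filter fun n => (w : ℤ) ∣ n - r).card : ℝ) ≤ σ * L / w) →
    (∑ k ∈ Finset.univ.filter (fun k : ZMod D => addOrderOf k ≤ Q),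
      ‖∑ n ∈ B, chi k (n : ZMod D)‖ ^ 2) ^ m ≤ C * σ ^ (2 * m - 1) * Q ^ 2 * L ^ (2 * m) := by
  obtain ⟨ρ, hρ, hρ1, hρm⟩ := exists_noise_parameter m hm
  obtain ⟨C, hC, hloss⟩ := exists_loss_bound m hm ρ hρ hρ1
  refine ⟨2 * C + 4, by linarith, ?_⟩
  intro D _ Q L y B σ hQ hL hBy hσ hσ4 hB
  obtain ⟨A, hA0, hA, hAC⟩ := hloss Q hQ
  obtain ⟨w, r, hw, hwQ, hmax⟩ := exists_windowEnergy_max (D := D) B L Q hQ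
  set M := windowEnergy D B L Q w r with hM
  have hM0 : 0 ≤ M := Finset.sum_nonneg fun _ _ => by positivity
  have hQL : Q ≤ L := (Nat.le_self_pow (by omega) Q).trans hL
  have hL1 : 1 ≤ L := hQ.trans hQL
  have hL0 : (0 : ℝ) < L := by exact_mod_cast hL1
  have hQ1 : (1 : ℝ) ≤ Q := by exact_mod_cast hQ
  have h1 := sum_windowPoly_pow_le m hm ρ hρ hρm B L Q w hw r A M C hA0 hM0 hA hAC (by linarith)
    hmax
  have h2 := sum_window_windowPoly_le m B L Q w hQ hL hw hwQ y r σ hσ.le (hB w hw hwQ r)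
    (C * Q ^ 2 * M ^ m) (h1.trans (le_of_eq (by ring)))
  have h3 := windowEnergy_pow_le (D := D) m hm B L Q w hL1 hw r σ (hB w hw hwQ r)
  have h4 : M ^ (2 * m) ≤ σ ^ (2 * m - 1) * (2 * (C * Q ^ 2 * M ^ m) + σ ^ (2 * m)) := by
    refine h3.trans ?_
    gcongr
    refine le_trans ?_ h2
    gcongr
  have hσ2 : σ ^ (2 * m) = σ ^ (2 * m - 1) * σ := by
    rw [← pow_succ]; congr 1; omega
  have h5 : M ^ m ≤ (2 * C + 4) * σ ^ (2 * m - 1) * Q ^ 2 := by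
    have hQ2 : (1 : ℝ) ≤ Q ^ 2 := one_le_pow₀ hQ1
    have hp : 0 < σ ^ (2 * m - 1) := by positivity
    rcases le_or_gt M (σ ^ 2) with h | h
    · calc M ^ m ≤ (σ ^ 2) ^ m := by gcongr
        _ = σ ^ (2 * m - 1) * σ := by rw [← pow_mul, hσ2]
        _ ≤ σ ^ (2 * m - 1) * 4 := by gcongr
        _ ≤ (2 * C + 4) * σ ^ (2 * m - 1) * Q ^ 2 := by
          nlinarith [mul_le_mul_of_nonneg_left hQ2 hp.le,
            mul_nonneg hp.le (mul_nonneg (by linarith : 0 ≤ C) (by positivity : (0:ℝ) ≤ (Q:ℝ) ^ 2))]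
    · have hMm : 0 < M ^ m := pow_pos (lt_trans (by positivity) h) m
      have h6 : σ ^ (2 * m) ≤ M ^ m := by
        rw [pow_mul]; gcongr
      have h7 : M ^ m * M ^ m ≤ (σ ^ (2 * m - 1) * (2 * C * Q ^ 2 + 1)) * M ^ m := by
        calc M ^ m * M ^ m = M ^ (2 * m) := by ring
          _ ≤ σ ^ (2 * m - 1) * (2 * (C * Q ^ 2 * M ^ m) + M ^ m) := h4.trans (by gcongr)
          _ = _ := by ring
      have h8 := le_of_mul_le_mul_right h7 hMm
      refine h8.trans ?_
      nlinarith
  have h6 : ∑ k ∈ Finset.univ.filter (fun k : ZMod D => addOrderOf k ≤ Q),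
      ‖∑ n ∈ B, chi k (n : ZMod D)‖ ^ 2 = L ^ 2 * windowEnergy D B L Q 1 0 := by
    rw [windowEnergy, Finset.mul_sum]
    refine Finset.sum_congr ?_ fun k _ => ?_
    · ext k; simp [GoodFreq]
    · have h7 : ‖∑ n ∈ B, chi (-k) (n : ZMod D)‖ = ‖∑ n ∈ B, chi k (n : ZMod D)‖ := by
        rw [← RCLike.norm_conj, map_sum]
        simp only [conj_chi, neg_neg]
      have h8 : B.filter (fun n => ((1 : ℕ) : ℤ) ∣ n - 0) = B := by simp
      rw [windowCoef, norm_mul, h8, h7, Complex.norm_real, Real.norm_of_nonneg (by positivity)]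
      push_cast
      field_simp
  rw [h6, mul_pow]
  calc _ ≤ ((L : ℝ) ^ 2) ^ m * ((2 * C + 4) * σ ^ (2 * m - 1) * Q ^ 2) := by
        gcongr
        refine le_trans ?_ h5
        have := hmax 1 le_rfl 0
        have h0 : 0 ≤ windowEnergy D B L Q 1 0 := Finset.sum_nonneg fun _ _ => by positivity
        gcongr
    _ = _ := by rw [← pow_mul]; ring

end CyclicCharacters

lemma sum_expo_orthogonality (H : ℕ) (hH : 1 ≤ H) (t : ℤ) :
    ∑ ξ ∈ Finset.range H, expo (t * (ξ / H)) = if (H : ℤ) ∣ t then (H : ℂ) else 0 := by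
  have hH0 : (H : ℝ) ≠ 0 := by exact_mod_cast (by omega : H ≠ 0)
  have h1 : ∀ ξ : ℕ, expo (t * (ξ / H)) = expo (t / H) ^ ξ := by
    intro ξ
    rw [← expo_nat_mul]; congr 1; ring
  simp only [h1]
  split_ifs with h
  · obtain ⟨c, rfl⟩ := h
    have h2 : ((H * c : ℤ) : ℝ) / H = (c : ℤ) := by push_cast; field_simp
    simp only [h2, expo_int, one_pow, Finset.sum_const, Finset.card_range, nsmul_eq_mul, mul_one]
  · have h2 : expo (t / H) - 1 ≠ 0 := by
      intro h3
      have h4 := near_of_norm_expo_sub_one (t / H)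
      rw [h3, norm_zero, zero_div] at h4
      obtain ⟨a, ha⟩ := h4
      have h5 := sub_eq_zero.1 (abs_nonpos_iff.1 ha)
      rw [div_eq_iff hH0] at h5
      exact h ⟨a, by rw [mul_comm]; exact_mod_cast h5⟩
    have h3 := geom_sum_mul (expo (t / H)) H
    have h4 : expo (t / H) ^ H = 1 := by
      rw [← expo_nat_mul, mul_div_cancel₀ _ hH0, expo_int]
    rw [h4, sub_self] at h3
    exact (mul_eq_zero.1 h3).resolve_right h2

/-- The exponential sum of `f` on `[0, N)`. -/
noncomputable def fourierSum (N : ℕ) (f : ℤ → ℂ) (α : ℝ) : ℂ :=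
  ∑ x ∈ Finset.Ico (0 : ℤ) N, f x * expo (x * α)

lemma normSq_fourierSum (N : ℕ) (f : ℤ → ℂ) (α : ℝ) :
    ((‖fourierSum N f α‖ ^ 2 : ℝ) : ℂ) = ∑ x ∈ Finset.Ico (0 : ℤ) N, ∑ y ∈ Finset.Ico (0 : ℤ) N,
      f x * (starRingEnd ℂ) (f y) * expo ((x - y : ℤ) * α) := by
  rw [Complex.ofReal_pow, ← Complex.mul_conj', fourierSum, map_sum, Finset.sum_mul_sum]
  refine Finset.sum_congr rfl fun x _ => Finset.sum_congr rfl fun y _ => ?_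
  have h : ((x - y : ℤ) : ℝ) * α = x * α - y * α := by push_cast; ring
  rw [h, expo_sub, map_mul]
  ring

lemma sum_normSq_fourierSum_mul_expo (N H : ℕ) (hH : 1 ≤ H) (f : ℤ → ℂ) (t : ℤ) :
    ∑ ξ ∈ Finset.range H, ((‖fourierSum N f (ξ / H)‖ ^ 2 : ℝ) : ℂ) * expo (t * (ξ / H)) =
      H * ∑ x ∈ Finset.Ico (0 : ℤ) N, ∑ y ∈ Finset.Ico (0 : ℤ) N,
        if (H : ℤ) ∣ x + t - y then f x * (starRingEnd ℂ) (f y) else 0 := by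
  simp only [normSq_fourierSum, Finset.sum_mul, Finset.mul_sum]
  rw [Finset.sum_comm]
  refine Finset.sum_congr rfl fun x _ => ?_
  rw [Finset.sum_comm]
  refine Finset.sum_congr rfl fun y _ => ?_
  have h1 : ∀ ξ : ℕ, f x * (starRingEnd ℂ) (f y) * expo ((x - y : ℤ) * (ξ / H)) *
      expo (t * (ξ / H)) = f x * (starRingEnd ℂ) (f y) * expo ((x + t - y : ℤ) * (ξ / H)) := by
    intro ξ
    rw [mul_assoc, ← expo_add]
    congr 2
    push_cast; ring
  simp only [h1]
  rw [← Finset.mul_sum, sum_expo_orthogonality H hH]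
  split_ifs <;> ring

lemma sum_normSq_fourierSum (H : ℕ) (hH : 1 ≤ H) (f : ℤ → ℂ) :
    ∑ ξ ∈ Finset.range H, ‖fourierSum H f (ξ / H)‖ ^ 2 =
      H * ∑ x ∈ Finset.Ico (0 : ℤ) H, ‖f x‖ ^ 2 := by
  have h := sum_normSq_fourierSum_mul_expo H H hH f 0
  simp only [Int.cast_zero, zero_mul, expo_zero, mul_one, add_zero] at h
  have h2 : ∀ x ∈ Finset.Ico (0 : ℤ) H, (∑ y ∈ Finset.Ico (0 : ℤ) H,
      if (H : ℤ) ∣ x - y then f x * (starRingEnd ℂ) (f y) else 0) = ((‖f x‖ ^ 2 : ℝ) : ℂ) := by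
    intro x hx
    rw [Finset.sum_eq_single_of_mem x hx]
    · simp [Complex.mul_conj']
    · intro y hy hyx
      rw [if_neg]
      rintro ⟨c, hc⟩
      simp only [Finset.mem_Ico] at hx hy
      have hc1 : c < 1 := by
        by_contra! hcon
        nlinarith
      have hc2 : -1 < c := by
        by_contra! hcon
        nlinarith
      have hc0 : c = 0 := by omega
      subst hc0
      apply hyx; linarith
  rw [Finset.sum_congr rfl h2] at h
  exact_mod_cast h

lemma sum_normSq_fourierSum_mul_expo_eq (N : ℕ) (hN : 1 ≤ N) (f : ℤ → ℂ)
    (hf : ∀ x, x ∉ Finset.Ico (0 : ℤ) N → f x = 0) (t : ℤ) (ht : |t| ≤ N) :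
    ∑ ξ ∈ Finset.range (2 * N), ((‖fourierSum N f (ξ / (2 * N : ℕ))‖ ^ 2 : ℝ) : ℂ) *
        expo (t * (ξ / (2 * N : ℕ))) =
      (2 * N : ℕ) * ∑ x ∈ Finset.Ico (0 : ℤ) N, f x * (starRingEnd ℂ) (f (x + t)) := by
  rw [sum_normSq_fourierSum_mul_expo N (2 * N) (by omega)]
  congr 1
  refine Finset.sum_congr rfl fun x hx => ?_
  have h1 : ∀ y ∈ Finset.Ico (0 : ℤ) N, (((2 * N : ℕ) : ℤ) ∣ x + t - y ↔ y = x + t) := by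
    intro y hy
    simp only [Finset.mem_Ico] at hx hy
    have ht' := abs_le.1 ht
    constructor
    · rintro ⟨c, hc⟩
      push_cast at hc
      have hc1 : c < 1 := by
        by_contra! hcon
        nlinarith
      have hc2 : -1 < c := by
        by_contra! hcon
        nlinarith
      have hc0 : c = 0 := by omega
      subst hc0
      linarith
    · rintro rfl; simp
  rw [Finset.sum_congr rfl fun y hy => if_congr (h1 y hy) rfl rfl]
  rw [Finset.sum_ite_eq']
  split_ifs with h
  · rfl
  · rw [hf _ h]; simp

lemma fourierSum_mul_kernel (N L q : ℕ) (f : ℤ → ℂ)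
    (hf : ∀ x, x ∉ Finset.Ico (0 : ℤ) N → f x = 0) (c : ℕ → ℂ) (hqL : q * L ≤ N) (α : ℝ) :
    fourierSum N f α * ∑ j ∈ Finset.range L, c j * expo (q * j * α) =
      fourierSum (2 * N) (fun z => ∑ j ∈ Finset.range L, c j * f (z - q * j)) α := by
  rw [fourierSum, fourierSum, Finset.sum_mul_sum, Finset.sum_comm]
  simp only [Finset.sum_mul]
  rw [Finset.sum_comm (s := Finset.Ico (0 : ℤ) (2 * N : ℕ))]
  refine Finset.sum_congr rfl fun j hj => ?_
  have hj := Finset.mem_range.1 hj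
  have hqj : q * j ≤ N := (Nat.mul_le_mul_left q hj.le).trans hqL
  have hqj' : (q * j : ℤ) ≤ N := by exact_mod_cast hqj
  have hqj0 : (0 : ℤ) ≤ q * j := by positivity
  have h1 : ∀ z ∈ Finset.Ico (0 : ℤ) (2 * N : ℕ), z ∉ Finset.Ico (0 + (q * j : ℤ)) (N + q * j) →
      c j * f (z - q * j) * expo (z * α) = 0 := by
    intro z _ hz
    rw [hf, mul_zero, zero_mul]
    intro h
    apply hz
    simp only [Finset.mem_Ico] at h ⊢
    constructor <;> linarith [h.1, h.2]
  rw [← Finset.sum_subset (s₁ := Finset.Ico (0 + (q * j : ℤ)) (N + q * j)) _ h1,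
    ← Finset.image_add_right_Ico, Finset.sum_image (fun _ _ _ _ h => add_right_cancel h)]
  · refine Finset.sum_congr rfl fun x _ => ?_
    have h2 : ((x + q * j : ℤ) : ℝ) * α = x * α + q * j * α := by push_cast; ring
    rw [h2, expo_add, add_sub_cancel_right]
    ring
  · intro z hz
    simp only [Finset.mem_Ico] at hz ⊢
    push_cast
    constructor <;> linarith [hz.1, hz.2]

/-- The energy on a set of frequencies where a kernel is large is controlled by averages of the
kernel translates in physical space. -/
lemma sum_normSq_fourierSum_le_of_kernel (N L q : ℕ) (hN : 1 ≤ N) (hL : 1 ≤ L) (f : ℤ → ℂ)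
    (hf : ∀ x, x ∉ Finset.Ico (0 : ℤ) N → f x = 0) (c : ℕ → ℂ) (hqL : q * L ≤ N)
    (Ξ : Finset ℕ) (hΞ : Ξ ⊆ Finset.range (2 * N))
    (hc : ∀ ξ ∈ Ξ, (L : ℝ) / 2 ≤ ‖∑ j ∈ Finset.range L, c j * expo (q * j * (ξ / (2 * N : ℕ)))‖) :
    ∑ ξ ∈ Ξ, ‖fourierSum N f (ξ / (2 * N : ℕ))‖ ^ 2 ≤
      4 / L ^ 2 * ((2 * N : ℕ) * ∑ z ∈ Finset.Ico (0 : ℤ) (2 * N : ℕ),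
        ‖∑ j ∈ Finset.range L, c j * f (z - q * j)‖ ^ 2) := by
  have hL0 : (0 : ℝ) < L := by exact_mod_cast hL
  rw [← sum_normSq_fourierSum (2 * N) (by omega)
    (fun z => ∑ j ∈ Finset.range L, c j * f (z - q * j)), Finset.mul_sum]
  refine le_trans ?_ (Finset.sum_le_sum_of_subset_of_nonneg hΞ fun _ _ _ => by positivity)
  refine Finset.sum_le_sum fun ξ hξ => ?_
  rw [← fourierSum_mul_kernel N L q f hf c hqL, norm_mul, mul_pow]
  have h1 := hc ξ hξ
  calc _ = 4 / L ^ 2 * (‖fourierSum N f (ξ / (2 * N : ℕ))‖ ^ 2 * ((L : ℝ) / 2) ^ 2) := by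
        field_simp; ring
    _ ≤ _ := by gcongr

lemma norm_sum_expo_ge (L : ℕ) (α η : ℝ) (hα : Near α η) (hη : η * L ≤ 1 / 16) :
    (L : ℝ) / 2 ≤ ‖∑ j ∈ Finset.range L, expo (j * α)‖ := by
  obtain ⟨a, ha⟩ := hα
  have hL0 : (0 : ℝ) ≤ L := Nat.cast_nonneg _
  have h1 : ∀ j ∈ Finset.range L, ‖expo (j * α) - 1‖ ≤ 1 / 2 := by
    intro j hj
    have hjL : (j : ℝ) ≤ L := by exact_mod_cast (Finset.mem_range.1 hj).le
    have h2 : expo (j * α) = expo (j * (α - a)) := by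
      have : (j * α : ℝ) = j * (α - a) + ((j * a : ℤ) : ℝ) := by push_cast; ring
      rw [this, expo_add_int]
    rw [h2, ← expo_zero]
    refine (norm_expo_sub_expo_le _ _).trans ?_
    rw [sub_zero, abs_mul, Nat.abs_cast]
    have h3 : (j : ℝ) * |α - a| ≤ 1 / 16 := by
      calc (j : ℝ) * |α - a| ≤ L * η := by gcongr
        _ ≤ 1 / 16 := by linarith
    nlinarith [Real.pi_le_four, Real.pi_pos, mul_nonneg (Nat.cast_nonneg (α := ℝ) j) (abs_nonneg (α - a))]
  have h2 : ‖∑ j ∈ Finset.range L, (expo (j * α) - 1)‖ ≤ L / 2 := by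
    refine (norm_sum_le _ _).trans ((Finset.sum_le_sum h1).trans (le_of_eq ?_))
    simp; ring
  have h3 : ∑ j ∈ Finset.range L, expo (j * α) = (L : ℂ) + ∑ j ∈ Finset.range L, (expo (j * α) - 1) := by
    simp
  rw [h3]
  have h4 := norm_sub_le ((L : ℂ) + ∑ j ∈ Finset.range L, (expo (j * α) - 1)) (∑ j ∈ Finset.range L, (expo (j * α) - 1))
  rw [add_sub_cancel_right, Complex.norm_natCast] at h4
  linarith

section Balanced

open scoped Classical

/-- The balanced indicator function of a set on `[0, N)`. -/
noncomputable def balanced (A : Finset ℤ) (N : ℕ) (x : ℤ) : ℝ :=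
  (if x ∈ A then 1 else 0) - (A.card / N : ℝ) * (if x ∈ Finset.Ico (0 : ℤ) N then 1 else 0)

variable {A : Finset ℤ} {N : ℕ}

lemma balanced_eq_zero (hA : A ⊆ Finset.Ico (0 : ℤ) N) (x : ℤ)
    (hx : x ∉ Finset.Ico (0 : ℤ) N) : balanced A N x = 0 := by
  rw [balanced, if_neg fun h => hx (hA h), if_neg hx]; ring

lemma sum_balanced (hN : 1 ≤ N) (hA : A ⊆ Finset.Ico (0 : ℤ) N) :
    ∑ x ∈ Finset.Ico (0 : ℤ) N, balanced A N x = 0 := by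
  have hN0 : (N : ℝ) ≠ 0 := by exact_mod_cast (by omega : N ≠ 0)
  simp only [balanced, Finset.sum_sub_distrib, ← Finset.mul_sum, Finset.sum_ite_mem,
    Finset.inter_self, Finset.inter_eq_right.2 hA]
  simp [div_mul_cancel₀ _ hN0]

lemma sum_balanced_sq_le (hN : 1 ≤ N) (hA : A ⊆ Finset.Ico (0 : ℤ) N) :
    ∑ x ∈ Finset.Ico (0 : ℤ) N, balanced A N x ^ 2 ≤ A.card := by
  have hN0 : (N : ℝ) ≠ 0 := by exact_mod_cast (by omega : N ≠ 0)
  have h1 : ∀ x ∈ Finset.Ico (0 : ℤ) N, balanced A N x ^ 2 =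
      (if x ∈ A then (1 : ℝ) else 0) - (A.card / N : ℝ) ^ 2 - 2 * (A.card / N : ℝ) * balanced A N x := by
    intro x hx
    rw [balanced, if_pos hx]
    split_ifs <;> ring
  rw [Finset.sum_congr rfl h1, Finset.sum_sub_distrib, Finset.sum_sub_distrib, ← Finset.mul_sum,
    sum_balanced hN hA, Finset.sum_ite_mem, Finset.inter_eq_right.2 hA]
  simp
  positivity

lemma card_filter_shift_ge (hA : A ⊆ Finset.Ico (0 : ℤ) N) (t : ℤ) :
    (A.card : ℝ) - |(t : ℝ)| ≤ (A.filter fun x => x + t ∈ Finset.Ico (0 : ℤ) N).card := by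
  have h1 : (A.filter fun x => ¬ x + t ∈ Finset.Ico (0 : ℤ) N).card ≤ t.natAbs := by
    rcases le_total 0 t with ht | ht
    · calc _ ≤ (Finset.Ico ((N : ℤ) - t) N).card := by
            apply Finset.card_le_card
            intro x hx
            have h2 := Finset.mem_filter.1 hx
            have h3 := hA h2.1
            have h4 := h2.2
            simp only [Finset.mem_Ico] at h3 h4 ⊢
            omega
        _ ≤ _ := by rw [Int.card_Ico]; omega
    · calc _ ≤ (Finset.Ico 0 (-t)).card := by
            apply Finset.card_le_card
            intro x hx
            have h2 := Finset.mem_filter.1 hx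
            have h3 := hA h2.1
            have h4 := h2.2
            simp only [Finset.mem_Ico] at h3 h4 ⊢
            omega
        _ ≤ _ := by rw [Int.card_Ico]; omega
  have h2 := Finset.card_filter_add_card_filter_not (s := A) fun x => x + t ∈ Finset.Ico (0 : ℤ) N
  have h3 : (A.card : ℝ) = (A.filter fun x => x + t ∈ Finset.Ico (0 : ℤ) N).card +
      (A.filter fun x => ¬ x + t ∈ Finset.Ico (0 : ℤ) N).card := by exact_mod_cast h2.symm
  have h4 : ((A.filter fun x => ¬ x + t ∈ Finset.Ico (0 : ℤ) N).card : ℝ) ≤ |(t : ℝ)| := by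
    have : ((t.natAbs : ℤ) : ℝ) = |(t : ℝ)| := by push_cast [Int.natCast_natAbs]; rfl
    rw [← this]; exact_mod_cast h1
  linarith

lemma sum_balanced_correlation_le (hN : 1 ≤ N) (hA : A ⊆ Finset.Ico (0 : ℤ) N) (t : ℤ) :
    ∑ x ∈ Finset.Ico (0 : ℤ) N, balanced A N x * balanced A N (x + t) ≤
      (A.filter fun x => x + t ∈ A).card - (A.card / N : ℝ) ^ 2 * N +
        2 * (A.card / N : ℝ) * |(t : ℝ)| := by
  set δ : ℝ := A.card / N with hδ
  have hδ0 : 0 ≤ δ := by positivity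
  have hN0 : (N : ℝ) ≠ 0 := by exact_mod_cast (by omega : N ≠ 0)
  have hδN : δ * N = A.card := by rw [hδ]; field_simp
  set I := Finset.Ico (0 : ℤ) N with hI
  have h1 : ∀ x ∈ I, balanced A N x * balanced A N (x + t) =
      (if x ∈ A then if x + t ∈ A then (1 : ℝ) else 0 else 0) -
      δ * (if x ∈ A then if x + t ∈ I then (1 : ℝ) else 0 else 0) -
      δ * (if x + t ∈ A then (1 : ℝ) else 0) + δ ^ 2 * (if x + t ∈ I then (1 : ℝ) else 0) := by
    intro x hx
    rw [balanced, balanced, ← hδ, if_pos hx]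
    split_ifs <;> ring
  rw [Finset.sum_congr rfl h1, Finset.sum_add_distrib, Finset.sum_sub_distrib,
    Finset.sum_sub_distrib, ← Finset.mul_sum, ← Finset.mul_sum, ← Finset.mul_sum,
    Finset.sum_ite_mem, Finset.sum_ite_mem, Finset.inter_eq_right.2 hA, Finset.sum_boole,
    Finset.sum_boole, Finset.sum_boole, Finset.sum_boole]
  have h2 := card_filter_shift_ge hA t
  have h3 : (A.card : ℝ) - |(t : ℝ)| ≤ (I.filter fun x => x + t ∈ A).card := by
    have h4 := card_filter_shift_ge hA (-t)
    have h5 : (A.filter fun x => x + -t ∈ I).card ≤ (I.filter fun x => x + t ∈ A).card := by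
      refine Finset.card_le_card_of_injOn (fun x => x + -t) ?_ fun _ _ _ _ h => add_right_cancel h
      intro x hx
      have hx := Finset.mem_filter.1 (Finset.mem_coe.1 hx)
      refine Finset.mem_coe.2 (Finset.mem_filter.2 ⟨hx.2, ?_⟩)
      simpa using hx.1
    have h6 : ((A.filter fun x => x + -t ∈ I).card : ℝ) ≤ (I.filter fun x => x + t ∈ A).card := by
      exact_mod_cast h5
    push_cast at h4
    rw [abs_neg] at h4
    linarith
  have h4 : ((I.filter fun x => x + t ∈ I).card : ℝ) ≤ N := by
    have : (I.filter fun x => x + t ∈ I).card ≤ N :=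
      (Finset.card_filter_le _ _).trans (by simp [hI])
    exact_mod_cast this
  nlinarith [mul_le_mul_of_nonneg_left h2 hδ0, mul_le_mul_of_nonneg_left h3 hδ0,
    mul_le_mul_of_nonneg_left h4 (sq_nonneg δ)]

/-- Negative total correlation along the values of a polynomial without such differences. -/
lemma sum_sum_balanced_le (hN : 1 ≤ N) (hA : A ⊆ Finset.Ico (0 : ℤ) N) (g : Polynomial ℤ)
    (k : ℕ) (hg : g.natDegree ≤ k) (hg0 : g ≠ 0) (M : ℕ) (T : ℝ)
    (hT : ∀ n : ℕ, n < M → |((g.eval (n : ℤ) : ℤ) : ℝ)| ≤ T)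
    (hfree : ∀ x ∈ A, ∀ y ∈ A, x ≠ y → ∀ n : ℤ, x - y ≠ g.eval n) :
    ∑ n ∈ Finset.range M, ∑ x ∈ Finset.Ico (0 : ℤ) N,
      balanced A N x * balanced A N (x + g.eval (n : ℤ)) ≤
      k * A.card + M * (2 * (A.card / N : ℝ) * T - (A.card / N : ℝ) ^ 2 * N) := by
  have h1 : ∀ n ∈ Finset.range M, ∑ x ∈ Finset.Ico (0 : ℤ) N,
      balanced A N x * balanced A N (x + g.eval (n : ℤ)) ≤
      A.card * (if g.eval (n : ℤ) = 0 then (1 : ℝ) else 0) +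
        (2 * (A.card / N : ℝ) * T - (A.card / N : ℝ) ^ 2 * N) := by
    intro n hn
    refine (sum_balanced_correlation_le hN hA _).trans ?_
    have h2 := hT n (Finset.mem_range.1 hn)
    have h3 : ((A.filter fun x => x + g.eval (n : ℤ) ∈ A).card : ℝ) ≤
        A.card * (if g.eval (n : ℤ) = 0 then (1 : ℝ) else 0) := by
      split_ifs with h
      · rw [mul_one]; exact_mod_cast Finset.card_filter_le _ _
      · rw [Finset.filter_eq_empty_iff.2]
        · simp
        · intro x hx hxt
          exact hfree _ hxt x hx (by simpa using h) n (by ring)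
    have h4 : 2 * (A.card / N : ℝ) * |((g.eval (n : ℤ) : ℤ) : ℝ)| ≤ 2 * (A.card / N : ℝ) * T := by
      gcongr
    linarith
  refine (Finset.sum_le_sum h1).trans ?_
  rw [Finset.sum_add_distrib, ← Finset.mul_sum, Finset.sum_boole, Finset.sum_const,
    Finset.card_range, nsmul_eq_mul]
  gcongr ?_ + _
  rw [mul_comm]
  gcongr
  have h2 : ((Finset.range M).filter fun n : ℕ => g.eval (n : ℤ) = 0).card ≤ g.roots.toFinset.card := by
    refine Finset.card_le_card_of_injOn (fun n : ℕ => (n : ℤ)) ?_ fun _ _ _ _ h => by simpa using h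
    intro n hn
    have hn := (Finset.mem_filter.1 (Finset.mem_coe.1 hn)).2
    refine Finset.mem_coe.2 (Multiset.mem_toFinset.2 ?_)
    exact (Polynomial.mem_roots hg0).2 hn
  exact h2.trans ((Multiset.toFinset_card_le _).trans ((Polynomial.card_roots' g).trans hg))

lemma sum_sq_le_of_sum_eq_zero {ι : Type*} (s : Finset ι) (φ u : ι → ℝ) (B : ℝ)
    (h0 : ∑ i ∈ s, φ i = 0) (hu : ∀ i ∈ s, φ i ≤ u i) (hu0 : ∀ i ∈ s, 0 ≤ u i)
    (hB : ∀ i ∈ s, |φ i| ≤ B) (hB0 : 0 ≤ B) : ∑ i ∈ s, φ i ^ 2 ≤ 2 * B * ∑ i ∈ s, u i := by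
  have h1 : ∀ i ∈ s, φ i ^ 2 ≤ B * (2 * u i - φ i) := by
    intro i hi
    have h2 : |φ i| ≤ 2 * u i - φ i := by
      rcases abs_cases (φ i) with h | h
      · linarith [hu i hi]
      · linarith [hu0 i hi]
    calc φ i ^ 2 = |φ i| * |φ i| := by rw [← sq, sq_abs]
      _ ≤ B * (2 * u i - φ i) := mul_le_mul (hB i hi) h2 (abs_nonneg _) hB0
  refine (Finset.sum_le_sum h1).trans (le_of_eq ?_)
  rw [← Finset.mul_sum, Finset.sum_sub_distrib, h0, ← Finset.mul_sum]
  ring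

lemma sum_progression_balanced_sq_le (hN : 1 ≤ N) (hA : A ⊆ Finset.Ico (0 : ℤ) N) (q L : ℕ)
    (ε : ℝ) (hε0 : 0 ≤ ε) (hε1 : ε ≤ 1) (hqL : (q * L : ℝ) ≤ ε * N)
    (hinc : ∀ x₀ : ℤ, (((Finset.range L).filter fun j : ℕ => x₀ + q * j ∈ A).card : ℝ) ≤
      (1 + ε) * (A.card / N) * L) :
    ∑ z ∈ Finset.Ico (0 : ℤ) (2 * N : ℕ), (∑ j ∈ Finset.range L, balanced A N (z - q * j)) ^ 2 ≤
      16 * ε * (A.card / N : ℝ) ^ 2 * L ^ 2 * N := by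
  set δ : ℝ := A.card / N with hδ
  have hδ0 : 0 ≤ δ := by positivity
  have hN0 : (0 : ℝ) < N := by exact_mod_cast hN
  have hqLN : q * L ≤ N := by
    have : (q * L : ℝ) ≤ N := hqL.trans (by nlinarith)
    exact_mod_cast this
  set φ : ℤ → ℝ := fun z => ∑ j ∈ Finset.range L, balanced A N (z - q * j) with hφ
  have hcount : ∀ z : ℤ, ∑ j ∈ Finset.range L, (if z - q * j ∈ A then (1 : ℝ) else 0) ≤
      (1 + ε) * δ * L := by
    intro z
    refine le_trans (le_of_eq ?_) (hinc (z - q * (L - 1 : ℤ)))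
    rw [← Finset.sum_range_reflect, ← Finset.sum_boole]
    refine Finset.sum_congr rfl fun j hj => ?_
    have hj := Finset.mem_range.1 hj
    have : z - q * ((L - 1 - j : ℕ) : ℤ) = z - q * (L - 1 : ℤ) + q * j := by
      rw [Nat.cast_sub (by omega), Nat.cast_sub (by omega)]
      push_cast; ring
    rw [this]
  have hφeq : ∀ z, φ z = ∑ j ∈ Finset.range L, (if z - q * j ∈ A then (1 : ℝ) else 0) -
      δ * ∑ j ∈ Finset.range L, (if z - q * j ∈ Finset.Ico (0 : ℤ) N then (1 : ℝ) else 0) := by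
    intro z
    rw [hφ]
    simp only [balanced, Finset.sum_sub_distrib, ← Finset.mul_sum, hδ]
  have hI : ∀ z : ℤ, 0 ≤ ∑ j ∈ Finset.range L,
      (if z - q * j ∈ Finset.Ico (0 : ℤ) N then (1 : ℝ) else 0) := fun z =>
    Finset.sum_nonneg fun _ _ => by split_ifs <;> norm_num
  have hI' : ∀ z : ℤ, ∑ j ∈ Finset.range L,
      (if z - q * j ∈ Finset.Ico (0 : ℤ) N then (1 : ℝ) else 0) ≤ L := fun z => by
    rw [Finset.sum_boole]
    exact_mod_cast (Finset.card_filter_le _ _).trans (Finset.card_range L).le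
  have hAz : ∀ z : ℤ, 0 ≤ ∑ j ∈ Finset.range L, (if z - q * j ∈ A then (1 : ℝ) else 0) := fun z =>
    Finset.sum_nonneg fun _ _ => by split_ifs <;> norm_num
  set E : Finset ℤ := Finset.Ico 0 ((q * L : ℕ) : ℤ) ∪ Finset.Ico (N : ℤ) (N + (q * L : ℕ)) with hE
  have hsum0 : ∑ z ∈ Finset.Ico (0 : ℤ) (2 * N : ℕ), φ z = 0 := by
    have h1 := fourierSum_mul_kernel N L q (fun x => (balanced A N x : ℂ))
      (fun x hx => by rw [balanced_eq_zero hA x hx]; simp) (fun _ => 1) hqLN 0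
    simp only [fourierSum, mul_zero, expo_zero, mul_one, one_mul] at h1
    have h2 : (∑ x ∈ Finset.Ico (0 : ℤ) N, (balanced A N x : ℂ)) = 0 := by
      rw [← Complex.ofReal_sum, sum_balanced hN hA, Complex.ofReal_zero]
    rw [h2, zero_mul] at h1
    have h3 : ((∑ z ∈ Finset.Ico (0 : ℤ) (2 * N : ℕ), φ z : ℝ) : ℂ) = 0 := by
      rw [h1, hφ]; push_cast; rfl
    exact_mod_cast h3
  have hδL : 0 ≤ δ * L := by positivity
  have hεδL : 0 ≤ ε * (δ * L) := by positivity
  have hεδL' : ε * (δ * L) ≤ δ * L := mul_le_of_le_one_left hδL hε1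
  have hmain := sum_sq_le_of_sum_eq_zero (Finset.Ico (0 : ℤ) (2 * N : ℕ)) φ
    (fun z => ε * (δ * L) + δ * L * (if z ∈ E then 1 else 0)) (2 * (δ * L)) hsum0 ?_ ?_ ?_
    (by positivity)
  · refine hmain.trans ?_
    rw [Finset.sum_add_distrib, Finset.sum_const, nsmul_eq_mul, ← Finset.mul_sum, Finset.sum_boole]
    have h1 : ((Finset.Ico (0 : ℤ) (2 * N : ℕ)).card : ℝ) = 2 * N := by
      rw [Int.card_Ico, sub_zero, Int.toNat_natCast]; push_cast; ring
    have h2 : (((Finset.Ico (0 : ℤ) (2 * N : ℕ)).filter fun z => z ∈ E).card : ℝ) ≤ 2 * (q * L) := by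
      have : ((Finset.Ico (0 : ℤ) (2 * N : ℕ)).filter fun z => z ∈ E).card ≤ q * L + q * L := by
        calc _ ≤ E.card := Finset.card_le_card fun z hz => (Finset.mem_filter.1 hz).2
          _ ≤ _ := Finset.card_union_le _ _
          _ = _ := by
            rw [Int.card_Ico, Int.card_Ico, sub_zero, add_sub_cancel_left, Int.toNat_natCast]
      calc _ ≤ ((q * L + q * L : ℕ) : ℝ) := by exact_mod_cast this
        _ = _ := by push_cast; ring
    rw [h1]
    calc _ ≤ 2 * (2 * (δ * L)) * (2 * N * (ε * (δ * L)) + δ * L * (2 * (ε * N))) := by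
          gcongr
          exact h2.trans (by linarith)
      _ = _ := by ring
  · intro z hz
    by_cases hzE : z ∈ E
    · rw [if_pos hzE, hφeq]
      nlinarith [hcount z, mul_nonneg hδ0 (hI z)]
    · rw [if_neg hzE, mul_zero, add_zero]
      simp only [hE, Finset.mem_union, Finset.mem_Ico, not_or, not_and, not_lt] at hzE hz
      have hz1 := hzE.1 hz.1
      have hjq : ∀ j ∈ Finset.range L, (0 : ℤ) ≤ q * j ∧ (q * j : ℤ) ≤ (q * L : ℕ) := by
        intro j hj
        have := (Finset.mem_range.1 hj).le
        constructor
        · positivity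
        · push_cast; gcongr
      by_cases hzN : z < N
      · have h1 : ∑ j ∈ Finset.range L,
            (if z - q * j ∈ Finset.Ico (0 : ℤ) N then (1 : ℝ) else 0) = L := by
          rw [Finset.sum_congr rfl fun j hj => if_pos ?_]
          · simp
          · have := hjq j hj
            rw [Finset.mem_Ico]; omega
        rw [hφeq, h1]
        linarith [hcount z]
      · have hz2 := hzE.2 (not_lt.1 hzN)
        have h1 : φ z = 0 := by
          refine Finset.sum_eq_zero fun j hj => balanced_eq_zero hA _ ?_
          have := hjq j hj
          rw [Finset.mem_Ico]; omega
        rw [h1]; exact hεδL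
  · intro z _
    have : (0 : ℝ) ≤ if z ∈ E then 1 else 0 := by split_ifs <;> norm_num
    positivity
  · intro z _
    rw [hφeq, abs_le]
    constructor
    · nlinarith [hAz z, mul_le_mul_of_nonneg_left (hI' z) hδ0]
    · nlinarith [hcount z, mul_nonneg hδ0 (hI z)]

end Balanced

section MajorArcs

open scoped Classical

variable {A : Finset ℤ} {N : ℕ} {D : ℕ} [NeZero D]

lemma exists_window_class (y r : ℤ) (L w : ℕ) (hw : 1 ≤ w) :
    ∃ x₀ : ℤ, (Finset.Ico y (y + L)).filter (fun n => (w : ℤ) ∣ n - r) ⊆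
      (Finset.range (L / w + 1)).image fun j : ℕ => x₀ + w * j := by
  obtain ⟨t, J, hJ, hP⟩ := int_window_filter_eq y r L w hw
  have hw0 : (0 : ℝ) < w := by exact_mod_cast hw
  have hJ' : J ≤ L / w + 1 := by
    rcases Nat.eq_zero_or_pos J with h | h
    · rw [h]; exact Nat.zero_le _
    have h1 : J - 1 ≤ L / w := by
      rw [Nat.le_div_iff_mul_le hw]
      have h2 : ((J - 1 : ℕ) : ℝ) * w ≤ L := by
        rw [Nat.cast_sub h, ← le_div_iff₀ hw0]; push_cast; linarith
      exact_mod_cast h2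
    exact Nat.sub_le_iff_le_add.1 h1
  refine ⟨t * w + r, ?_⟩
  rw [hP]
  intro n hn
  obtain ⟨j, hj, rfl⟩ := Finset.mem_image.1 hn
  refine Finset.mem_image.2 ⟨j, Finset.range_subset_range.2 hJ' hj, by ring⟩

lemma card_class_filter_le (S : Finset ℤ) (y r : ℤ) (L w : ℕ) (hw : 1 ≤ w) (hwL : w ≤ L) (β : ℝ)
    (hβ : 0 ≤ β)
    (hS : ∀ x₀ : ℤ, (((Finset.range (L / w + 1)).filter fun j : ℕ => x₀ + w * j ∈ S).card : ℝ) ≤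
      β * (L / w + 1 : ℕ)) :
    (((S.filter fun n => n ∈ Finset.Ico y (y + L)).filter fun n => (w : ℤ) ∣ n - r).card : ℝ) ≤
      2 * β * L / w := by
  obtain ⟨x₀, hx₀⟩ := exists_window_class y r L w hw
  have hw0 : (0 : ℝ) < w := by exact_mod_cast hw
  have hwL' : (w : ℝ) ≤ L := by exact_mod_cast hwL
  have h1 : ((S.filter fun n => n ∈ Finset.Ico y (y + L)).filter fun n => (w : ℤ) ∣ n - r) ⊆
      ((Finset.range (L / w + 1)).filter fun j : ℕ => x₀ + w * j ∈ S).image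
        fun j : ℕ => x₀ + w * j := by
    intro n hn
    simp only [Finset.mem_filter] at hn
    obtain ⟨j, hj, hjn⟩ := Finset.mem_image.1 (hx₀ (Finset.mem_filter.2 ⟨hn.1.2, hn.2⟩))
    exact Finset.mem_image.2 ⟨j, Finset.mem_filter.2 ⟨hj, by rw [hjn]; exact hn.1.1⟩, hjn⟩
  have h2 := (Finset.card_le_card h1).trans Finset.card_image_le
  have h3 : ((L / w : ℕ) : ℝ) ≤ L / w := Nat.cast_div_le
  calc _ ≤ (((Finset.range (L / w + 1)).filter fun j : ℕ => x₀ + w * j ∈ S).card : ℝ) := by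
        exact_mod_cast h2
    _ ≤ β * (L / w + 1 : ℕ) := hS x₀
    _ ≤ β * (L / w + L / w) := by
        push_cast
        gcongr
        rwa [le_div_iff₀ hw0, one_mul]
    _ = _ := by ring

lemma chi_eq_expo (k : ZMod D) (n : ℤ) : chi k (n : ZMod D) = expo (n * (k.val / D)) := by
  have h1 : k * (n : ZMod D) = ((k.val * n : ℤ) : ZMod D) := by
    push_cast; rw [ZMod.natCast_zmod_val]
  rw [chi, h1, ZMod.stdAddChar_coe, expo]
  congr 1
  push_cast
  ring

/-- Rational approximations with denominators at most `Q` are approximations by frequencies of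
small order modulo any multiple of all such denominators. -/
lemma exists_zmod_approx (Q : ℕ) (hD : ∀ q : ℕ, 1 ≤ q → q ≤ Q → q ∣ D) (α η : ℝ)
    (h : ∃ q : ℕ, 1 ≤ q ∧ q ≤ Q ∧ Near (q * α) η) :
    ∃ k : ZMod D, addOrderOf k ≤ Q ∧ Near (α - k.val / D) η := by
  obtain ⟨q, hq, hqQ, a, ha⟩ := h
  obtain ⟨c, hc⟩ := hD q hq hqQ
  have hq0 : (0 : ℝ) < q := by exact_mod_cast hq
  have hq1 : (1 : ℝ) ≤ q := by exact_mod_cast hq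
  have hD0 : (0 : ℝ) < D := by exact_mod_cast NeZero.pos D
  have hc' : (D : ℝ) = q * c := by rw [hc]; push_cast; rfl
  have hc0 : (c : ℝ) ≠ 0 := by
    intro h0; rw [h0, mul_zero] at hc'; exact hD0.ne' hc'
  set k : ZMod D := ((a * c : ℤ) : ZMod D) with hk
  have h1 : (D : ℤ) ∣ a * c - k.val := by
    rw [← ZMod.intCast_zmod_eq_zero_iff_dvd]
    push_cast
    rw [ZMod.natCast_zmod_val, hk]
    push_cast; ring
  obtain ⟨e, he⟩ := h1
  refine ⟨k, ?_, e, ?_⟩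
  · refine (Nat.le_of_dvd hq ?_).trans hqQ
    rw [addOrderOf_dvd_iff, hk]
    have h2 : (q : ZMod D) * ((a * c : ℤ) : ZMod D) = ((a * D : ℤ) : ZMod D) := by
      rw [hc]; push_cast; ring
    have h3 : ((a * D : ℤ) : ZMod D) = 0 := by simp
    first
      | rw [h2, h3]
      | rw [mul_comm, h2, h3]
  · have he' : (a * c - k.val : ℝ) = D * e := by exact_mod_cast he
    have h2 : α - k.val / D - e = (q * α - a) / q := by
      have h3 : (k.val : ℝ) = a * c - D * e := by linarith
      rw [h3, hc']
      field_simp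
      ring
    rw [h2, abs_div, Nat.abs_cast, div_le_iff₀ hq0]
    have := (abs_nonneg _).trans ha
    nlinarith

lemma sum_window_balanced_chi (S : Finset ℤ) (y : ℤ) (L : ℕ) (k : ZMod D) :
    ∑ n ∈ Finset.Ico y (y + L), (if n ∈ S then (1 : ℂ) else 0) * chi k (n : ZMod D) =
      ∑ n ∈ S.filter (fun n => n ∈ Finset.Ico y (y + L)), chi k (n : ZMod D) := by
  simp only [ite_mul, one_mul, zero_mul]
  rw [Finset.sum_ite_mem]
  refine Finset.sum_congr ?_ fun _ _ => rfl
  ext n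
  simp only [Finset.mem_inter, Finset.mem_filter]
  tauto

/-- Mean-square bound for twisted window sums of a balanced function. -/
lemma sum_normSq_window_balanced_le {m : ℕ} (hm : 1 ≤ m) {C : ℝ} (hC1 : 1 ≤ C)
    (hC : ∀ (Q L : ℕ) (y : ℤ) (B : Finset ℤ) (σ : ℝ), 1 ≤ Q → Q ^ (6 * m + 1) ≤ L →
      B ⊆ Finset.Ico y (y + L) → 0 < σ → σ ≤ 4 →
      (∀ w : ℕ, 1 ≤ w → w ≤ Q → ∀ r : ℤ,
        ((B.filter fun n => (w : ℤ) ∣ n - r).card : ℝ) ≤ σ * L / w) →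
      (∑ k ∈ Finset.univ.filter (fun k : ZMod D => addOrderOf k ≤ Q),
        ‖∑ n ∈ B, chi k (n : ZMod D)‖ ^ 2) ^ m ≤ C * σ ^ (2 * m - 1) * Q ^ 2 * L ^ (2 * m))
    (hδ0 : (0 : ℝ) < A.card / N) (hδ1 : (A.card / N : ℝ) ≤ 1) (Q L : ℕ) (hQ : 1 ≤ Q)
    (hL : Q ^ (6 * m + 1) ≤ L)
    (hinc : ∀ w : ℕ, 1 ≤ w → w ≤ Q → ∀ x₀ : ℤ,
      (((Finset.range (L / w + 1)).filter fun j : ℕ => x₀ + w * j ∈ A).card : ℝ) ≤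
        2 * (A.card / N) * (L / w + 1 : ℕ))
    (ρ : ℝ) (hρ0 : 0 ≤ ρ) (hρ : C * 16 ^ m * Q ^ 2 ≤ (A.card / N) * ρ ^ m) (y : ℤ) :
    ∑ k ∈ Finset.univ.filter (fun k : ZMod D => addOrderOf k ≤ Q),
      ‖∑ n ∈ Finset.Ico y (y + L), (balanced A N n : ℂ) * chi k (n : ZMod D)‖ ^ 2 ≤
      4 * ρ * (A.card / N : ℝ) ^ 2 * L ^ 2 := by
  set δ : ℝ := A.card / N with hδ
  have hQL : Q ≤ L := (Nat.le_self_pow (by omega) Q).trans hL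
  have hm' : 2 * m - 1 + 1 = 2 * m := by omega
  have hQ2 : (0 : ℝ) ≤ Q ^ 2 := by positivity
  have hA := hC Q L y (A.filter fun n => n ∈ Finset.Ico y (y + L)) (4 * δ) hQ hL
    (fun n hn => (Finset.mem_filter.1 hn).2) (by positivity) (by linarith) (fun w hw hwQ r => by
      refine (card_class_filter_le A y r L w hw (hwQ.trans hQL) (2 * δ) (by positivity)
        (hinc w hw hwQ)).trans (le_of_eq (by ring)))
  have hI := hC Q L y ((Finset.Ico (0 : ℤ) N).filter fun n => n ∈ Finset.Ico y (y + L)) 2 hQ hL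
    (fun n hn => (Finset.mem_filter.1 hn).2) (by norm_num) (by norm_num) (fun w hw hwQ r => by
      refine (card_class_filter_le _ y r L w hw (hwQ.trans hQL) 1 (by norm_num) fun x₀ => ?_).trans
        (le_of_eq (by ring))
      rw [one_mul]
      exact_mod_cast (Finset.card_filter_le _ _).trans (Finset.card_range _).le)
  set K := Finset.univ.filter (fun k : ZMod D => addOrderOf k ≤ Q) with hK
  set EA := ∑ k ∈ K, ‖∑ n ∈ A.filter (fun n => n ∈ Finset.Ico y (y + L)), chi k (n : ZMod D)‖ ^ 2
    with hEA
  set EI := ∑ k ∈ K, ‖∑ n ∈ (Finset.Ico (0 : ℤ) N).filter (fun n => n ∈ Finset.Ico y (y + L)),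
    chi k (n : ZMod D)‖ ^ 2 with hEI
  have h16 : (4 : ℝ) ^ (2 * m) = 16 ^ m := by rw [pow_mul]; norm_num
  have h41 : (4 : ℝ) ^ (2 * m - 1) ≤ 16 ^ m := by
    rw [← h16]; exact pow_le_pow_right₀ (by norm_num) (by omega)
  have h21 : (2 : ℝ) ^ (2 * m - 1) ≤ 16 ^ m :=
    (pow_le_pow_left₀ (by norm_num) (by norm_num : (2 : ℝ) ≤ 4) _).trans h41
  have hEA1 : EA ≤ ρ * δ ^ 2 * L ^ 2 := by
    refine le_of_pow_le_pow_left₀ (by omega : m ≠ 0) (by positivity) (hA.trans ?_)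
    calc _ = (C * 4 ^ (2 * m - 1) * Q ^ 2) * (δ ^ (2 * m - 1) * L ^ (2 * m)) := by
          rw [mul_pow]; ring
      _ ≤ (C * 16 ^ m * Q ^ 2) * (δ ^ (2 * m - 1) * L ^ (2 * m)) := by gcongr
      _ ≤ (δ * ρ ^ m) * (δ ^ (2 * m - 1) * L ^ (2 * m)) := by gcongr
      _ = ρ ^ m * δ ^ (2 * m - 1 + 1) * L ^ (2 * m) := by ring
      _ = _ := by rw [hm']; ring
  have hEI1 : EI ≤ ρ * L ^ 2 := by
    refine le_of_pow_le_pow_left₀ (by omega : m ≠ 0) (by positivity) (hI.trans ?_)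
    calc _ ≤ (C * 16 ^ m * Q ^ 2) * L ^ (2 * m) := by gcongr
      _ ≤ (δ * ρ ^ m) * L ^ (2 * m) := by gcongr
      _ ≤ (1 * ρ ^ m) * L ^ (2 * m) := by gcongr
      _ = _ := by rw [mul_pow, ← pow_mul, one_mul]
  have h1 : ∀ k ∈ K, ‖∑ n ∈ Finset.Ico y (y + L), (balanced A N n : ℂ) * chi k (n : ZMod D)‖ ^ 2 ≤
      2 * ‖∑ n ∈ A.filter (fun n => n ∈ Finset.Ico y (y + L)), chi k (n : ZMod D)‖ ^ 2 +
      2 * δ ^ 2 * ‖∑ n ∈ (Finset.Ico (0 : ℤ) N).filter (fun n => n ∈ Finset.Ico y (y + L)),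
        chi k (n : ZMod D)‖ ^ 2 := by
    intro k _
    rw [← sum_window_balanced_chi, ← sum_window_balanced_chi]
    set a := ∑ n ∈ Finset.Ico y (y + L), (if n ∈ A then (1 : ℂ) else 0) * chi k (n : ZMod D)
    set b := ∑ n ∈ Finset.Ico y (y + L), (if n ∈ Finset.Ico (0 : ℤ) N then (1 : ℂ) else 0) *
      chi k (n : ZMod D)
    have h2 : ∑ n ∈ Finset.Ico y (y + L), (balanced A N n : ℂ) * chi k (n : ZMod D) =
        a - (δ : ℂ) * b := by
      simp only [a, b, Finset.mul_sum, ← Finset.sum_sub_distrib]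
      refine Finset.sum_congr rfl fun n _ => ?_
      rw [balanced, ← hδ]
      split_ifs <;> (push_cast; ring)
    rw [h2]
    have h3 : ‖a - (δ : ℂ) * b‖ ≤ ‖a‖ + δ * ‖b‖ := by
      refine (norm_sub_le _ _).trans (le_of_eq ?_)
      rw [norm_mul, Complex.norm_real, Real.norm_of_nonneg hδ0.le]
    calc _ ≤ (‖a‖ + δ * ‖b‖) ^ 2 := by gcongr
      _ ≤ _ := by nlinarith [sq_nonneg (‖a‖ - δ * ‖b‖)]
  refine (Finset.sum_le_sum h1).trans ?_
  rw [Finset.sum_add_distrib, ← Finset.mul_sum, ← Finset.mul_sum]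
  calc _ ≤ 2 * (ρ * δ ^ 2 * L ^ 2) + 2 * δ ^ 2 * (ρ * L ^ 2) := by gcongr
    _ = _ := by ring

lemma sum_twisted_window_eq (f : ℤ → ℂ) (L : ℕ) (k : ZMod D) (z : ℤ) :
    ‖∑ j ∈ Finset.range L, expo (-(j * (k.val / D : ℝ))) * f (z - (1 : ℕ) * j)‖ =
      ‖∑ n ∈ Finset.Ico (z - L + 1) (z - L + 1 + L), f n * chi k (n : ZMod D)‖ := by
  have h1 : ∑ n ∈ Finset.Ico (z - L + 1) (z - L + 1 + L), f n * chi k (n : ZMod D) =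
      ∑ j ∈ Finset.range L, f (z - (1 : ℕ) * j) * chi k ((z - (1 : ℕ) * j : ℤ) : ZMod D) := by
    symm
    refine Finset.sum_nbij (fun j : ℕ => z - (1 : ℕ) * j) ?_ ?_ ?_ fun _ _ => rfl
    · intro j hj
      have := Finset.mem_range.1 hj
      rw [Finset.mem_Ico]; push_cast; omega
    · intro i _ j _ hij
      simpa using hij
    · intro n hn
      have hn := Finset.mem_Ico.1 (Finset.mem_coe.1 hn)
      refine ⟨(z - n).toNat, Finset.mem_coe.2 (Finset.mem_range.2 (by omega)), ?_⟩
      simp only []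
      rw [Int.toNat_of_nonneg (by omega)]; push_cast; ring
  have h2 : ∑ j ∈ Finset.range L, f (z - (1 : ℕ) * j) * chi k ((z - (1 : ℕ) * j : ℤ) : ZMod D) =
      expo (z * (k.val / D)) *
        ∑ j ∈ Finset.range L, expo (-(j * (k.val / D : ℝ))) * f (z - (1 : ℕ) * j) := by
    rw [Finset.mul_sum]
    refine Finset.sum_congr rfl fun j _ => ?_
    rw [chi_eq_expo]
    have h3 : ((z - (1 : ℕ) * j : ℤ) : ℝ) * (k.val / D) =
        z * (k.val / D) + -(j * (k.val / D : ℝ)) := by push_cast; ring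
    rw [h3, expo_add]; ring
  rw [h1, h2, norm_mul, norm_expo, one_mul]

/-- Energy of the balanced function on all major arcs with denominator at most `Q`. -/
lemma sum_normSq_major_arcs_le {m : ℕ} (hm : 1 ≤ m) {C : ℝ} (hC1 : 1 ≤ C) (hN : 1 ≤ N)
    (hA : A ⊆ Finset.Ico (0 : ℤ) N) (Q L : ℕ) (hD : ∀ q : ℕ, 1 ≤ q → q ≤ Q → q ∣ D)
    (hC : ∀ (Q L : ℕ) (y : ℤ) (B : Finset ℤ) (σ : ℝ), 1 ≤ Q → Q ^ (6 * m + 1) ≤ L →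
      B ⊆ Finset.Ico y (y + L) → 0 < σ → σ ≤ 4 →
      (∀ w : ℕ, 1 ≤ w → w ≤ Q → ∀ r : ℤ,
        ((B.filter fun n => (w : ℤ) ∣ n - r).card : ℝ) ≤ σ * L / w) →
      (∑ k ∈ Finset.univ.filter (fun k : ZMod D => addOrderOf k ≤ Q),
        ‖∑ n ∈ B, chi k (n : ZMod D)‖ ^ 2) ^ m ≤ C * σ ^ (2 * m - 1) * Q ^ 2 * L ^ (2 * m))
    (hδ0 : (0 : ℝ) < A.card / N) (hδ1 : (A.card / N : ℝ) ≤ 1) (hQ : 1 ≤ Q)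
    (hL : Q ^ (6 * m + 1) ≤ L) (hLN : L ≤ N)
    (hinc : ∀ w : ℕ, 1 ≤ w → w ≤ Q → ∀ x₀ : ℤ,
      (((Finset.range (L / w + 1)).filter fun j : ℕ => x₀ + w * j ∈ A).card : ℝ) ≤
        2 * (A.card / N) * (L / w + 1 : ℕ))
    (ρ : ℝ) (hρ0 : 0 ≤ ρ) (hρ : C * 16 ^ m * Q ^ 2 ≤ (A.card / N) * ρ ^ m) (η : ℝ)
    (hη : η * L ≤ 1 / 16) (Ξ : Finset ℕ) (hΞ : Ξ ⊆ Finset.range (2 * N))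
    (hnear : ∀ ξ ∈ Ξ, ∃ q : ℕ, 1 ≤ q ∧ q ≤ Q ∧ Near (q * (ξ / (2 * N : ℕ) : ℝ)) η) :
    ∑ ξ ∈ Ξ, ‖fourierSum N (fun x => (balanced A N x : ℂ)) (ξ / (2 * N : ℕ))‖ ^ 2 ≤
      64 * ρ * (A.card / N : ℝ) ^ 2 * N ^ 2 := by
  have hL1 : 1 ≤ L := hQ.trans ((Nat.le_self_pow (by omega) Q).trans hL)
  have hL0 : (0 : ℝ) < L := by exact_mod_cast hL1
  have h1 : ∀ ξ : ℕ, ∃ k : ZMod D, ξ ∈ Ξ →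
      addOrderOf k ≤ Q ∧ Near (ξ / (2 * N : ℕ) - k.val / D : ℝ) η := by
    intro ξ
    by_cases hξ : ξ ∈ Ξ
    · obtain ⟨k, hk⟩ := exists_zmod_approx (D := D) Q hD _ η (hnear ξ hξ)
      exact ⟨k, fun _ => hk⟩
    · exact ⟨0, fun h => absurd h hξ⟩
  choose κ hκ using h1
  set K := Finset.univ.filter (fun k : ZMod D => addOrderOf k ≤ Q) with hK
  rw [← Finset.sum_fiberwise_of_maps_to (s := Ξ) (t := K) (g := κ)
    fun ξ hξ => Finset.mem_filter.2 ⟨Finset.mem_univ _, (hκ ξ hξ).1⟩]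
  have h2 : ∀ k ∈ K, ∑ ξ ∈ Ξ.filter (fun ξ => κ ξ = k),
      ‖fourierSum N (fun x => (balanced A N x : ℂ)) (ξ / (2 * N : ℕ))‖ ^ 2 ≤
      4 / L ^ 2 * ((2 * N : ℕ) * ∑ z ∈ Finset.Ico (0 : ℤ) (2 * N : ℕ),
        ‖∑ n ∈ Finset.Ico (z - L + 1) (z - L + 1 + L),
          (balanced A N n : ℂ) * chi k (n : ZMod D)‖ ^ 2) := by
    intro k _
    have h3 := sum_normSq_fourierSum_le_of_kernel N L 1 hN hL1 (fun x => (balanced A N x : ℂ))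
      (fun x hx => by simp [balanced_eq_zero hA x hx])
      (fun j => expo (-(j * (k.val / D : ℝ)))) (by omega) (Ξ.filter (fun ξ => κ ξ = k))
      ((Finset.filter_subset _ _).trans hΞ) (fun ξ hξ => by
        have hξ := Finset.mem_filter.1 hξ
        have h4 := (hκ ξ hξ.1).2
        rw [hξ.2] at h4
        refine (norm_sum_expo_ge L _ η h4 hη).trans (le_of_eq ?_)
        congr 1
        refine Finset.sum_congr rfl fun j _ => ?_
        rw [← expo_add]
        congr 1
        push_cast; ring)
    refine h3.trans (le_of_eq ?_)
    congr 2
    refine Finset.sum_congr rfl fun z _ => ?_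
    rw [sum_twisted_window_eq (fun x => (balanced A N x : ℂ))]
  refine (Finset.sum_le_sum h2).trans ?_
  rw [← Finset.mul_sum, ← Finset.mul_sum, Finset.sum_comm]
  calc _ ≤ 4 / (L : ℝ) ^ 2 * ((2 * N : ℕ) * ∑ z ∈ Finset.Ico (0 : ℤ) (2 * N : ℕ),
        4 * ρ * (A.card / N : ℝ) ^ 2 * L ^ 2) := by
        gcongr with z hz
        exact sum_normSq_window_balanced_le hm hC1 hC hδ0 hδ1 Q L hQ hL hinc ρ hρ0 hρ _
    _ = _ := by
        rw [Finset.sum_const, Int.card_Ico, sub_zero, Int.toNat_natCast, nsmul_eq_mul]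
        push_cast
        field_simp
        ring

end MajorArcs

section EnergyComparison

open scoped Classical

variable {A : Finset ℤ} {N : ℕ}

/-- The exponential sum of the first `M` values of the polynomial `g`. -/
noncomputable def polySum (g : ℤ[X]) (M : ℕ) (α : ℝ) : ℂ :=
  ∑ n ∈ Finset.range M, expo (α * (g.eval (n : ℤ) : ℤ))

lemma norm_polySum_le (g : ℤ[X]) (M : ℕ) (α : ℝ) : ‖polySum g M α‖ ≤ M := by
  refine (norm_sum_le _ _).trans ?_
  simp [norm_expo]

/-- Energy of the balanced function at the frequency `ξ / (2N)`. -/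
noncomputable def energy (A : Finset ℤ) (N ξ : ℕ) : ℝ :=
  ‖fourierSum N (fun x => (balanced A N x : ℂ)) (ξ / (2 * N : ℕ))‖ ^ 2

lemma energy_nonneg (A : Finset ℤ) (N ξ : ℕ) : 0 ≤ energy A N ξ := by
  unfold energy; positivity

lemma sum_energy_le (hN : 1 ≤ N) (hA : A ⊆ Finset.Ico (0 : ℤ) N) :
    ∑ ξ ∈ Finset.range (2 * N), energy A N ξ ≤ 2 * N * A.card := by
  have h1 := sum_normSq_fourierSum_mul_expo_eq N hN (fun x => (balanced A N x : ℂ))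
    (fun x hx => by simp [balanced_eq_zero hA x hx]) 0 (by simp)
  have h2 : ∑ ξ ∈ Finset.range (2 * N), energy A N ξ =
      2 * N * ∑ x ∈ Finset.Ico (0 : ℤ) N, balanced A N x ^ 2 := by
    have h3 : ((∑ ξ ∈ Finset.range (2 * N), energy A N ξ : ℝ) : ℂ) =
        ((2 * N * ∑ x ∈ Finset.Ico (0 : ℤ) N, balanced A N x ^ 2 : ℝ) : ℂ) := by
      simp only [Int.cast_zero, zero_mul, expo_zero, mul_one, add_zero, Complex.conj_ofReal] at h1
      push_cast at h1 ⊢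
      simp only [energy]
      push_cast
      rw [h1]
      simp only [sq]
    exact_mod_cast h3
  rw [h2]
  gcongr
  exact sum_balanced_sq_le hN hA

lemma neg_correlation_le_sum_energy (hN : 1 ≤ N) (hA : A ⊆ Finset.Ico (0 : ℤ) N) (g : ℤ[X])
    (M : ℕ) (hT : ∀ n : ℕ, n < M → |g.eval (n : ℤ)| ≤ N) :
    -(2 * N * ∑ n ∈ Finset.range M, ∑ x ∈ Finset.Ico (0 : ℤ) N,
      balanced A N x * balanced A N (x + g.eval (n : ℤ))) ≤
      ∑ ξ ∈ Finset.range (2 * N), energy A N ξ * ‖polySum g M (ξ / (2 * N : ℕ))‖ := by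
  have h1 : ∑ ξ ∈ Finset.range (2 * N), (energy A N ξ : ℂ) * polySum g M (ξ / (2 * N : ℕ)) =
      ((2 * N * ∑ n ∈ Finset.range M, ∑ x ∈ Finset.Ico (0 : ℤ) N,
      balanced A N x * balanced A N (x + g.eval (n : ℤ)) : ℝ) : ℂ) := by
    simp only [polySum, Finset.mul_sum]
    rw [Finset.sum_comm]
    push_cast
    refine Finset.sum_congr rfl fun n hn => ?_
    have h2 := sum_normSq_fourierSum_mul_expo_eq N hN (fun x => (balanced A N x : ℂ))
      (fun x hx => by simp [balanced_eq_zero hA x hx]) (g.eval (n : ℤ))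
      (hT n (Finset.mem_range.1 hn))
    simp only [Complex.conj_ofReal] at h2
    rw [← Finset.mul_sum]
    push_cast at h2
    rw [← h2]
    refine Finset.sum_congr rfl fun ξ _ => ?_
    rw [energy, mul_comm (((ξ : ℝ) / _))]
    push_cast
    rfl
  refine (neg_le_abs _).trans ?_
  rw [← Real.norm_eq_abs, ← Complex.norm_real, ← h1]
  refine (norm_sum_le _ _).trans (le_of_eq ?_)
  refine Finset.sum_congr rfl fun ξ _ => ?_
  rw [norm_mul, Complex.norm_real, Real.norm_of_nonneg (energy_nonneg A N ξ)]

lemma sum_mul_le_of_level_sets {ι : Type*} (s : Finset ι) (a b : ι → ℝ) (M X₀ X₁ e₀ e₁ e₂ : ℝ)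
    (ha : ∀ i ∈ s, 0 ≤ a i) (hb : ∀ i ∈ s, b i ≤ M) (hM : 0 ≤ M)
    (hX₀ : 0 < X₀) (hX₁ : 0 < X₁) (h₀ : ∑ i ∈ s.filter (fun i => M ≤ X₀ * b i), a i ≤ e₀)
    (h₁ : ∑ i ∈ s.filter (fun i => M ≤ X₁ * b i), a i ≤ e₁) (h₂ : ∑ i ∈ s, a i ≤ e₂) :
    ∑ i ∈ s, a i * b i ≤ M * e₀ + M / X₀ * e₁ + M / X₁ * e₂ := by
  have h : ∀ i ∈ s, a i * b i ≤ M * (if M ≤ X₀ * b i then a i else 0) +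
      M / X₀ * (if M ≤ X₁ * b i then a i else 0) + M / X₁ * a i := by
    intro i hi
    have hai := ha i hi
    have p0 : 0 ≤ M / X₀ * a i := by positivity
    have p1 : 0 ≤ M / X₁ * a i := by positivity
    have p2 : 0 ≤ M * a i := by positivity
    by_cases c0 : M ≤ X₀ * b i
    · have := mul_le_mul_of_nonneg_left (hb i hi) hai
      rw [if_pos c0]
      split_ifs <;> nlinarith
    rw [if_neg c0]
    have c0' : b i ≤ M / X₀ := by rw [le_div_iff₀ hX₀]; linarith
    by_cases c1 : M ≤ X₁ * b i
    · have := mul_le_mul_of_nonneg_left c0' hai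
      rw [if_pos c1]; nlinarith
    · have c1' : b i ≤ M / X₁ := by rw [le_div_iff₀ hX₁]; linarith
      have := mul_le_mul_of_nonneg_left c1' hai
      rw [if_neg c1]; nlinarith
  refine (Finset.sum_le_sum h).trans ?_
  rw [Finset.sum_add_distrib, Finset.sum_add_distrib, ← Finset.mul_sum, ← Finset.mul_sum,
    ← Finset.mul_sum, ← Finset.sum_filter, ← Finset.sum_filter]
  gcongr

/-- Energy on narrow major arcs, in the absence of a density increment on progressions. -/
lemma sum_energy_narrow_arcs_le (hN : 1 ≤ N) (hA : A ⊆ Finset.Ico (0 : ℤ) N) (Q L : ℕ) (hL : 1 ≤ L)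
    (ε : ℝ) (hε0 : 0 ≤ ε) (hε1 : ε ≤ 1) (hQL : (Q * L : ℝ) ≤ ε * N)
    (hinc : ∀ q : ℕ, 1 ≤ q → q ≤ Q → ∀ x₀ : ℤ,
      (((Finset.range L).filter fun j : ℕ => x₀ + q * j ∈ A).card : ℝ) ≤
        (1 + ε) * (A.card / N) * L)
    (η : ℝ) (hη : η * L ≤ 1 / 16) (Ξ : Finset ℕ) (hΞ : Ξ ⊆ Finset.range (2 * N))
    (hnear : ∀ ξ ∈ Ξ, ∃ q : ℕ, 1 ≤ q ∧ q ≤ Q ∧ Near (q * (ξ / (2 * N : ℕ) : ℝ)) η) :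
    ∑ ξ ∈ Ξ, energy A N ξ ≤ 128 * (Q * ε) * ((A.card / N : ℝ) ^ 2 * N ^ 2) := by
  have hL0 : (0 : ℝ) < L := by exact_mod_cast hL
  have h1 : ∀ ξ : ℕ, ∃ q : ℕ, ξ ∈ Ξ → 1 ≤ q ∧ q ≤ Q ∧ Near (q * (ξ / (2 * N : ℕ) : ℝ)) η := by
    intro ξ
    by_cases hξ : ξ ∈ Ξ
    · obtain ⟨q, hq⟩ := hnear ξ hξ
      exact ⟨q, fun _ => hq⟩
    · exact ⟨0, fun h => absurd h hξ⟩
  choose κ hκ using h1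
  rw [← Finset.sum_fiberwise_of_maps_to (s := Ξ) (t := Finset.Icc 1 Q) (g := κ)
    fun ξ hξ => Finset.mem_Icc.2 ⟨(hκ ξ hξ).1, (hκ ξ hξ).2.1⟩]
  have h2 : ∀ q ∈ Finset.Icc 1 Q, ∑ ξ ∈ Ξ.filter (fun ξ => κ ξ = q), energy A N ξ ≤
      4 / L ^ 2 * ((2 * N : ℕ) * (16 * ε * (A.card / N : ℝ) ^ 2 * L ^ 2 * N)) := by
    intro q hq
    obtain ⟨hq1, hqQ⟩ := Finset.mem_Icc.1 hq
    have hqL : (q * L : ℝ) ≤ ε * N := le_trans (by gcongr) hQL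
    have hqLN : q * L ≤ N := by
      have : (q * L : ℝ) ≤ N := hqL.trans (mul_le_of_le_one_left (Nat.cast_nonneg _) hε1)
      exact_mod_cast this
    refine (sum_normSq_fourierSum_le_of_kernel N L q hN hL (fun x => (balanced A N x : ℂ))
      (fun x hx => by simp [balanced_eq_zero hA x hx]) (fun _ => 1) hqLN
      (Ξ.filter (fun ξ => κ ξ = q)) ((Finset.filter_subset _ _).trans hΞ) (fun ξ hξ => by
        have hξ := Finset.mem_filter.1 hξ
        have h4 := (hκ ξ hξ.1).2.2
        rw [hξ.2] at h4
        refine (norm_sum_expo_ge L _ η h4 hη).trans (le_of_eq ?_)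
        congr 1
        refine Finset.sum_congr rfl fun j _ => ?_
        rw [one_mul]
        congr 1
        ring)).trans ?_
    gcongr
    refine le_trans (le_of_eq ?_) (sum_progression_balanced_sq_le hN hA q L ε hε0 hε1 hqL
      (hinc q hq1 hqQ))
    refine Finset.sum_congr rfl fun z _ => ?_
    have : ∑ j ∈ Finset.range L, (1 : ℂ) * (balanced A N (z - q * j) : ℂ) =
        ((∑ j ∈ Finset.range L, balanced A N (z - q * j) : ℝ) : ℂ) := by
      push_cast; simp only [one_mul]
    rw [this, Complex.norm_real, Real.norm_eq_abs, sq_abs]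
  refine (Finset.sum_le_sum h2).trans (le_of_eq ?_)
  rw [Finset.sum_const, Nat.card_Icc, Nat.add_sub_cancel, nsmul_eq_mul]
  push_cast
  field_simp
  ring

end EnergyComparison

section DensityIncrement

open scoped Classical

variable {A : Finset ℤ} {N : ℕ}

lemma PrimitiveBounded.abs_eval_le {k : ℕ} {G : ℝ} {g : ℤ[X]} (hg : PrimitiveBounded k G g)
    {n M : ℕ} (hnM : n ≤ M) (hM : 1 ≤ M) : |((g.eval (n : ℤ) : ℤ) : ℝ)| ≤ (k + 1) * G * M ^ k := by
  have hG := hg.one_le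
  have hM1 : (1 : ℝ) ≤ M := by exact_mod_cast hM
  have hnM' : (n : ℝ) ≤ M := by exact_mod_cast hnM
  rw [eval_eq_sum_range' (Nat.lt_succ_of_le hg.natDegree_le)]
  push_cast
  refine (Finset.abs_sum_le_sum_abs _ _).trans ?_
  have h : ∀ i ∈ Finset.range (k + 1), |(g.coeff i : ℝ) * (n : ℝ) ^ i| ≤ G * M ^ k := by
    intro i hi
    have hik : i ≤ k := Nat.lt_succ_iff.1 (Finset.mem_range.1 hi)
    rw [abs_mul, abs_pow, Nat.abs_cast]
    have h1 : (n : ℝ) ^ i ≤ M ^ k :=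
      (pow_le_pow_left₀ (Nat.cast_nonneg _) hnM' i).trans (pow_le_pow_right₀ hM1 hik)
    exact mul_le_mul (hg.bound i) h1 (by positivity) (by linarith)
  refine (Finset.sum_le_sum h).trans (le_of_eq ?_)
  rw [Finset.sum_const, Finset.card_range, nsmul_eq_mul]
  push_cast
  ring

lemma le_sum_energy_mul_polySum {k : ℕ} {G δ Λ : ℝ} {g : ℤ[X]} (hg : PrimitiveBounded k G g)
    {M : ℕ} (hN : 1 ≤ N) (hM : 1 ≤ M) (hA : A ⊆ Finset.Ico (0 : ℤ) N) (hδ : δ = A.card / N)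
    (hδ0 : 0 < δ) (hδ1 : δ ≤ 1) (hΛ : 1 ≤ δ * Λ) (hM2 : 10 * k * Λ ≤ M)
    (hMN : 10 * (k + 1) * G * Λ * (M : ℝ) ^ k ≤ N)
    (hfree : ∀ x ∈ A, ∀ y ∈ A, x ≠ y → ∀ n : ℤ, x - y ≠ g.eval n) :
    7 / 5 * (M * (δ ^ 2 * N ^ 2)) ≤
      ∑ ξ ∈ Finset.range (2 * N), energy A N ξ * ‖polySum g M (ξ / (2 * N : ℕ))‖ := by
  have hG := hg.one_le
  have hN0 : (0 : ℝ) < N := by exact_mod_cast hN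
  have hAδ : (A.card : ℝ) = δ * N := by rw [hδ, div_mul_cancel₀ _ hN0.ne']
  have hT : ∀ n : ℕ, n < M → |((g.eval (n : ℤ) : ℤ) : ℝ)| ≤ δ * N / 10 := by
    intro n hn
    refine (hg.abs_eval_le hn.le hM).trans ?_
    have h2 := mul_le_mul_of_nonneg_left hMN hδ0.le
    have h3 : 0 ≤ (k + 1) * G * (M : ℝ) ^ k * 10 := by positivity
    have h4 := mul_le_mul_of_nonneg_left hΛ h3
    linarith
  have hneg : ∑ n ∈ Finset.range M, ∑ x ∈ Finset.Ico (0 : ℤ) N,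
      balanced A N x * balanced A N (x + g.eval (n : ℤ)) ≤ -(7 / 10) * (M * (δ ^ 2 * N)) := by
    refine (sum_sum_balanced_le hN hA g k hg.natDegree_le
      (fun h => hg.coeff_ne (by rw [h, coeff_zero])) M (δ * N / 10) hT hfree).trans ?_
    rw [← hδ, hAδ]
    have h1 := mul_le_mul_of_nonneg_left hM2 hδ0.le
    have h3 : (0 : ℝ) ≤ 10 * k := by positivity
    have h4 := mul_le_mul_of_nonneg_left hΛ h3
    have h2 : (10 * k : ℝ) ≤ M * δ := by linarith
    have h5 := mul_le_mul_of_nonneg_right h2 (by positivity : 0 ≤ δ * N)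
    nlinarith
  refine le_trans ?_ (neg_correlation_le_sum_energy hN hA g M fun n hn => ?_)
  · have := mul_le_mul_of_nonneg_left hneg (by positivity : (0 : ℝ) ≤ 2 * N)
    linarith
  · have h1 := hT n hn
    have h2 : |((g.eval (n : ℤ) : ℤ) : ℝ)| ≤ N := by nlinarith
    exact_mod_cast h2

lemma near_of_le_polySum {k K : ℕ} (hk : 1 ≤ k) (hW : WeylBound k K) {G : ℝ} {g : ℤ[X]}
    (hg : PrimitiveBounded k G g) {M : ℕ} {X Q : ℝ} (hX : 2 ≤ X) (hXQ : X ^ K ≤ Q)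
    (hM : 2 * G * Q < M) (α : ℝ) (hα : (M : ℝ) ≤ X * ‖polySum g M α‖) :
    ∃ q : ℕ, 1 ≤ q ∧ (q : ℝ) ≤ X ^ K ∧ Near (q * α) (Q / (M : ℝ) ^ k) := by
  have hG := hg.one_le
  have hX0 : 0 < X := by linarith
  have hQ0 : 0 < Q := lt_of_lt_of_le (by positivity) hXQ
  have hM0 : (0 : ℝ) < M := lt_of_le_of_lt (by positivity) hM
  obtain ⟨q, hq1, hqX, hq⟩ := hW.major_arc hk X hX g G hg M
    (lt_of_le_of_lt (mul_le_mul_of_nonneg_left hXQ (by positivity)) hM) _ hα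
  refine ⟨q, hq1, hqX, hq.mono ?_⟩
  have h1 : (1 : ℝ) ≤ |(g.coeff k : ℝ)| := by
    exact_mod_cast Int.one_le_abs hg.coeff_ne
  exact div_le_div₀ hQ0.le hXQ (by positivity) (le_mul_of_one_le_left (by positivity) h1)

lemma major_arc_energies_le {M N R RP δ t a : ℝ} (hR : 1280 ≤ R) (hM : 0 ≤ M) (hδ0 : 0 ≤ δ)
    (hRP : 1 ≤ RP) (hδR : 1 ≤ δ * RP) (ht : t = 1 / R) (ha : a = δ * N) :
    M * (128 * t * (δ ^ 2 * N ^ 2)) + M / R * (64 * (R / 640) * δ ^ 2 * N ^ 2) +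
      M / (10 * RP) * (2 * N * a) ≤ 4 / 10 * (M * (δ ^ 2 * N ^ 2)) := by
  have hR0 : 0 < R := by linarith
  have hpos : 0 ≤ M * (δ ^ 2 * N ^ 2) := by positivity
  have h1 : M * (128 * t * (δ ^ 2 * N ^ 2)) ≤ 1 / 10 * (M * (δ ^ 2 * N ^ 2)) := by
    have h2 : 128 * t ≤ 1 / 10 := by
      rw [ht, mul_one_div, div_le_div_iff₀ hR0 (by norm_num)]
      linarith
    have := mul_le_mul_of_nonneg_right h2 hpos
    linarith
  have h2 : M / R * (64 * (R / 640) * δ ^ 2 * N ^ 2) = 1 / 10 * (M * (δ ^ 2 * N ^ 2)) := by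
    field_simp; ring
  have h3 : M / (10 * RP) * (2 * N * a) ≤ 2 / 10 * (M * (δ ^ 2 * N ^ 2)) := by
    rw [ha, div_mul_eq_mul_div, div_le_iff₀ (by positivity)]
    have h4 := mul_le_mul_of_nonneg_left hδR (by positivity : 0 ≤ 2 * M * δ * N ^ 2)
    linarith
  linarith

lemma exists_increment_of_params {k K m : ℕ} (hk : 2 ≤ k) (hW : WeylBound k K) (hm : 1 ≤ m) {C : ℝ}
    (hC1 : 1 ≤ C)
    (hC : ∀ (D : ℕ) [NeZero D] (Q L : ℕ) (y : ℤ) (B : Finset ℤ) (σ : ℝ), 1 ≤ Q →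
      Q ^ (6 * m + 1) ≤ L → B ⊆ Finset.Ico y (y + L) → 0 < σ → σ ≤ 4 →
      (∀ w : ℕ, 1 ≤ w → w ≤ Q → ∀ r : ℤ,
        ((B.filter fun n => (w : ℤ) ∣ n - r).card : ℝ) ≤ σ * L / w) →
      (∑ k ∈ Finset.univ.filter (fun k : ZMod D => addOrderOf k ≤ Q),
        ‖∑ n ∈ B, chi k (n : ZMod D)‖ ^ 2) ^ m ≤ C * σ ^ (2 * m - 1) * Q ^ 2 * L ^ (2 * m))
    {G : ℝ} {g : ℤ[X]} (hg : PrimitiveBounded k G g) (R P M L Q₁ : ℕ) (hR : 1280 ≤ R)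
    (hP : 2 * K + 1 ≤ P) (hQ₁ : Q₁ = (10 * R ^ P) ^ K) (hLdef : L = M ^ k / (16 * Q₁))
    (hρ : C * 16 ^ m * Q₁ ^ 2 * R ^ P ≤ ((R : ℝ) / 640) ^ m) (hM1 : 2 * G * Q₁ < M)
    (hM2 : 10 * k * R ^ P ≤ M) (hMN : 10 * (k + 1) * G * R ^ P * (M : ℝ) ^ k ≤ N)
    (hL : Q₁ ^ (6 * m + 1) ≤ L) (hA : A ⊆ Finset.Ico (0 : ℤ) N) (hdens : N ≤ A.card * R ^ P)
    (hfree : ∀ x ∈ A, ∀ y ∈ A, x ≠ y → ∀ n : ℤ, x - y ≠ g.eval n) :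
    ∃ (w J : ℕ) (x₀ : ℤ), 1 ≤ w ∧ w ≤ Q₁ ∧ L ≤ w * J ∧
      (1 + 1 / (R : ℝ) ^ (K + 1)) * (A.card / N) * J <
        ((Finset.range J).filter fun j : ℕ => x₀ + w * j ∈ A).card := by
  by_contra hcon
  push Not at hcon
  have hG := hg.one_le
  have hR0 : (0 : ℝ) < R := by exact_mod_cast (by omega : 0 < R)
  have hR1 : (1 : ℝ) ≤ R := by exact_mod_cast (by omega : 1 ≤ R)
  have hRP : (1 : ℝ) ≤ (R : ℝ) ^ P := one_le_pow₀ hR1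
  have hRPn : 1 ≤ R ^ P := Nat.one_le_pow _ _ (by omega)
  have hM1n : 1 ≤ M := by
    have : 10 * 2 * 1 ≤ M := le_trans (by gcongr) hM2
    omega
  have hM1' : (1 : ℝ) ≤ M := by exact_mod_cast hM1n
  have hMk : (1 : ℝ) ≤ (M : ℝ) ^ k := one_le_pow₀ hM1'
  have hMkN : (M : ℝ) ^ k ≤ N := by
    refine le_trans (le_mul_of_one_le_left (by positivity) ?_) hMN
    have : (1 : ℝ) ≤ 10 * (k + 1) := by linarith [(Nat.cast_nonneg k : (0 : ℝ) ≤ k)]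
    calc (1 : ℝ) = 1 * 1 * 1 := by ring
      _ ≤ 10 * (k + 1) * G * R ^ P := by gcongr
  have hN0 : (0 : ℝ) < N := by linarith
  have hN : 1 ≤ N := by exact_mod_cast hN0
  have hQ₁1 : 1 ≤ Q₁ := by rw [hQ₁]; exact Nat.one_le_pow _ _ (by omega)
  have hQ₁0 : (0 : ℝ) < Q₁ := by exact_mod_cast hQ₁1
  have hQ₁r : (Q₁ : ℝ) = (10 * (R : ℝ) ^ P) ^ K := by rw [hQ₁]; push_cast; ring
  have hL1 : 1 ≤ L := (Nat.one_le_pow _ _ hQ₁1).trans hL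
  have hL0 : (0 : ℝ) < L := by exact_mod_cast hL1
  have hLle : (L : ℝ) * (16 * Q₁) ≤ (M : ℝ) ^ k := by
    have : L * (16 * Q₁) ≤ M ^ k := by rw [hLdef]; exact Nat.div_mul_le_self _ _
    exact_mod_cast this
  have hLN : L ≤ N := by
    have h1 : (1 : ℝ) ≤ 16 * Q₁ := by
      have : (1 : ℝ) ≤ Q₁ := by exact_mod_cast hQ₁1
      linarith
    have : (L : ℝ) ≤ N := by nlinarith
    exact_mod_cast this
  set δ : ℝ := A.card / N with hδ
  have hAδ : (A.card : ℝ) = δ * N := by rw [hδ, div_mul_cancel₀ _ hN0.ne']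
  have hδR : 1 ≤ δ * R ^ P := by
    rw [hδ, div_mul_eq_mul_div, le_div_iff₀ hN0, one_mul]; exact_mod_cast hdens
  have hδ0 : 0 < δ := by
    by_contra h
    push Not at h
    nlinarith
  have hδ1 : δ ≤ 1 := by
    rw [hδ, div_le_one hN0]
    have := Finset.card_le_card hA
    rw [Int.card_Ico, sub_zero, Int.toNat_natCast] at this
    exact_mod_cast this
  set ε : ℝ := 1 / (R : ℝ) ^ (K + 1) with hε
  have hε0 : 0 ≤ ε := by positivity
  have hε1 : ε ≤ 1 := by
    rw [hε, div_le_one (by positivity)]; exact one_le_pow₀ hR1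
  have hlow := le_sum_energy_mul_polySum hg hN hM1n hA hδ hδ0 hδ1 hδR (by exact_mod_cast hM2) hMN
    hfree
  set η : ℝ := Q₁ / (M : ℝ) ^ k with hη
  have hηL : η * L ≤ 1 / 16 := by
    rw [hη, div_mul_eq_mul_div, div_le_div_iff₀ (by positivity) (by norm_num)]
    linarith
  have hmajor : ∀ X : ℝ, 2 ≤ X → X ≤ 10 * R ^ P → ∀ ξ : ℕ,
      (M : ℝ) ≤ X * ‖polySum g M (ξ / (2 * N : ℕ))‖ →
      ∃ q : ℕ, 1 ≤ q ∧ (q : ℝ) ≤ X ^ K ∧ Near (q * (ξ / (2 * N : ℕ) : ℝ)) η := by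
    intro X hX hXR ξ hξ
    have hXK : X ^ K ≤ Q₁ := by rw [hQ₁r]; exact pow_le_pow_left₀ (by linarith) hXR K
    exact near_of_le_polySum (by omega) hW hg hX hXK hM1 _ hξ
  have hRX : (R : ℝ) ≤ 10 * R ^ P := by
    have : (R : ℝ) ≤ R ^ P := le_self_pow₀ hR1 (by omega)
    linarith
  have hR2 : (2 : ℝ) ≤ R := by exact_mod_cast (by omega : 2 ≤ R)
  have hRKL : ((R ^ K : ℕ) * L : ℝ) ≤ ε * N := by
    have h1 : ((R : ℝ) ^ K * L) * R ^ (K + 1) ≤ N := by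
      calc ((R : ℝ) ^ K * L) * R ^ (K + 1) = R ^ (2 * K + 1) * L := by ring
        _ ≤ R ^ P * (M : ℝ) ^ k := by
          gcongr
          · have h1 : (1 : ℝ) ≤ 16 * Q₁ := by
              have : (1 : ℝ) ≤ Q₁ := by exact_mod_cast hQ₁1
              linarith
            nlinarith
        _ ≤ 10 * (k + 1) * G * R ^ P * (M : ℝ) ^ k := by
          have : (1 : ℝ) ≤ 10 * (k + 1) := by linarith [(Nat.cast_nonneg k : (0 : ℝ) ≤ k)]
          calc (R : ℝ) ^ P * (M : ℝ) ^ k = 1 * 1 * R ^ P * M ^ k := by ring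
            _ ≤ _ := by gcongr
        _ ≤ N := hMN
    rw [hε, one_div_mul_eq_div, le_div_iff₀ (by positivity)]
    push_cast
    exact h1
  have hRKQ : R ^ K ≤ Q₁ := by
    rw [hQ₁]
    exact Nat.pow_le_pow_left (by exact_mod_cast hRX) K
  have hE₀ := sum_energy_narrow_arcs_le hN hA (R ^ K) L hL1 ε hε0 hε1 hRKL
    (fun q hq1 hqR x₀ => hcon q L x₀ hq1 (hqR.trans hRKQ) (Nat.le_mul_of_pos_left _ hq1)) η hηL
    ((Finset.range (2 * N)).filter fun ξ => (M : ℝ) ≤ R * ‖polySum g M (ξ / (2 * N : ℕ))‖)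
    (Finset.filter_subset _ _) (fun ξ hξ => by
      obtain ⟨q, hq1, hq2, hq3⟩ := hmajor R hR2 hRX ξ (Finset.mem_filter.1 hξ).2
      exact ⟨q, hq1, by exact_mod_cast hq2, hq3⟩)
  have hE₁ := by
    haveI : NeZero (Nat.factorial Q₁) := ⟨Nat.factorial_ne_zero _⟩
    exact sum_normSq_major_arcs_le (D := Nat.factorial Q₁) hm hC1 hN hA Q₁ L
      (fun q hq1 hqQ => Nat.dvd_factorial hq1 hqQ) (hC _) hδ0 hδ1 hQ₁1 hL hLN
      (fun w hw1 hwQ x₀ => by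
        refine (hcon w (L / w + 1) x₀ hw1 hwQ ?_).trans ?_
        · exact (Nat.lt_mul_div_succ L (by omega)).le
        · have h1 : (0 : ℝ) ≤ δ * (L / w + 1 : ℕ) := mul_nonneg hδ0.le (Nat.cast_nonneg _)
          have h2 := mul_le_mul_of_nonneg_right hε1 h1
          linarith)
      (R / 640) (by positivity) (by
        rw [← hδ]
        have h2 := mul_le_mul_of_nonneg_left hρ hδ0.le
        have h3 : 0 ≤ C * 16 ^ m * (Q₁ : ℝ) ^ 2 := by positivity
        have h4 := mul_le_mul_of_nonneg_left hδR h3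
        linarith) η hηL
      ((Finset.range (2 * N)).filter fun ξ =>
        (M : ℝ) ≤ (10 * R ^ P) * ‖polySum g M (ξ / (2 * N : ℕ))‖)
      (Finset.filter_subset _ _) (fun ξ hξ => by
        obtain ⟨q, hq1, hq2, hq3⟩ := hmajor (10 * R ^ P) (by linarith) le_rfl ξ
          (Finset.mem_filter.1 hξ).2
        exact ⟨q, hq1, by rw [← hQ₁r] at hq2; exact_mod_cast hq2, hq3⟩)
  have hE₂ := sum_energy_le hN hA
  have hup := sum_mul_le_of_level_sets (Finset.range (2 * N)) (energy A N)
    (fun ξ => ‖polySum g M (ξ / (2 * N : ℕ))‖) M R (10 * R ^ P) _ _ _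
    (fun ξ _ => energy_nonneg A N ξ) (fun ξ _ => norm_polySum_le g M _) (Nat.cast_nonneg _)
    hR0 (by positivity) hE₀ hE₁ hE₂
  rw [← hδ] at hup
  have hQε : ((R ^ K : ℕ) : ℝ) * ε = 1 / R := by
    rw [hε]; push_cast; field_simp; ring
  have hfin := major_arc_energies_le (M := M) (N := N) (by exact_mod_cast hR) (Nat.cast_nonneg M)
    hδ0.le hRP hδR hQε hAδ
  have hpos : 0 < (M : ℝ) * (δ ^ 2 * N ^ 2) :=
    mul_pos (by linarith) (mul_pos (pow_pos hδ0 2) (pow_pos hN0 2))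
  linarith

end DensityIncrement

section DensityIncrementConstants

open scoped Classical

lemma exists_length_parameter (k c N V : ℕ) (hk : 1 ≤ k) (hc : 1 ≤ c) (hV : 1 ≤ V)
    (h : c * V ^ k ≤ N) : ∃ M : ℕ, V ≤ M ∧ c * M ^ k ≤ N ∧ N ≤ c * 2 ^ k * M ^ k := by
  have hVN : V ≤ N := (Nat.le_self_pow (by omega) V).trans
    ((Nat.le_mul_of_pos_left _ hc).trans h)
  refine ⟨Nat.findGreatest (fun M => c * M ^ k ≤ N) N, Nat.le_findGreatest hVN h,
    Nat.findGreatest_spec (P := fun M => c * M ^ k ≤ N) hVN h, ?_⟩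
  set M := Nat.findGreatest (fun M => c * M ^ k ≤ N) N with hM
  have hVM : V ≤ M := Nat.le_findGreatest hVN h
  have h1 : N < c * (M + 1) ^ k := by
    by_contra hcon
    push Not at hcon
    have h2 : M + 1 ≤ N := (Nat.le_self_pow (by omega) _).trans
      ((Nat.le_mul_of_pos_left _ hc).trans hcon)
    exact Nat.findGreatest_is_greatest (P := fun M => c * M ^ k ≤ N) (n := N) (k := M + 1)
      (by omega) h2 hcon
  calc N ≤ c * (M + 1) ^ k := h1.le
    _ ≤ c * (2 * M) ^ k := by gcongr; omega
    _ = _ := by rw [mul_pow]; ring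

theorem exists_density_increment (k : ℕ) (hk : 2 ≤ k) : ∃ K : ℕ, ∀ P : ℕ, 2 * K + 1 ≤ P →
    ∃ B R₀ : ℕ, ∀ R : ℕ, R₀ ≤ R → ∀ (G : ℕ) (g : ℤ[X]) (N : ℕ) (A : Finset ℤ),
      PrimitiveBounded k G g → (G * R) ^ B ≤ N → A ⊆ Finset.Ico (0 : ℤ) N → N ≤ A.card * R ^ P →
      (∀ x ∈ A, ∀ y ∈ A, x ≠ y → ∀ n : ℤ, x - y ≠ g.eval n) →
      ∃ (w J : ℕ) (x₀ : ℤ), 1 ≤ w ∧ w ≤ R ^ B ∧ N ≤ J * (G * R) ^ B ∧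
        (1 + 1 / (R : ℝ) ^ (K + 1)) * (A.card / N) * J <
          ((Finset.range J).filter fun j : ℕ => x₀ + w * j ∈ A).card := by
  obtain ⟨K, hW⟩ := exists_weylBound k (by omega)
  refine ⟨K, fun P hP => ?_⟩
  obtain ⟨C, hC1, hC⟩ := exists_moment_bound ((2 * K + 1) * P + 1) (by omega)
  set m := (2 * K + 1) * P + 1 with hm
  set b := (1 + P * K) * (6 * m + 2) + P + 3 with hb
  refine ⟨P + 2 + b * k, 1280 + 10 ^ K + 320 * (k + 1) * 2 ^ k +
    ⌈C * 16 ^ m * 640 ^ m * 100 ^ K⌉₊, fun R hR G g N A hg hGN hA hdens hfree => ?_⟩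
  have hG : 1 ≤ G := by exact_mod_cast hg.one_le
  have h2k : 1 ≤ 2 ^ k := Nat.one_le_two_pow
  have hkk : k + 1 ≤ (k + 1) * 2 ^ k := Nat.le_mul_of_pos_right _ h2k
  have hp1 : 0 ≤ 10 ^ K := Nat.zero_le _
  have hp2 : 0 ≤ 320 * (k + 1) * 2 ^ k := Nat.zero_le _
  have hR1280 : 1280 ≤ R := by omega
  have hR10 : 10 ^ K ≤ R := by omega
  have hRk2 : 320 * (k + 1) * 2 ^ k ≤ R := by omega
  have hRk : 10 * (k + 1) ≤ R := by rw [mul_assoc] at hRk2; omega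
  have hRC : C * 16 ^ m * 640 ^ m * 100 ^ K ≤ R := by
    refine (Nat.le_ceil _).trans ?_
    exact_mod_cast (by omega : ⌈C * 16 ^ m * 640 ^ m * 100 ^ K⌉₊ ≤ R)
  clear hR
  set W := G * R with hWdef
  have hRW : R ≤ W := Nat.le_mul_of_pos_left _ hG
  have hGW : G ≤ W := Nat.le_mul_of_pos_right _ (by omega)
  have hW1 : 1 ≤ W := by omega
  have hRP : 1 ≤ R ^ P := Nat.one_le_pow _ _ (by omega)
  set Q₁ := (10 * R ^ P) ^ K with hQ₁
  have hQ₁1 : 1 ≤ Q₁ := Nat.one_le_pow _ _ (by omega)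
  have hQ₁R : Q₁ ≤ R ^ (1 + P * K) := by
    rw [hQ₁, mul_pow, pow_add, pow_one, ← pow_mul]
    gcongr
  have hQ₁W : Q₁ ≤ W ^ (1 + P * K) := hQ₁R.trans (by gcongr)
  have hbK : 1 + P * K + 3 ≤ b := by rw [hb]; nlinarith [Nat.zero_le (P * K), Nat.zero_le m]
  have hbK2 : 8 * (1 + P * K) ≤ b := by
    have h6 : 8 ≤ 6 * m + 2 := by omega
    calc 8 * (1 + P * K) = (1 + P * K) * 8 := mul_comm _ _
      _ ≤ (1 + P * K) * (6 * m + 2) := by gcongr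
      _ ≤ b := by omega
  have hbk : b ≤ b * k := Nat.le_mul_of_pos_right _ (by omega)
  have hstart : (10 * (k + 1) * G * R ^ P) * (W ^ b) ^ k ≤ N := by
    refine le_trans ?_ hGN
    calc (10 * (k + 1) * G * R ^ P) * (W ^ b) ^ k ≤ (W * W * W ^ P) * (W ^ b) ^ k := by
          gcongr
          exact hRk.trans hRW
      _ = W ^ (P + 2 + b * k) := by ring
  obtain ⟨M, hVM, hMN, hNM⟩ := exists_length_parameter k (10 * (k + 1) * G * R ^ P) N (W ^ b)
    (by omega) (Nat.one_le_iff_ne_zero.2 (by positivity)) (Nat.one_le_pow _ _ hW1) hstart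
  have hM1 : 2 * G * Q₁ < M := by
    refine lt_of_lt_of_le ?_ hVM
    calc 2 * G * Q₁ < R * G * Q₁ := by gcongr; omega
      _ ≤ W * W * W ^ (1 + P * K) := by gcongr
      _ = W ^ (1 + P * K + 2) := by ring
      _ ≤ W ^ b := Nat.pow_le_pow_right hW1 (by omega)
  have hM2 : 10 * k * R ^ P ≤ M := by
    refine le_trans ?_ hVM
    calc 10 * k * R ^ P ≤ W * W ^ P := by gcongr; omega
      _ = W ^ (P + 1) := by ring
      _ ≤ W ^ b := Nat.pow_le_pow_right hW1 (by omega)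
  have hM0 : 1 ≤ M := by omega
  have hL : Q₁ ^ (6 * m + 1) ≤ M ^ k / (16 * Q₁) := by
    rw [Nat.le_div_iff_mul_le (by omega)]
    calc Q₁ ^ (6 * m + 1) * (16 * Q₁) = 16 * Q₁ ^ (6 * m + 2) := by ring
      _ ≤ W * (W ^ (1 + P * K)) ^ (6 * m + 2) := by gcongr; omega
      _ = W ^ ((1 + P * K) * (6 * m + 2) + 1) := by rw [← pow_mul]; ring
      _ ≤ W ^ b := Nat.pow_le_pow_right hW1 (by omega)
      _ ≤ M := hVM
      _ ≤ M ^ k := Nat.le_self_pow (by omega) M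
  have hρ : C * 16 ^ m * (Q₁ : ℝ) ^ 2 * (R : ℝ) ^ P ≤ ((R : ℝ) / 640) ^ m := by
    rw [div_pow, le_div_iff₀ (by positivity)]
    have h1 : (Q₁ : ℝ) ^ 2 * (R : ℝ) ^ P = 100 ^ K * (R : ℝ) ^ ((2 * K + 1) * P) := by
      rw [hQ₁]; push_cast
      rw [mul_pow, ← pow_mul, mul_pow, ← pow_mul, ← pow_mul, mul_comm K 2, pow_mul, mul_assoc,
        ← pow_add]
      norm_num
      ring
    calc C * 16 ^ m * (Q₁ : ℝ) ^ 2 * (R : ℝ) ^ P * 640 ^ m =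
        C * 16 ^ m * 640 ^ m * ((Q₁ : ℝ) ^ 2 * (R : ℝ) ^ P) := by ring
      _ = (C * 16 ^ m * 640 ^ m * 100 ^ K) * (R : ℝ) ^ ((2 * K + 1) * P) := by rw [h1]; ring
      _ ≤ R * (R : ℝ) ^ ((2 * K + 1) * P) := by gcongr
      _ = (R : ℝ) ^ m := by rw [hm]; ring
  obtain ⟨w, J, x₀, hw1, hwQ, hLJ, hinc⟩ := exists_increment_of_params hk hW (by omega) hC1 hC hg
    R P M _ Q₁ hR1280 hP hQ₁ rfl hρ (by exact_mod_cast hM1) hM2 (by exact_mod_cast hMN) hL hA hdens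
    hfree
  refine ⟨w, J, x₀, hw1, hwQ.trans (hQ₁R.trans (Nat.pow_le_pow_right (by omega) (by omega))),
    ?_, hinc⟩
  have hL1 : 1 ≤ M ^ k / (16 * Q₁) := (Nat.one_le_pow _ _ hQ₁1).trans hL
  have hML : M ^ k ≤ 32 * Q₁ * (w * J) := by
    have h1 := Nat.lt_mul_div_succ (M ^ k) (by omega : 0 < 16 * Q₁)
    calc M ^ k ≤ 16 * Q₁ * (M ^ k / (16 * Q₁) + 1) := h1.le
      _ ≤ 16 * Q₁ * (2 * (w * J)) := by gcongr; omega
      _ = _ := by ring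
  calc N ≤ 10 * (k + 1) * G * R ^ P * 2 ^ k * M ^ k := hNM
    _ ≤ 10 * (k + 1) * G * R ^ P * 2 ^ k * (32 * Q₁ * (Q₁ * J)) := by
      gcongr
      exact hML.trans (by gcongr)
    _ = (320 * (k + 1) * 2 ^ k) * G * R ^ P * Q₁ * Q₁ * J := by ring
    _ ≤ W * W * W ^ P * W ^ (1 + P * K) * W ^ (1 + P * K) * J := by
      gcongr
      exact hRk2.trans hRW
    _ = J * W ^ (P + 2 + 2 * (1 + P * K)) := by ring
    _ ≤ J * W ^ (P + 2 + b * k) := by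
      refine Nat.mul_le_mul_left _ (Nat.pow_le_pow_right hW1 ?_)
      omega

end DensityIncrementConstants

section Renormalise

/-- A polynomial having a root modulo every positive integer. -/
def Intersective (g : ℤ[X]) : Prop := ∀ d : ℕ, 0 < d → ∃ n : ℤ, (d : ℤ) ∣ g.eval n

lemma Intersective.exists_class {g : ℤ[X]} (hg : Intersective g) (w : ℕ) (hw : 1 ≤ w) :
    ∃ s : ℕ, s < w ∧ ∀ d : ℕ, 0 < d → ∃ n : ℤ, (d : ℤ) ∣ g.eval (s + w * n) := by
  by_contra hcon
  push Not at hcon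
  choose! D hD0 hD using hcon
  obtain ⟨n, hn⟩ := hg (∏ s ∈ Finset.range w, D s)
    (Finset.prod_pos fun s hs => hD0 s (Finset.mem_range.1 hs))
  have hw0 : (w : ℤ) ≠ 0 := by omega
  have h1 : ((n % w).toNat : ℤ) = n % w := Int.toNat_of_nonneg (Int.emod_nonneg n hw0)
  have h2 : (n % w).toNat < w := by
    have := Int.emod_lt_of_pos n (by omega : (0 : ℤ) < w)
    omega
  refine hD _ h2 (n / w) ?_
  rw [h1, Int.emod_add_mul_ediv]
  refine dvd_trans ?_ hn
  exact_mod_cast Finset.dvd_prod_of_mem D (Finset.mem_range.2 h2)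

lemma dvd_taylor_coeff {d : ℤ} {g : ℤ[X]} (hd : ∀ i, 1 ≤ i → d ∣ g.coeff i) (r : ℤ) (i : ℕ)
    (hi : 1 ≤ i) : d ∣ (taylor r g).coeff i := by
  rw [taylor_coeff]
  have h1 : C d ∣ hasseDeriv i g := by
    rw [C_dvd_iff_dvd_coeff]
    intro j
    rw [hasseDeriv_coeff]
    exact Dvd.dvd.mul_left (hd _ (by omega)) _
  have h2 := eval_dvd (x := r) h1
  rwa [eval_C] at h2

lemma dvd_eval_of_dvd_coeff {d : ℤ} {p : ℤ[X]} (hd : ∀ i, 1 ≤ i → d ∣ p.coeff i) {n : ℤ}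
    (hn : d ∣ p.eval n) : d ∣ p.coeff 0 := by
  have h1 : C d ∣ p.divX := by
    rw [C_dvd_iff_dvd_coeff]
    intro j
    rw [coeff_divX]
    exact hd _ (by omega)
  have h2 := eval_dvd (x := n) h1
  rw [eval_C] at h2
  rw [← divX_mul_X_add p, eval_add, eval_mul, eval_X, eval_C] at hn
  exact (Int.dvd_add_right (Dvd.dvd.mul_right h2 n)).1 hn

lemma abs_taylor_coeff_mul_pow_le {g : ℤ[X]} {k s w i : ℕ} {G : ℝ} (hdeg : g.natDegree ≤ k)
    (hG : ∀ i, |(g.coeff i : ℝ)| ≤ G) (hs : s ≤ w) (hw : 1 ≤ w) (hi : i ≤ k) :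
    |(((taylor (s : ℤ) g).coeff i * (w : ℤ) ^ i : ℤ) : ℝ)| ≤ (k + 1) * 2 ^ k * G * w ^ k := by
  have hG0 : 0 ≤ G := (abs_nonneg _).trans (hG 0)
  have hw1 : (1 : ℝ) ≤ w := by exact_mod_cast hw
  have hsw : (s : ℝ) ≤ w := by exact_mod_cast hs
  rw [taylor_coeff, eval_eq_sum_range' (n := k - i + 1)
    (by have := natDegree_hasseDeriv_le g i; omega)]
  push_cast
  rw [Finset.sum_mul]
  refine (Finset.abs_sum_le_sum_abs _ _).trans ?_
  have h : ∀ j ∈ Finset.range (k - i + 1),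
      |((hasseDeriv i g).coeff j : ℝ) * (s : ℝ) ^ j * (w : ℝ) ^ i| ≤ 2 ^ k * G * w ^ k := by
    intro j hj
    have hj := Finset.mem_range.1 hj
    rw [hasseDeriv_coeff]
    push_cast
    rw [abs_mul, abs_mul, abs_mul, abs_pow, abs_pow, Nat.abs_cast, Nat.abs_cast, Nat.abs_cast]
    have h1 : ((j + i).choose i : ℝ) ≤ 2 ^ k := by
      have : (j + i).choose i ≤ 2 ^ k :=
        (Nat.choose_le_two_pow _ _).trans (Nat.pow_le_pow_right (by norm_num) (by omega))
      exact_mod_cast this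
    have h2 : (s : ℝ) ^ j * (w : ℝ) ^ i ≤ w ^ k := by
      calc (s : ℝ) ^ j * (w : ℝ) ^ i ≤ w ^ j * w ^ i := by gcongr
        _ = w ^ (j + i) := by rw [pow_add]
        _ ≤ w ^ k := pow_le_pow_right₀ hw1 (by omega)
    calc ((j + i).choose i : ℝ) * |(g.coeff (j + i) : ℝ)| * (s : ℝ) ^ j * (w : ℝ) ^ i =
        ((j + i).choose i : ℝ) * |(g.coeff (j + i) : ℝ)| * ((s : ℝ) ^ j * (w : ℝ) ^ i) := by ring
      _ ≤ 2 ^ k * G * w ^ k := by gcongr; exact hG _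
  refine (Finset.sum_le_sum h).trans ?_
  rw [Finset.sum_const, Finset.card_range, nsmul_eq_mul]
  have h3 : ((k - i + 1 : ℕ) : ℝ) ≤ k + 1 := by exact_mod_cast (by omega : k - i + 1 ≤ k + 1)
  calc ((k - i + 1 : ℕ) : ℝ) * (2 ^ k * G * w ^ k) ≤ (k + 1) * (2 ^ k * G * w ^ k) := by gcongr
    _ = _ := by ring

/-- Restricting an intersective polynomial to a suitable residue class and dividing by the
greatest common divisor of the nonconstant coefficients. -/
lemma Intersective.exists_primitive {g : ℤ[X]} (hg : Intersective g) {k w : ℕ} {G : ℝ} (hk : 1 ≤ k)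
    (hdeg : g.natDegree ≤ k) (hlead : g.coeff k ≠ 0) (hG : ∀ i, |(g.coeff i : ℝ)| ≤ G)
    (hw : 1 ≤ w) : ∃ (u s : ℕ) (f : ℤ[X]), 1 ≤ u ∧ (∀ n : ℤ, u * f.eval n = g.eval (s + w * n)) ∧
      PrimitiveBounded k ((k + 1) * 2 ^ k * G * w ^ k) f ∧ Intersective f ∧ w ∣ u ∧
      ((∀ d : ℕ, (∀ i, 1 ≤ i → (d : ℤ) ∣ g.coeff i) → d = 1) → u ∣ w ^ k) := by
  obtain ⟨s, hsw, hs⟩ := hg.exists_class w hw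
  set t := taylor (s : ℤ) g with ht
  set p := t.comp (C (w : ℤ) * X) with hp
  have hpc : ∀ i, p.coeff i = t.coeff i * (w : ℤ) ^ i := fun i => comp_C_mul_X_coeff
  have hpe : ∀ n, p.eval n = g.eval (s + w * n) := by
    intro n
    rw [hp, eval_comp, ht, taylor_eval]
    simp [add_comm]
  have htdeg : t.natDegree ≤ k := by rw [ht, natDegree_taylor]; exact hdeg
  have hgk : g.natDegree = k := le_antisymm hdeg (le_natDegree_of_ne_zero hlead)
  have htk : t.coeff k = g.coeff k := by
    rw [ht, ← hgk, coeff_taylor_natDegree, leadingCoeff]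
  have hw0 : (w : ℤ) ≠ 0 := by omega
  have hpk : p.coeff k ≠ 0 := by
    rw [hpc, htk]; exact mul_ne_zero hlead (pow_ne_zero _ hw0)
  have hp0 : ∀ i, k < i → p.coeff i = 0 := by
    intro i hi
    rw [hpc, coeff_eq_zero_of_natDegree_lt (by omega), zero_mul]
  set u := (Finset.Icc 1 k).gcd fun i => (p.coeff i).natAbs with hu
  have hup : ∀ i, 1 ≤ i → (u : ℤ) ∣ p.coeff i := by
    intro i hi
    rcases le_or_gt i k with hik | hik
    · exact Int.natCast_dvd.2 (Finset.gcd_dvd (f := fun i => (p.coeff i).natAbs)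
        (Finset.mem_Icc.2 ⟨hi, hik⟩))
    · rw [hp0 i hik]; exact dvd_zero _
  have hu_max : ∀ d : ℕ, (∀ i, 1 ≤ i → (d : ℤ) ∣ p.coeff i) → d ∣ u := fun d hd =>
    Finset.dvd_gcd fun i hi => Int.natCast_dvd.1 (hd i (Finset.mem_Icc.1 hi).1)
  have hu0 : u ≠ 0 := by
    intro h
    have := hup k hk
    rw [h, Nat.cast_zero, zero_dvd_iff] at this
    exact hpk this
  have hu1 : 1 ≤ u := Nat.one_le_iff_ne_zero.2 hu0
  have hu0' : (u : ℤ) ≠ 0 := by exact_mod_cast hu0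
  have hup0 : (u : ℤ) ∣ p.coeff 0 := by
    obtain ⟨n, hn⟩ := hs u hu1
    rw [← hpe] at hn
    exact dvd_eval_of_dvd_coeff hup hn
  have hCu : C (u : ℤ) ∣ p := by
    rw [C_dvd_iff_dvd_coeff]
    intro i
    rcases Nat.eq_zero_or_pos i with rfl | hi
    · exact hup0
    · exact hup i hi
  obtain ⟨f, hf⟩ := hCu
  have hfc : ∀ i, p.coeff i = u * f.coeff i := by
    intro i; rw [hf, coeff_C_mul]
  have hfe : ∀ n, (u : ℤ) * f.eval n = g.eval (s + w * n) := by
    intro n; rw [← hpe, hf, eval_mul, eval_C]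
  have hf0 : ∀ i, k < i → f.coeff i = 0 := by
    intro i hi
    have := hfc i
    rw [hp0 i hi] at this
    exact (mul_eq_zero.1 this.symm).resolve_left hu0'
  have hG0 : 0 ≤ G := (abs_nonneg _).trans (hG 0)
  refine ⟨u, s, f, hu1, hfe, ⟨?_, ?_, ?_, ?_⟩, ?_, ?_, ?_⟩
  · exact natDegree_le_iff_coeff_eq_zero.2 hf0
  · intro h
    apply hpk
    rw [hfc, h, mul_zero]
  · intro i
    rcases le_or_gt i k with hik | hik
    · refine le_trans ?_ (abs_taylor_coeff_mul_pow_le hdeg hG hsw.le hw hik)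
      rw [← ht, ← hpc, hfc]
      push_cast
      rw [abs_mul, Nat.abs_cast]
      exact le_mul_of_one_le_left (abs_nonneg _) (by exact_mod_cast hu1)
    · rw [hf0 i hik, Int.cast_zero, abs_zero]
      positivity
  · intro d hd
    have h1 : u * d ∣ u := hu_max (u * d) fun i hi => by
      rw [hfc]; push_cast; exact mul_dvd_mul_left _ (hd i hi)
    have h2 : u * d ∣ u * 1 := by rwa [mul_one]
    exact Nat.dvd_one.1 (Nat.dvd_of_mul_dvd_mul_left hu1 h2)
  · intro d hd
    obtain ⟨n, hn⟩ := hs (u * d) (by positivity)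
    refine ⟨n, ?_⟩
    rw [← hfe] at hn
    push_cast at hn
    exact Int.dvd_of_mul_dvd_mul_left hu0' hn
  · exact hu_max w fun i hi => by
      rw [hpc]; exact Dvd.dvd.mul_left (dvd_pow_self _ (by omega)) _
  · intro hprim
    have h1 : u / Nat.gcd u (w ^ k) = 1 := by
      apply hprim
      have hd : ∀ i, 1 ≤ i → ((u / Nat.gcd u (w ^ k) : ℕ) : ℤ) ∣ t.coeff i := by
        intro i hi
        rcases le_or_gt i k with hik | hik
        · rw [Int.natCast_dvd]
          have h2 : u ∣ w ^ k * (t.coeff i).natAbs := by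
            have h3 := Int.natCast_dvd.1 (hup i hi)
            rw [hpc, Int.natAbs_mul, Int.natAbs_pow, Int.natAbs_natCast] at h3
            refine h3.trans ?_
            rw [mul_comm]
            exact mul_dvd_mul_right (pow_dvd_pow w hik) _
          have hgp : 0 < Nat.gcd u (w ^ k) := Nat.gcd_pos_of_pos_left _ hu1
          refine (Nat.coprime_div_gcd_div_gcd hgp).dvd_of_dvd_mul_left ?_
          refine Nat.dvd_of_mul_dvd_mul_left hgp ?_
          rw [← mul_assoc, Nat.mul_div_cancel' (Nat.gcd_dvd_left _ _),
            Nat.mul_div_cancel' (Nat.gcd_dvd_right _ _)]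
          exact h2
        · rw [coeff_eq_zero_of_natDegree_lt (by omega)]; exact dvd_zero _
      intro i hi
      have h4 := dvd_taylor_coeff hd (-(s : ℤ)) i hi
      rwa [ht, taylor_taylor, neg_add_cancel, taylor_zero] at h4
    have h5 := Nat.mul_div_cancel' (Nat.gcd_dvd_left u (w ^ k))
    rw [h1, mul_one] at h5
    rw [← h5]
    exact Nat.gcd_dvd_right _ _

end Renormalise

section IterationStep

open scoped Classical

/-- A set of integers in `[0, N)` without differences that are values of `g`, where `g` is
intersective, primitive and has coefficients bounded by `G`. -/
structure FreeConfiguration (k G : ℕ) (g : ℤ[X]) (N : ℕ) (A : Finset ℤ) : Prop where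
  primitiveBounded : PrimitiveBounded k G g
  intersective : Intersective g
  subset : A ⊆ Finset.Ico (0 : ℤ) N
  free : ∀ x ∈ A, ∀ y ∈ A, x ≠ y → ∀ n : ℤ, x - y ≠ g.eval n

lemma PrimitiveBounded.mono {k : ℕ} {G G' : ℝ} {g : ℤ[X]} (hg : PrimitiveBounded k G g)
    (h : G ≤ G') : PrimitiveBounded k G' g :=
  ⟨hg.natDegree_le, hg.coeff_ne, fun i => (hg.bound i).trans h, hg.primitive⟩

lemma card_filter_eq_sum_classes (J v : ℕ) (hv : 1 ≤ v) (φ : ℕ → Prop) :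
    ((Finset.range J).filter φ).card = ∑ t ∈ Finset.range v,
      ((Finset.range ((J + (v - 1 - t)) / v)).filter fun i => φ (t + v * i)).card := by
  rw [Finset.card_eq_sum_card_fiberwise (f := fun j => j % v) (t := Finset.range v)
    fun j _ => Finset.mem_coe.2 (Finset.mem_range.2 (Nat.mod_lt _ hv))]
  refine Finset.sum_congr rfl fun t ht => ?_
  have htv := Finset.mem_range.1 ht
  have key : ∀ i, i < (J + (v - 1 - t)) / v ↔ t + v * i < J := by
    intro i
    rw [← Nat.succ_le_iff, Nat.le_div_iff_mul_le hv, Nat.succ_mul, mul_comm i v]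
    omega
  refine Finset.card_nbij' (fun j => j / v) (fun i => t + v * i) ?_ ?_ ?_ ?_
  · intro j hj
    simp only [Finset.coe_filter, Finset.mem_filter, Finset.mem_range, Set.mem_ofPred_eq] at hj ⊢
    have h1 : t + v * (j / v) = j := by rw [← hj.2]; exact Nat.mod_add_div j v
    rw [key, h1]
    exact hj.1
  · intro i hi
    simp only [Finset.coe_filter, Finset.mem_filter, Finset.mem_range, Set.mem_ofPred_eq] at hi ⊢
    rw [key] at hi
    exact ⟨hi, by rw [Nat.add_mul_mod_self_left, Nat.mod_eq_of_lt htv]⟩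
  · intro j hj
    simp only [Finset.coe_filter, Finset.mem_filter, Finset.mem_range, Set.mem_ofPred_eq] at hj
    rw [← hj.2]
    exact Nat.mod_add_div j v
  · intro i _
    show (t + v * i) / v = i
    rw [Nat.add_mul_div_left _ _ hv, Nat.div_eq_of_lt htv, zero_add]

lemma exists_class_dense (J v : ℕ) (hv : 1 ≤ v) (φ : ℕ → Prop) (β : ℝ)
    (h : β * J < ((Finset.range J).filter φ).card) : ∃ t len : ℕ, J / v ≤ len ∧
      β * len < ((Finset.range len).filter fun i => φ (t + v * i)).card := by
  have h1 := card_filter_eq_sum_classes J v hv fun _ => True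
  simp only [Finset.filter_true, Finset.card_range] at h1
  have h2 : ∑ t ∈ Finset.range v, β * ((J + (v - 1 - t)) / v : ℕ) <
      ∑ t ∈ Finset.range v,
        (((Finset.range ((J + (v - 1 - t)) / v)).filter fun i => φ (t + v * i)).card : ℝ) := by
    rw [← Finset.mul_sum, ← Nat.cast_sum, ← Nat.cast_sum, ← h1, ← card_filter_eq_sum_classes J v hv]
    exact h
  obtain ⟨t, _, ht⟩ := Finset.exists_lt_of_sum_lt h2
  exact ⟨t, _, Nat.div_le_div_right (Nat.le_add_right _ _), ht⟩

theorem exists_denser_configuration (k : ℕ) (hk : 2 ≤ k) : ∃ K : ℕ, ∀ P : ℕ, 2 * K + 1 ≤ P →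
    ∃ B R₀ : ℕ, ∀ R : ℕ, R₀ ≤ R → ∀ (G : ℕ) (g : ℤ[X]) (N : ℕ) (A : Finset ℤ),
      FreeConfiguration k G g N A → (G * R) ^ B ≤ N → N ≤ A.card * R ^ P →
      ∃ (g' : ℤ[X]) (N' : ℕ) (A' : Finset ℤ), FreeConfiguration k (G * R ^ B) g' N' A' ∧
        N ≤ N' * (G * R) ^ B ∧
        (1 + 1 / (R : ℝ) ^ (K + 1)) * (A.card / N) ≤ A'.card / N' := by
  obtain ⟨K, hK⟩ := exists_density_increment k hk
  refine ⟨K, fun P hP => ?_⟩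
  obtain ⟨B, R₀, hB⟩ := hK P hP
  refine ⟨B + B * k + 2, R₀ + (k + 1) * 2 ^ k + 2, fun R hR G g N A hA hGN hdens => ?_⟩
  have hp1 : 0 ≤ (k + 1) * 2 ^ k := Nat.zero_le _
  have hRk : (k + 1) * 2 ^ k ≤ R := by omega
  have hR2 : 2 ≤ R := by omega
  have hG : 1 ≤ G := by exact_mod_cast hA.primitiveBounded.one_le
  set W := G * R with hW
  have hRW : R ≤ W := Nat.le_mul_of_pos_left _ hG
  have hW1 : 1 ≤ W := by omega
  obtain ⟨w, J, x₀, hw1, hwR, hJ, hinc⟩ := hB R (by omega) G g N A hA.primitiveBounded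
    ((Nat.pow_le_pow_right hW1 (by omega)).trans hGN) hA.subset hdens hA.free
  obtain ⟨u, s, f, hu1, hfe, hf, hfint, hwu, huw⟩ := hA.intersective.exists_primitive (by omega)
    hA.primitiveBounded.natDegree_le hA.primitiveBounded.coeff_ne hA.primitiveBounded.bound hw1
  have huwk : u ∣ w ^ k := huw hA.primitiveBounded.primitive
  obtain ⟨v, rfl⟩ := hwu
  have hv1 : 1 ≤ v := Nat.pos_of_mul_pos_left hu1
  have hwkR : w ^ k ≤ R ^ (B * k) := by
    rw [pow_mul]; gcongr
  have hvR : v ≤ R ^ (B * k) := (Nat.le_mul_of_pos_left _ hw1).trans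
    ((Nat.le_of_dvd (pow_pos hw1 k) huwk).trans hwkR)
  have hvW : v ≤ W ^ (B * k) := hvR.trans (by gcongr)
  obtain ⟨t, len, hlen, ht⟩ := exists_class_dense J v hv1 (fun j : ℕ => x₀ + (w : ℤ) * (j : ℤ) ∈ A)
    ((1 + 1 / (R : ℝ) ^ (K + 1)) * (A.card / N)) (by convert hinc)
  have hinj : Function.Injective (Nat.cast : ℕ → ℤ) := Nat.cast_injective
  refine ⟨f, len, ((Finset.range len).filter fun i : ℕ => x₀ + w * ((t + v * i : ℕ) : ℤ) ∈ A).image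
    (Nat.cast : ℕ → ℤ), ⟨?_, hfint, ?_, ?_⟩, ?_, ?_⟩
  · refine hf.mono ?_
    have h1 : (k + 1) * 2 ^ k * G * w ^ k ≤ G * R ^ (B + B * k + 2) := by
      calc (k + 1) * 2 ^ k * G * w ^ k ≤ R * G * R ^ (B * k) := by gcongr
        _ = G * R ^ (B * k + 1) := by ring
        _ ≤ _ := Nat.mul_le_mul_left _ (Nat.pow_le_pow_right (by omega) (by omega))
    exact_mod_cast h1
  · intro x hx
    obtain ⟨i, hi, rfl⟩ := Finset.mem_image.1 hx
    have := Finset.mem_range.1 (Finset.mem_filter.1 hi).1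
    exact Finset.mem_Ico.2 ⟨by omega, by omega⟩
  · intro x hx y hy hxy n hn
    obtain ⟨i, hi, rfl⟩ := Finset.mem_image.1 hx
    obtain ⟨j, hj, rfl⟩ := Finset.mem_image.1 hy
    have hu0 : ((w * v : ℕ) : ℤ) ≠ 0 := by exact_mod_cast (by omega : w * v ≠ 0)
    have h1 : (x₀ + w * ((t + v * i : ℕ) : ℤ)) - (x₀ + w * ((t + v * j : ℕ) : ℤ)) =
        ((w * v : ℕ) : ℤ) * (i - j) := by push_cast; ring
    refine hA.free _ (Finset.mem_filter.1 hi).2 _ (Finset.mem_filter.1 hj).2 ?_ (s + w * n) ?_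
    · intro h
      rw [h, sub_self] at h1
      exact hxy (sub_eq_zero.1 ((mul_eq_zero.1 h1.symm).resolve_left hu0))
    · rw [h1, hn, hfe]
  · have hJv : v ≤ J := by
      have h1 : W ^ (B * k) * W ^ B ≤ J * W ^ B := by
        refine le_trans ?_ hJ
        refine le_trans ?_ hGN
        rw [← pow_add]
        exact Nat.pow_le_pow_right hW1 (by omega)
      exact hvW.trans (Nat.le_of_mul_le_mul_right h1 (pow_pos hW1 B))
    have hJ1 : 1 ≤ J / v := (Nat.one_le_div_iff hv1).2 hJv
    calc N ≤ J * W ^ B := hJ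
      _ ≤ (v * (J / v + 1)) * W ^ B := by gcongr; exact (Nat.lt_mul_div_succ J hv1).le
      _ ≤ (W ^ (B * k) * (len + len)) * W ^ B := by gcongr; omega
      _ = len * (W ^ (B * k) * W ^ B * 2) := by ring
      _ ≤ len * (W ^ (B * k) * W ^ B * W ^ 2) := by
        gcongr
        exact hR2.trans (hRW.trans (Nat.le_self_pow (by norm_num) W))
      _ = len * W ^ (B + B * k + 2) := by ring
  · rw [Finset.card_image_of_injective _ hinj]
    have hlen0 : 0 < len := by
      rcases Nat.eq_zero_or_pos len with h | h
      · rw [h] at ht; simp at ht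
      · exact h
    rw [le_div_iff₀ (by exact_mod_cast hlen0)]
    convert ht.le

end IterationStep

section Iteration

open scoped Classical

lemma FreeConfiguration.card_le {k G : ℕ} {g : ℤ[X]} {N : ℕ} {A : Finset ℤ}
    (hA : FreeConfiguration k G g N A) : A.card ≤ N := by
  simpa using Finset.card_le_card hA.subset

lemma lt_one_add_inv_pow (E P R : ℕ) (hP : 1 ≤ P) (hR : 1 ≤ R) :
    (R : ℝ) ^ P < (1 + 1 / (R : ℝ) ^ E) ^ (R ^ E * (R * P)) := by
  have hR0 : (0 : ℝ) < (R : ℝ) ^ E := by positivity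
  have h1 : (2 : ℝ) ≤ (1 + 1 / (R : ℝ) ^ E) ^ (R ^ E) := by
    refine le_trans ?_ (one_add_mul_le_pow (le_trans (by norm_num) (by positivity :
      (0 : ℝ) ≤ 1 / (R : ℝ) ^ E)) _)
    push_cast
    rw [mul_one_div_cancel hR0.ne']
    norm_num
  have h2 : (R : ℝ) < 2 ^ R := by exact_mod_cast Nat.lt_two_pow_self
  rw [pow_mul, pow_mul _ R P]
  refine pow_lt_pow_left₀ (h2.trans_le ?_) (by positivity) (by omega)
  gcongr

lemma iteration_size_le (B E P R G : ℕ) (hP : P = 2 * E + 4) (hG : G ≤ R) (hR1 : 1 ≤ R)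
    (hR : 2 * B * (B + 2) * P ^ 2 ≤ R) :
    (((G * R ^ (B * (R ^ E * (R * P))) * R) ^ (B * (R ^ E * (R * P) + 1)) : ℕ) : ℝ) ≤
      Real.exp ((R : ℝ) ^ P) := by
  set T := R ^ E * (R * P) with hT
  have hT1 : 1 ≤ T := Nat.one_le_iff_ne_zero.2 (by rw [hT, hP]; positivity)
  have h1 : (G * R ^ (B * T) * R) ^ (B * (T + 1)) ≤ R ^ ((B * T + 2) * (B * (T + 1))) := by
    rw [pow_mul R (B * T + 2)]
    refine Nat.pow_le_pow_left ?_ _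
    calc G * R ^ (B * T) * R ≤ R * R ^ (B * T) * R := by gcongr
      _ = R ^ (B * T + 2) := by ring
  have h2 : R * ((B * T + 2) * (B * (T + 1))) ≤ R ^ P := by
    calc R * ((B * T + 2) * (B * (T + 1))) ≤
        R * ((B * T + 2 * T) * (B * (T + T))) := by gcongr; omega
      _ = (2 * B * (B + 2) * P ^ 2) * R ^ (2 * E + 3) := by rw [hT]; ring
      _ ≤ R * R ^ (2 * E + 3) := by gcongr
      _ = R ^ P := by rw [hP]; ring
  have h3 : (R : ℝ) ≤ Real.exp R := by linarith [Real.add_one_le_exp (R : ℝ)]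
  calc (((G * R ^ (B * T) * R) ^ (B * (T + 1)) : ℕ) : ℝ) ≤
      ((R ^ ((B * T + 2) * (B * (T + 1))) : ℕ) : ℝ) := by exact_mod_cast h1
    _ = (R : ℝ) ^ ((B * T + 2) * (B * (T + 1))) := by push_cast; rfl
    _ ≤ Real.exp R ^ ((B * T + 2) * (B * (T + 1))) := by gcongr
    _ = Real.exp (((R * ((B * T + 2) * (B * (T + 1))) : ℕ) : ℝ)) := by
      rw [← Real.exp_nat_mul]; congr 1; push_cast; ring
    _ ≤ Real.exp ((R : ℝ) ^ P) := Real.exp_le_exp.2 (by exact_mod_cast h2)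

theorem exists_card_mul_lt (k : ℕ) (hk : 2 ≤ k) : ∃ P : ℕ, 1 ≤ P ∧ ∀ G : ℕ, ∃ R₁ : ℕ,
    ∀ R : ℕ, R₁ ≤ R → ∀ (g : ℤ[X]) (N : ℕ) (A : Finset ℤ), FreeConfiguration k G g N A →
      Real.exp ((R : ℝ) ^ P) ≤ N → A.card * R ^ P < N := by
  obtain ⟨K, hK⟩ := exists_denser_configuration k hk
  obtain ⟨P, hP⟩ : ∃ P, P = 2 * (K + 1) + 4 := ⟨_, rfl⟩
  obtain ⟨B, R₀, hB⟩ := hK P (by omega)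
  refine ⟨P, by omega, fun G => ⟨R₀ + G + 1 + 2 * B * (B + 2) * P ^ 2, fun R hR g N A hA hN => ?_⟩⟩
  by_contra hcon
  push Not at hcon
  have hpos : 0 ≤ 2 * B * (B + 2) * P ^ 2 := Nat.zero_le _
  have hR1 : 1 ≤ R := by omega
  have hG : 1 ≤ G := by exact_mod_cast hA.primitiveBounded.one_le
  have hsize := (iteration_size_le B (K + 1) P R G hP (by omega) hR1 (by omega)).trans hN
  have hlt := lt_one_add_inv_pow (K + 1) P R (by omega) hR1
  set T := R ^ (K + 1) * (R * P) with hT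
  set W := G * R ^ (B * T) * R with hW
  have hW1 : 1 ≤ W := Nat.one_le_iff_ne_zero.2 (by positivity)
  have hsize' : W ^ (B * (T + 1)) ≤ N := by exact_mod_cast hsize
  have hN1 : 1 ≤ N := (Nat.one_le_pow _ _ hW1).trans hsize'
  have hN0 : (0 : ℝ) < N := by exact_mod_cast hN1
  have hRP : (0 : ℝ) < (R : ℝ) ^ P := by positivity
  have hdens : 1 / (R : ℝ) ^ P ≤ A.card / N := by
    rw [div_le_div_iff₀ hRP hN0, one_mul]
    exact_mod_cast hcon
  have hd0 : (0 : ℝ) ≤ A.card / N := by positivity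
  have hε : (1 : ℝ) ≤ 1 + 1 / (R : ℝ) ^ (K + 1) := by
    have : (0 : ℝ) ≤ 1 / (R : ℝ) ^ (K + 1) := by positivity
    linarith
  have step : ∀ t, t ≤ T → ∃ (g' : ℤ[X]) (N' : ℕ) (A' : Finset ℤ),
      FreeConfiguration k (G * R ^ (B * t)) g' N' A' ∧ N ≤ N' * W ^ (B * t) ∧
      (1 + 1 / (R : ℝ) ^ (K + 1)) ^ t * (A.card / N) ≤ A'.card / N' := by
    intro t
    induction t with
    | zero => exact fun _ => ⟨g, N, A, by simpa using hA, by simp, by simp⟩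
    | succ t ih =>
      intro ht
      obtain ⟨g', N', A', hA', hNN', hd⟩ := ih (by omega)
      have hGW : G * R ^ (B * t) * R ≤ W := by
        rw [hW]
        gcongr
        omega
      have hN'1 : 1 ≤ N' := by
        rcases Nat.eq_zero_or_pos N' with h | h
        · rw [h, zero_mul] at hNN'; omega
        · exact h
      have hWN' : W ^ B ≤ N' := by
        have h1 : W ^ B * W ^ (B * t) ≤ N' * W ^ (B * t) := by
          refine le_trans ?_ (hsize'.trans hNN')
          rw [← pow_add]
          refine Nat.pow_le_pow_right hW1 ?_
          have : B * (t + 1) ≤ B * (T + 1) := Nat.mul_le_mul_left _ (by omega)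
          linarith
        exact Nat.le_of_mul_le_mul_right h1 (pow_pos hW1 _)
      have hd' : 1 / (R : ℝ) ^ P ≤ A'.card / N' :=
        hdens.trans ((le_mul_of_one_le_left hd0 (one_le_pow₀ hε)).trans hd)
      rw [div_le_div_iff₀ hRP (by exact_mod_cast hN'1), one_mul] at hd'
      obtain ⟨g₂, N₂, A₂, hA₂, hN₂, hd₂⟩ := hB R (by omega) _ g' N' A' hA'
        ((Nat.pow_le_pow_left hGW B).trans hWN') (by exact_mod_cast hd')
      refine ⟨g₂, N₂, A₂, ?_, ?_, ?_⟩
      · rw [mul_assoc, ← pow_add] at hA₂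
        exact hA₂
      · calc N ≤ N' * W ^ (B * t) := hNN'
          _ ≤ N₂ * W ^ B * W ^ (B * t) := by
            gcongr
            exact hN₂.trans (by gcongr)
          _ = N₂ * W ^ (B * (t + 1)) := by ring
      · refine le_trans ?_ hd₂
        rw [pow_succ', mul_assoc]
        gcongr
  obtain ⟨g', N', A', hA', -, hd⟩ := step T le_rfl
  have h1 : (A'.card : ℝ) / N' ≤ 1 :=
    div_le_one_of_le₀ (by exact_mod_cast hA'.card_le) (by positivity)
  have h2 : 1 < (1 + 1 / (R : ℝ) ^ (K + 1)) ^ T * (A.card / N) := by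
    calc (1 : ℝ) = (R : ℝ) ^ P * (1 / (R : ℝ) ^ P) := by field_simp
      _ < (1 + 1 / (R : ℝ) ^ (K + 1)) ^ T * (1 / (R : ℝ) ^ P) := by gcongr
      _ ≤ _ := by gcongr
  linarith

end Iteration

section Conclusion

lemma exists_root_parameter (P R₁ : ℕ) (hP : 1 ≤ P) (x : ℝ) (hx : ((R₁ : ℝ) + 1) ^ P ≤ x) :
    ∃ R : ℕ, R₁ ≤ R ∧ (R : ℝ) ^ P ≤ x ∧ x ≤ (2 * (R : ℝ)) ^ P := by
  have hx0 : 0 ≤ x := le_trans (by positivity) hx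
  have hP0 : (P : ℝ) ≠ 0 := by exact_mod_cast (by omega : P ≠ 0)
  have hroot : (x ^ (1 / (P : ℝ))) ^ P = x := by
    rw [← Real.rpow_natCast, ← Real.rpow_mul hx0, one_div_mul_cancel hP0, Real.rpow_one]
  have hy0 : 0 ≤ x ^ (1 / (P : ℝ)) := Real.rpow_nonneg hx0 _
  set y := x ^ (1 / (P : ℝ)) with hy
  have h1 : (R₁ : ℝ) + 1 ≤ y := by
    refine le_of_pow_le_pow_left₀ (by omega : P ≠ 0) hy0 ?_
    rw [hroot]
    exact hx
  have h2 : R₁ + 1 ≤ ⌊y⌋₊ := Nat.le_floor (by exact_mod_cast h1)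
  refine ⟨⌊y⌋₊, by omega, ?_, ?_⟩
  · calc ((⌊y⌋₊ : ℝ)) ^ P ≤ y ^ P := by gcongr; exact Nat.floor_le hy0
      _ = x := hroot
  · have h3 := Nat.lt_floor_add_one y
    have h4 : (1 : ℝ) ≤ ⌊y⌋₊ := by exact_mod_cast (by omega : 1 ≤ ⌊y⌋₊)
    calc x = y ^ P := hroot.symm
      _ ≤ (2 * (⌊y⌋₊ : ℝ)) ^ P := by gcongr; linarith

/-- A set without differences that are values of an intersective polynomial has size
`O(N / log N)`. -/
theorem exists_card_le_div_log (h : ℤ[X]) (k : ℕ) (hk : 2 ≤ k) (hdeg : h.natDegree = k)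
    (hint : Intersective h) : ∃ C : ℝ, 0 < C ∧ ∃ N₀ : ℕ, ∀ N : ℕ, N₀ ≤ N → ∀ φ : ℕ → Prop,
      (∀ i j, φ i → φ j → i ≠ j → ∀ n : ℤ, (i : ℤ) - j ≠ h.eval n) →
      ∀ [DecidablePred φ],
      (((Finset.range N).filter φ).card : ℝ) ≤ C * N / Real.log N := by
  classical
  obtain ⟨P, hP, hiter⟩ := exists_card_mul_lt k hk
  have hcoeff : ∀ i, |(h.coeff i : ℝ)| ≤ ∑ i ∈ h.support, |(h.coeff i : ℝ)| := by
    intro i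
    by_cases hi : i ∈ h.support
    · exact Finset.single_le_sum (f := fun i => |(h.coeff i : ℝ)|) (fun _ _ => abs_nonneg _) hi
    · rw [notMem_support_iff.1 hi]
      simpa using Finset.sum_nonneg fun i _ => abs_nonneg (h.coeff i : ℝ)
  have hlead : h.coeff k ≠ 0 := by
    rw [← hdeg]
    refine leadingCoeff_ne_zero.2 fun h0 => ?_
    rw [h0, natDegree_zero] at hdeg
    omega
  obtain ⟨u, s, f, hu1, hfe, hf, hfint, -, -⟩ := hint.exists_primitive (w := 1) (by omega)
    hdeg.le hlead hcoeff le_rfl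
  obtain ⟨G, hf'⟩ : ∃ G : ℕ, PrimitiveBounded k G f := ⟨_, hf.mono (Nat.le_ceil _)⟩
  obtain ⟨R₁, hR₁⟩ := hiter G
  refine ⟨2 * 2 ^ P, by positivity, ⌈Real.exp (2 * ((R₁ : ℝ) + 1) ^ P)⌉₊ + (2 * u) ^ 2,
    fun N hN φ hφ _ => ?_⟩
  have hN₁ : Real.exp (2 * ((R₁ : ℝ) + 1) ^ P) ≤ N :=
    (Nat.le_ceil _).trans (by exact_mod_cast (Nat.le_add_right _ _).trans hN)
  have hN₂ : (2 * u) ^ 2 ≤ N := (Nat.le_add_left _ _).trans hN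
  have hN0 : (0 : ℝ) < N := (Real.exp_pos _).trans_le hN₁
  have hlog : 2 * ((R₁ : ℝ) + 1) ^ P ≤ Real.log N := (Real.le_log_iff_exp_le hN0).2 hN₁
  have hlog0 : 0 < Real.log N := lt_of_lt_of_le (by positivity) hlog
  obtain ⟨R, hR, hRx, hxR⟩ := exists_root_parameter P R₁ hP (Real.log N / 2) (by linarith)
  have hRP : (0 : ℝ) < (R : ℝ) ^ P := by
    rw [mul_pow] at hxR
    by_contra hneg
    nlinarith [pow_pos (two_pos : (0 : ℝ) < 2) P, pow_nonneg (Nat.cast_nonneg (α := ℝ) R) P]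
  by_contra hcon
  push Not at hcon
  have hdense : 1 / (R : ℝ) ^ P * N < ((Finset.range N).filter φ).card := by
    refine lt_of_le_of_lt ?_ hcon
    rw [one_div_mul_eq_div, div_le_div_iff₀ hRP hlog0]
    rw [mul_pow] at hxR
    nlinarith
  obtain ⟨t, len, hlen, ht⟩ := exists_class_dense N u hu1 φ (1 / (R : ℝ) ^ P) (by convert hdense)
  have hconf : FreeConfiguration k G f len (((Finset.range len).filter fun i : ℕ =>
      φ (t + u * i)).image (Nat.cast : ℕ → ℤ)) := by
    refine ⟨hf', hfint, ?_, ?_⟩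
    · intro x hx
      obtain ⟨i, hi, rfl⟩ := Finset.mem_image.1 hx
      have := Finset.mem_range.1 (Finset.mem_filter.1 hi).1
      exact Finset.mem_Ico.2 ⟨by omega, by omega⟩
    · intro x hx y hy hxy n hn
      obtain ⟨i, hi, rfl⟩ := Finset.mem_image.1 hx
      obtain ⟨j, hj, rfl⟩ := Finset.mem_image.1 hy
      refine hφ _ _ (Finset.mem_filter.1 hi).2 (Finset.mem_filter.1 hj).2 ?_ (s + (1 : ℕ) * n) ?_
      · intro hij
        refine hxy ?_
        rw [Nat.eq_of_mul_eq_mul_left hu1 (Nat.add_left_cancel hij)]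
      · rw [← hfe, ← hn]
        push_cast
        ring
  have hlenexp : Real.exp ((R : ℝ) ^ P) ≤ len := by
    have h1 : Real.exp (Real.log N / 2) ≤ len := by
      rw [Real.exp_half, Real.exp_log hN0]
      have h2 : 2 * (u : ℝ) ≤ √N := Real.le_sqrt_of_sq_le (by exact_mod_cast hN₂)
      have h3 : (N : ℝ) ≤ u * (len + 1) := by
        have : N ≤ u * (len + 1) := (Nat.lt_mul_div_succ N hu1).le.trans (by gcongr)
        exact_mod_cast this
      have h4 : √(N : ℝ) * √N = N := Real.mul_self_sqrt hN0.le
      have hu1' : (1 : ℝ) ≤ u := by exact_mod_cast hu1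
      nlinarith [Real.sqrt_nonneg (N : ℝ)]
    exact (Real.exp_le_exp.2 hRx).trans h1
  have hend := hR₁ R hR f len _ hconf hlenexp
  rw [Finset.card_image_of_injective _ Nat.cast_injective] at hend
  have hend' : ((((Finset.range len).filter fun i : ℕ => φ (t + u * i)).card : ℝ)) * (R : ℝ) ^ P <
    len := by exact_mod_cast hend
  have ht' : (len : ℝ) < ((Finset.range len).filter fun i : ℕ => φ (t + u * i)).card *
      (R : ℝ) ^ P := by
    rw [one_div_mul_eq_div, div_lt_iff₀ hRP] at ht
    refine ht.trans_le (le_of_eq ?_)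
    congr!
  exact lt_asymm hend' ht'

end Conclusion

/-- **Lucier's quantitative bound.** Let `h ∈ ℤ[x]` be an intersective polynomial of degree
`k ≥ 2`. Any subset of `{1, …, N}` containing no two distinct elements differing by a value
`h(n)` has size at most `C · N · (log log N)^{μ/(k-1)} / (log N)^{1/(k-1)}`, where `μ = 3`
if `k = 2` and `μ = 2` if `k ≥ 3`, for `N` sufficiently large depending on `h`. -/
theorem lucier_quantitative_bound (h : Polynomial ℤ) (k : ℕ) (hk : 2 ≤ k)
    (hdeg : h.natDegree = k)
    (hint : ∀ d : ℕ, 0 < d → ∃ n : ℤ, (d : ℤ) ∣ h.eval n) :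
    ∃ C : ℝ, 0 < C ∧ ∃ N₀ : ℕ, ∀ N : ℕ, N₀ ≤ N →
      ∀ A : Finset ℕ, A ⊆ Finset.Icc 1 N →
        (∀ a ∈ A, ∀ a' ∈ A, a ≠ a' → ¬ ∃ n : ℤ, (a : ℤ) - (a' : ℤ) = h.eval n) →
        (A.card : ℝ) ≤ C * (N : ℝ) *
          (Real.log (Real.log N)) ^ ((if k = 2 then (3 : ℝ) else 2) / ((k : ℝ) - 1)) /
            (Real.log N) ^ ((1 : ℝ) / ((k : ℝ) - 1)) := by
  obtain ⟨C, hC, N₀, hN₀⟩ := exists_card_le_div_log h k hk hdeg hint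
  refine ⟨C, hC, N₀ + ⌈Real.exp (Real.exp 1)⌉₊, fun N hN A hA hfree => ?_⟩
  have hexp : Real.exp (Real.exp 1) ≤ N :=
    (Nat.le_ceil _).trans (by exact_mod_cast (Nat.le_add_left _ _).trans hN)
  have hN0 : (0 : ℝ) < N := (Real.exp_pos _).trans_le hexp
  have hlog : Real.exp 1 ≤ Real.log N := (Real.le_log_iff_exp_le hN0).2 hexp
  have hlog0 : 0 < Real.log N := (Real.exp_pos _).trans_le hlog
  have hlog1 : 1 ≤ Real.log N := le_trans (by linarith [Real.add_one_le_exp (1 : ℝ)]) hlog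
  have hloglog : 1 ≤ Real.log (Real.log N) := (Real.le_log_iff_exp_le hlog0).2 hlog
  have hk1 : (1 : ℝ) ≤ k - 1 := by
    have : (2 : ℝ) ≤ k := by exact_mod_cast hk
    linarith
  have hcard : A.card = ((Finset.range N).filter fun i => i + 1 ∈ A).card := by
    refine Finset.card_nbij' (fun a => a - 1) (fun i => i + 1) ?_ ?_ ?_ ?_
    · intro a ha
      have h1 := Finset.mem_Icc.1 (hA ha)
      simp only [Finset.coe_filter, Finset.mem_range, Set.mem_ofPred_eq]
      refine ⟨by omega, ?_⟩
      rw [Nat.sub_add_cancel h1.1]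
      exact ha
    · intro i hi
      exact (Finset.mem_filter.1 hi).2
    · intro a ha
      have h1 := Finset.mem_Icc.1 (hA ha)
      exact Nat.sub_add_cancel h1.1
    · intro i _
      rfl
  have hmain := hN₀ N (by omega) (fun i => i + 1 ∈ A) fun i j hi hj hij n hn =>
    hfree _ hi _ hj (by omega) ⟨n, by push_cast; linarith⟩
  rw [hcard]
  refine hmain.trans ?_
  have hpow : Real.log N ^ ((1 : ℝ) / ((k : ℝ) - 1)) ≤ Real.log N := by
    conv_rhs => rw [← Real.rpow_one (Real.log N)]
    exact Real.rpow_le_rpow_of_exponent_le hlog1 (div_le_one_of_le₀ hk1 (by linarith))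
  have hpow' : 1 ≤ Real.log (Real.log N) ^ ((if k = 2 then (3 : ℝ) else 2) / ((k : ℝ) - 1)) :=
    Real.one_le_rpow hloglog (div_nonneg (by split_ifs <;> norm_num) (by linarith))
  have hCN : 0 ≤ C * (N : ℝ) := by positivity
  exact div_le_div₀ (by positivity) (le_mul_of_one_le_right hCN hpow')
    (Real.rpow_pos_of_pos hlog0 _) hpow
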